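/- arXiv:2405.03812 — 6 statements merged into one kernel-verified Lean document; each statement's English description precedes it below -/
import Mathlib

section
/- Let k be any field and n a positive integer. Let the symmetric group S_n act on the rational function field k(x_1,…,x_n,y_1,…,y_n) in 2n variables by permuting the x's and y's simultaneously: g·x_i = x_{g(i)} and g·y_i = y_{g(i)}. Then the fixed field k(x_1,…,x_n,y_1,…,y_n)^{S_n} is purely transcendental over k of transcendence degree 2n. -/
open MvPolynomial

/-- A field generated over `F` by finitely many distinct elements, namely the roots of a polynomial
over `F` which splits into distinct linear factors, is a finite Galois extension of `F`. -/
theorem isGalois_and_finiteDimensional_of_prod_X_sub_C {F E ι : Type*} [Field F] [Field E]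
    [Algebra F E] [Fintype ι] {x : ι → E} (hx : Function.Injective x) {p : Polynomial F}
    (hp : p.map (algebraMap F E) = ∏ i, (Polynomial.X - Polynomial.C (x i)))
    (hgen : IntermediateField.adjoin F (Set.range x) = ⊤) :
    IsGalois F E ∧ FiniteDimensional F E := by
  have hsep : p.Separable := by
    rw [← Polynomial.separable_map (algebraMap F E), hp, Polynomial.separable_prod_X_sub_C_iff]
    exact hx
  have hroots : p.rootSet E = Set.range x := by
    ext a
    rw [Polynomial.mem_rootSet', Polynomial.aeval_def, ← Polynomial.eval_map, hp,
      and_iff_right (Polynomial.monic_prod_X_sub_C _ _).ne_zero, Polynomial.eval_prod,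
      Finset.prod_eq_zero_iff]
    simp [sub_eq_zero, eq_comm]
  have : p.IsSplittingField F E := by
    rw [isSplittingField_iff_intermediateField, hroots]
    refine ⟨?_, hgen⟩
    rw [hp]
    exact Polynomial.Splits.prod fun i _ ↦ Polynomial.Splits.X_sub_C _
  exact ⟨IsGalois.of_separable_splitting_field hsep,
    Polynomial.IsSplittingField.finiteDimensional E p⟩

/-- An intermediate field containing distinct elements `x i` and the power sums of the `x i`
weighted by the `y i` contains the weights `y i`. -/
theorem IntermediateField.mem_of_sum_mul_pow_mem {F E : Type*} [Field F] [Field E] [Algebra F E]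
    {n : ℕ} {x y : Fin n → E} (hx : Function.Injective x) (M : IntermediateField F E)
    (hxM : ∀ i, x i ∈ M) (hM : ∀ j : Fin n, ∑ i, y i * x i ^ (j : ℕ) ∈ M) (i : Fin n) :
    y i ∈ M := by
  let x' : Fin n → M := fun i ↦ ⟨x i, hxM i⟩
  let z : Fin n → M := fun j ↦ ⟨_, hM j⟩
  have hx' : Function.Injective x' := fun a b h ↦ hx (congrArg Subtype.val h)
  have hdet : IsUnit (Matrix.vandermonde x').det :=
    (Matrix.det_vandermonde_ne_zero_iff.mpr hx').isUnit
  let w : Fin n → M := Matrix.vecMul z (Matrix.vandermonde x')⁻¹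
  have hw : Matrix.vecMul w (Matrix.vandermonde x') = z := by
    simp [w, Matrix.vecMul_vecMul, Matrix.nonsing_inv_mul _ hdet]
  have hzero : (fun i ↦ y i - (w i : E)) = 0 := by
    refine Matrix.eq_zero_of_forall_pow_sum_mul_pow_eq_zero hx fun j ↦ ?_
    have hj : ∑ i, (w i : E) * x i ^ (j : ℕ) = ∑ i, y i * x i ^ (j : ℕ) := by
      simpa [Matrix.vecMul, dotProduct, Matrix.vandermonde_apply, x', z] using
        congrArg Subtype.val (congrFun hw j)
    simp only [sub_mul, Finset.sum_sub_distrib, hj, sub_self]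
  have hi : y i = w i := sub_eq_zero.mp (congrFun hzero i)
  exact hi ▸ (w i).2

/-- The nonleading coefficients of `∏ i, (T - x i)`, together with the power sums of the `x i`
weighted by the `y i`. -/
noncomputable def multisymmetricGenerators {K : Type*} [Field K] {n : ℕ} (x y : Fin n → K) :
    Fin n ⊕ Fin n → K :=
  Sum.elim (fun j ↦ (∏ i, (Polynomial.X - Polynomial.C (x i))).coeff j)
    (fun j ↦ ∑ i, y i * x i ^ (j : ℕ))

section

variable {k K : Type*} [Field k] [Field K] [Algebra k K] {n : ℕ} {x y : Fin n → K}

theorem exists_map_eq_prod_X_sub_C (x y : Fin n → K) :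
    ∃ p : Polynomial (IntermediateField.adjoin k (Set.range (multisymmetricGenerators x y))),
      p.map (algebraMap _ K) = ∏ i, (Polynomial.X - Polynomial.C (x i)) := by
  set P : Polynomial K := ∏ i, (Polynomial.X - Polynomial.C (x i)) with hP
  rw [← Polynomial.mem_lifts, Polynomial.lifts_iff_coeff_lifts]
  have hmonic : P.Monic := Polynomial.monic_prod_X_sub_C _ _
  have hdeg : P.natDegree = n := by simp [hP]
  intro m
  rcases lt_trichotomy m n with hm | rfl | hm
  · exact ⟨⟨P.coeff m, IntermediateField.subset_adjoin _ _ ⟨.inl ⟨m, hm⟩, rfl⟩⟩, rfl⟩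
  · exact ⟨1, by rw [map_one, ← hmonic.coeff_natDegree, hdeg]⟩
  · exact ⟨0, by rw [map_zero, Polynomial.coeff_eq_zero_of_natDegree_lt (hdeg.trans_lt hm)]⟩

theorem adjoin_range_eq_top_of_multisymmetricGenerators (hx : Function.Injective x)
    (hgen : IntermediateField.adjoin k (Set.range (Sum.elim x y)) = ⊤) :
    IntermediateField.adjoin
      (IntermediateField.adjoin k (Set.range (multisymmetricGenerators x y))) (Set.range x) =
        ⊤ := by
  set L := IntermediateField.adjoin k (Set.range (multisymmetricGenerators x y))
  set M := IntermediateField.adjoin L (Set.range x)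
  have hxM : ∀ i, x i ∈ M := fun i ↦ IntermediateField.subset_adjoin _ _ ⟨i, rfl⟩
  have hyM : ∀ i, y i ∈ M := IntermediateField.mem_of_sum_mul_pow_mem hx M hxM fun j ↦
    M.algebraMap_mem ⟨_, IntermediateField.subset_adjoin _ _ ⟨.inr j, rfl⟩⟩
  rw [← IntermediateField.restrictScalars_eq_top_iff (K := k), eq_top_iff, ← hgen,
    IntermediateField.adjoin_le_iff]
  rintro _ ⟨i | i, rfl⟩
  exacts [hxM i, hyM i]

theorem isGalois_adjoin_multisymmetricGenerators (hx : Function.Injective x)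
    (hgen : IntermediateField.adjoin k (Set.range (Sum.elim x y)) = ⊤) :
    IsGalois (IntermediateField.adjoin k (Set.range (multisymmetricGenerators x y))) K ∧
      FiniteDimensional
        (IntermediateField.adjoin k (Set.range (multisymmetricGenerators x y))) K := by
  obtain ⟨p, hp⟩ := exists_map_eq_prod_X_sub_C (k := k) x y
  exact isGalois_and_finiteDimensional_of_prod_X_sub_C hx hp
    (adjoin_range_eq_top_of_multisymmetricGenerators hx hgen)

theorem algebraicIndependent_multisymmetricGenerators
    (hind : AlgebraicIndependent k (Sum.elim x y))
    (hgen : IntermediateField.adjoin k (Set.range (Sum.elim x y)) = ⊤) :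
    AlgebraicIndependent k (multisymmetricGenerators x y) := by
  have hx : Function.Injective x := hind.injective.comp Sum.inl_injective
  have := (isGalois_adjoin_multisymmetricGenerators hx hgen).2
  have : Algebra.IsAlgebraic
      (Algebra.adjoin k (Set.range (multisymmetricGenerators x y))) K :=
    open scoped IntermediateField.algebraAdjoinAdjoin in
    .trans _ (IntermediateField.adjoin k (Set.range (multisymmetricGenerators x y))) _
  exact (Algebra.IsAlgebraic.isTranscendenceBasis_of_lift_le_trdeg_of_finite k
    (multisymmetricGenerators x y) hind.lift_cardinalMk_le_trdeg).1

/-- An automorphism fixing the generators permutes the `x i` and the `y i` simultaneously. -/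
theorem exists_perm_of_forall_multisymmetricGenerators_eq (hx : Function.Injective x)
    (σ : K ≃ₐ[k] K)
    (hσ : ∀ j, σ (multisymmetricGenerators x y j) = multisymmetricGenerators x y j) :
    ∃ g : Equiv.Perm (Fin n), (∀ i, σ (x i) = x (g i)) ∧ ∀ i, σ (y i) = y (g i) := by
  have hL : ∀ a ∈ IntermediateField.adjoin k (Set.range (multisymmetricGenerators x y)),
      σ a = a :=
    (IntermediateField.forall_mem_adjoin_smul_eq_self_iff k σ).mpr (Set.forall_mem_range.mpr hσ)
  have hroot : ∀ i, ∃ j, σ (x i) = x j := by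
    intro i
    obtain ⟨p, hp⟩ := exists_map_eq_prod_X_sub_C (k := k) x y
    have hmap : (∏ i, (Polynomial.X - Polynomial.C (x i))).map (σ : K →+* K) =
        ∏ i, (Polynomial.X - Polynomial.C (x i)) := by
      rw [← hp, Polynomial.map_map]
      congr 1
      exact RingHom.ext fun a ↦ hL a a.2
    have h0 : (∏ i, (Polynomial.X - Polynomial.C (x i))).eval (σ (x i)) = 0 := by
      rw [← hmap]
      have : (∏ i, (Polynomial.X - Polynomial.C (x i))).eval (x i) = 0 := by
        rw [Polynomial.eval_prod]
        exact Finset.prod_eq_zero (Finset.mem_univ i) (by simp)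
      have h := Polynomial.eval_map_apply (f := (σ : K →+* K)) (x i)
        (p := ∏ i, (Polynomial.X - Polynomial.C (x i)))
      rw [this, map_zero] at h
      exact h
    rw [Polynomial.eval_prod, Finset.prod_eq_zero_iff] at h0
    obtain ⟨j, -, hj⟩ := h0
    exact ⟨j, by simpa [sub_eq_zero] using hj⟩
  choose g hg using hroot
  have hginj : Function.Injective g := fun a b h ↦
    hx (σ.injective (by rw [hg, hg, h]))
  let e : Equiv.Perm (Fin n) := Equiv.ofBijective g (Finite.injective_iff_bijective.mp hginj)
  refine ⟨e, hg, fun i ↦ ?_⟩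
  have hzero : (fun i ↦ σ (y i) - y (e i)) = 0 := by
    refine Matrix.eq_zero_of_forall_pow_sum_mul_pow_eq_zero (hx.comp hginj) fun j ↦ ?_
    have h1 : ∑ i, σ (y i) * x (g i) ^ (j : ℕ) = ∑ i, y i * x i ^ (j : ℕ) := by
      simpa [multisymmetricGenerators, hg] using hσ (.inr j)
    have h2 := Equiv.sum_comp e fun i ↦ y i * x i ^ (j : ℕ)
    simp only [sub_mul, Finset.sum_sub_distrib, Function.comp_apply, h1]
    exact sub_eq_zero.mpr h2.symm
  exact sub_eq_zero.mp (congrFun hzero i)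

theorem map_multisymmetricGenerators (σ : K ≃ₐ[k] K) (g : Equiv.Perm (Fin n))
    (hx : ∀ i, σ (x i) = x (g i)) (hy : ∀ i, σ (y i) = y (g i)) (j : Fin n ⊕ Fin n) :
    σ (multisymmetricGenerators x y j) = multisymmetricGenerators x y j := by
  rcases j with j | j
  · have hmap : (∏ i, (Polynomial.X - Polynomial.C (x i))).map (σ : K →+* K) =
        ∏ i, (Polynomial.X - Polynomial.C (x i)) := by
      simpa [Polynomial.map_prod, hx] using
        Equiv.prod_comp g fun i ↦ Polynomial.X - Polynomial.C (x i)
    have h := congrArg (fun p ↦ p.coeff j) hmap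
    rwa [Polynomial.coeff_map] at h
  · simpa [multisymmetricGenerators, hx, hy] using
      Equiv.sum_comp g fun i ↦ y i * x i ^ (j : ℕ)

theorem fixedField_range_eq_adjoin_multisymmetricGenerators (hx : Function.Injective x)
    (hgen : IntermediateField.adjoin k (Set.range (Sum.elim x y)) = ⊤)
    (φ : Equiv.Perm (Fin n) →* (K ≃ₐ[k] K)) (hφx : ∀ g i, φ g (x i) = x (g i))
    (hφy : ∀ g i, φ g (y i) = y (g i)) :
    IntermediateField.fixedField φ.range =
      IntermediateField.adjoin k (Set.range (multisymmetricGenerators x y)) := by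
  apply le_antisymm
  · intro a ha
    obtain ⟨_, _⟩ := isGalois_adjoin_multisymmetricGenerators hx hgen
    rw [IntermediateField.mem_fixedField_iff] at ha
    obtain ⟨b, rfl⟩ := (IsGalois.mem_range_algebraMap_iff_fixed
      (F := IntermediateField.adjoin k (Set.range (multisymmetricGenerators x y))) a).mpr (by
        intro σ
        obtain ⟨g, hgx, hgy⟩ := exists_perm_of_forall_multisymmetricGenerators_eq (k := k)
          (y := y) hx (σ.restrictScalars k) fun j ↦
            σ.commutes ⟨_, IntermediateField.subset_adjoin _ _ ⟨j, rfl⟩⟩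
        have heq : ∀ b ∈ IntermediateField.adjoin k (Set.range (Sum.elim x y)),
            ((φ g)⁻¹ * σ.restrictScalars k) • b = b := by
          rw [IntermediateField.forall_mem_adjoin_smul_eq_self_iff, Set.forall_mem_range]
          rintro (i | i)
          · exact (φ g).symm_apply_eq.mpr ((hgx i).trans (hφx g i).symm)
          · exact (φ g).symm_apply_eq.mpr ((hgy i).trans (hφy g i).symm)
        have hga := (φ g).symm_apply_eq.mp (heq a (hgen ▸ IntermediateField.mem_top))
        exact hga.trans (ha _ ⟨g, rfl⟩))
    exact b.2
  · rw [IntermediateField.adjoin_le_iff]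
    rintro _ ⟨j, rfl⟩
    rw [SetLike.mem_coe, IntermediateField.mem_fixedField_iff]
    rintro _ ⟨g, rfl⟩
    exact map_multisymmetricGenerators (φ g) g (hφx g) (hφy g) j

end

/-- A fraction field of a polynomial ring over `k` is generated over `k` by the variables. -/
theorem IntermediateField.adjoin_range_algebraMap_X_eq_top (k ι K : Type*) [Field k] [Field K]
    [Algebra k K] [Algebra (MvPolynomial ι k) K] [IsScalarTower k (MvPolynomial ι k) K]
    [IsFractionRing (MvPolynomial ι k) K] :
    IntermediateField.adjoin k
      (Set.range fun i ↦ algebraMap (MvPolynomial ι k) K (X i)) = ⊤ := by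
  set M := IntermediateField.adjoin k (Set.range fun i ↦ algebraMap (MvPolynomial ι k) K (X i))
  have hpoly : ∀ p : MvPolynomial ι k, algebraMap _ K p ∈ M := by
    intro p
    induction p using MvPolynomial.induction_on with
    | C a =>
      rw [← MvPolynomial.algebraMap_eq, ← IsScalarTower.algebraMap_apply]
      exact M.algebraMap_mem a
    | add p q hp hq => rw [map_add]; exact add_mem hp hq
    | mul_X p i hp =>
      rw [map_mul]
      exact mul_mem hp (IntermediateField.subset_adjoin _ _ ⟨i, rfl⟩)
  rw [eq_top_iff]
  rintro a -
  obtain ⟨p, q, -, rfl⟩ := IsFractionRing.div_surjective (A := MvPolynomial ι k) a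
  exact div_mem (hpoly p) (hpoly q)

/-- **Noether's problem for the doubled permutation action of `S_n` (Miyata).**
Let `k` be any field and `n` a positive integer.  Let `K` be the rational function field
`k(x_1, …, x_n, y_1, …, y_n)` in `2n` variables (the fraction field of the polynomial ring in
the variables indexed by `Fin n ⊕ Fin n`, the `x`'s being indexed by `Sum.inl` and the `y`'s by
`Sum.inr`), and let `S_n` act by `k`-algebra automorphisms permuting the `x`'s and `y`'s
simultaneously: `g • x_i = x_{g i}` and `g • y_i = y_{g i}`, encoded by the homomorphism `φ`.
Then the fixed field `K^{S_n}` is purely transcendental over `k` of transcendence degree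
`2n`. -/
theorem symmetricGroup_doubled_fixedField_is_rational
    (k : Type*) [Field k] (n : ℕ) (hn : 0 < n)
    (K : Type*) [Field K] [Algebra k K]
    [Algebra (MvPolynomial (Fin n ⊕ Fin n) k) K]
    [IsScalarTower k (MvPolynomial (Fin n ⊕ Fin n) k) K]
    [IsFractionRing (MvPolynomial (Fin n ⊕ Fin n) k) K]
    (φ : Equiv.Perm (Fin n) →* (K ≃ₐ[k] K))
    (hφx : ∀ (g : Equiv.Perm (Fin n)) (i : Fin n),
      φ g (algebraMap (MvPolynomial (Fin n ⊕ Fin n) k) K (X (Sum.inl i))) =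
        algebraMap (MvPolynomial (Fin n ⊕ Fin n) k) K (X (Sum.inl (g i))))
    (hφy : ∀ (g : Equiv.Perm (Fin n)) (i : Fin n),
      φ g (algebraMap (MvPolynomial (Fin n ⊕ Fin n) k) K (X (Sum.inr i))) =
        algebraMap (MvPolynomial (Fin n ⊕ Fin n) k) K (X (Sum.inr (g i)))) :
    Nonempty (↥(IntermediateField.fixedField φ.range) ≃ₐ[k]
      FractionRing (MvPolynomial (Fin (2 * n)) k)) := by
  let x : Fin n → K := fun i ↦ algebraMap (MvPolynomial (Fin n ⊕ Fin n) k) K (X (Sum.inl i))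
  let y : Fin n → K := fun i ↦ algebraMap (MvPolynomial (Fin n ⊕ Fin n) k) K (X (Sum.inr i))
  have hxy : Sum.elim x y = fun i ↦ algebraMap (MvPolynomial (Fin n ⊕ Fin n) k) K (X i) := by
    ext (i | i) <;> rfl
  have hind : AlgebraicIndependent k (Sum.elim x y) := by
    rw [hxy]
    exact (algebraicIndependent_X (Fin n ⊕ Fin n) k).map'
      (f := IsScalarTower.toAlgHom k (MvPolynomial (Fin n ⊕ Fin n) k) K)
      (IsFractionRing.injective _ _)
  have hgen : IntermediateField.adjoin k (Set.range (Sum.elim x y)) = ⊤ := by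
    rw [hxy]
    exact IntermediateField.adjoin_range_algebraMap_X_eq_top k _ K
  have hx : Function.Injective x := hind.injective.comp Sum.inl_injective
  rw [fixedField_range_eq_adjoin_multisymmetricGenerators hx hgen φ hφx hφy]
  let e : MvPolynomial (Fin n ⊕ Fin n) k ≃ₐ[k] MvPolynomial (Fin (2 * n)) k :=
    renameEquiv k (finSumFinEquiv.trans (finCongr (two_mul n).symm))
  exact ⟨(algebraicIndependent_multisymmetricGenerators hind hgen).aevalEquivField.symm.trans
    (IsFractionRing.fieldEquivOfAlgEquiv k _ _ e)⟩
end

section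
/- Let p be a prime, G a finite p-group, and k a field of characteristic p. Then k(G), the fixed field of G acting by left translation on the rational function field in variables indexed by the elements of G, is purely transcendental over k of transcendence degree |G|. -/
section

open Polynomial

/-- A finite `p`-group acting on an additive group of exponent `p` fixes a nonzero element in the
subgroup generated by any nontrivial orbit. -/
lemma IsPGroup.exists_ne_zero_fixed_mem_closure {p : ℕ} [Fact p.Prime] {G A : Type*} [Group G]
    [Finite G] (hG : IsPGroup p G) [AddCommGroup A] [DistribMulAction G A]
    (hA : ∀ a : A, p • a = 0) {u : A} (hu : u ≠ 0) :
    ∃ v ∈ AddSubgroup.closure (Set.range fun g : G ↦ g • u), v ≠ 0 ∧ ∀ g : G, g • v = v := by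
  set M := AddSubgroup.closure (Set.range fun g : G ↦ g • u) with hM
  have hMu : u ∈ M := AddSubgroup.subset_closure ⟨1, one_smul G u⟩
  have hstab : ∀ (g : G) (m : A), m ∈ M → g • m ∈ M := by
    intro g m hm
    have hle : M ≤ M.comap (DistribSMul.toAddMonoidHom A g) := by
      rw [hM, AddSubgroup.closure_le]
      rintro _ ⟨h, rfl⟩
      exact AddSubgroup.subset_closure ⟨g * h, mul_smul g h u⟩
    exact hle hm
  let : MulAction G M :=
    { smul := fun g m ↦ ⟨g • (m : A), hstab g m m.2⟩
      one_smul := fun m ↦ Subtype.ext (one_smul G (m : A))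
      mul_smul := fun g h m ↦ Subtype.ext (mul_smul g h (m : A)) }
  have hp0 : p ≠ 0 := (Fact.out : p.Prime).ne_zero
  have : AddGroup.FG M := by
    rw [AddGroup.fg_iff_addSubgroup_fg, AddSubgroup.fg_iff]
    exact ⟨_, rfl, Set.finite_range _⟩
  have hMp : ∀ m : M, p • m = 0 := fun m ↦ Subtype.ext (by simpa using hA m)
  have : Finite M := AddCommGroup.finite_of_fg_isAddTorsion M fun m ↦
    isOfFinAddOrder_iff_nsmul_eq_zero.2 ⟨p, hp0.bot_lt, hMp m⟩
  have hu' : (⟨u, hMu⟩ : M) ≠ 0 := fun h ↦ hu (congrArg Subtype.val h)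
  have hdvd : p ∣ Nat.card M := by
    rw [← addOrderOf_eq_prime (hMp ⟨u, hMu⟩) hu']
    exact addOrderOf_dvd_natCard _
  obtain ⟨v, hv, hv0⟩ := hG.exists_fixed_point_of_prime_dvd_card_of_fixed_point M hdvd
    (a := (0 : M)) fun g ↦ Subtype.ext (smul_zero g)
  exact ⟨v, v.2, fun h ↦ hv0 (Subtype.ext h.symm), fun g ↦ congrArg Subtype.val (hv g)⟩

/-- Relative form of `IsPGroup.exists_ne_zero_fixed_mem_closure`: the fixed element is found modulo
a stable subgroup. -/
lemma IsPGroup.exists_notMem_smul_sub_mem {p : ℕ} [Fact p.Prime] {G V : Type*} [Group G]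
    [Finite G] (hG : IsPGroup p G) [AddCommGroup V] [DistribMulAction G V]
    (hV : ∀ v : V, p • v = 0) (W : AddSubgroup V) (hW : ∀ (g : G), ∀ w ∈ W, g • w ∈ W)
    {u : V} (hu : u ∉ W) :
    ∃ v ∈ AddSubgroup.closure (Set.range fun g : G ↦ g • u), v ∉ W ∧ ∀ g : G, g • v - v ∈ W := by
  let act (g : G) : V ⧸ W →+ V ⧸ W :=
    QuotientAddGroup.map W W (DistribSMul.toAddMonoidHom V g) (hW g)
  let : DistribMulAction G (V ⧸ W) :=
    { smul := fun g ↦ act g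
      one_smul := by
        rintro ⟨v⟩
        exact congrArg (QuotientAddGroup.mk (s := W)) (one_smul G v)
      mul_smul := by
        rintro g h ⟨v⟩
        exact congrArg (QuotientAddGroup.mk (s := W)) (mul_smul g h v)
      smul_zero := fun g ↦ map_zero (act g)
      smul_add := fun g ↦ map_add (act g) }
  have hu' : QuotientAddGroup.mk' W u ≠ 0 := by simpa using hu
  have hA : ∀ a : V ⧸ W, p • a = 0 := by
    rintro ⟨v⟩
    exact congrArg (QuotientAddGroup.mk (s := W)) (hV v)
  obtain ⟨a, ha, ha0, hfix⟩ := hG.exists_ne_zero_fixed_mem_closure hA hu'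
  have hmap : (Set.range fun g : G ↦ g • QuotientAddGroup.mk' W u) =
      Set.image (QuotientAddGroup.mk' W) (Set.range fun g : G ↦ g • u) := by
    rw [← Set.range_comp]
    rfl
  rw [hmap, ← AddMonoidHom.map_closure] at ha
  obtain ⟨v, hv, rfl⟩ := ha
  refine ⟨v, hv, by simpa using ha0, fun g ↦ ?_⟩
  rw [← QuotientAddGroup.eq_zero_iff, QuotientAddGroup.mk_sub, sub_eq_zero]
  exact hfix g

/-- Miyata's lemma: the polynomials fixed by a family of degree-preserving endomorphisms of `F[X]`
are the polynomials with fixed coefficients in a single fixed polynomial `f`. -/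
lemma Polynomial.exists_forall_fixed_eq_comp {F ι : Type*} [Field F] (τ : ι → F[X] →+* F[X])
    (hτ : ∀ i P, (τ i P).degree = P.degree) :
    ∃ f, (∀ i, τ i f = f) ∧ ∀ P, (∀ i, τ i P = P) →
      ∃ Q : F[X], P = Q.comp f ∧ ∀ i j, τ i (C (Q.coeff j)) = C (Q.coeff j) := by
  by_cases hex : ∃ n, ∃ f : F[X], (∀ i, τ i f = f) ∧ 0 < f.natDegree ∧ f.natDegree = n
  · classical
    obtain ⟨f, hf, hf0, hfn⟩ := Nat.find_spec hex
    have hmin : ∀ g : F[X], (∀ i, τ i g = g) → g.degree < f.degree → g.natDegree = 0 := by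
      intro g hg hlt
      by_contra h0
      refine Nat.find_min hex (m := g.natDegree) ?_ ⟨g, hg, Nat.pos_of_ne_zero h0, rfl⟩
      rw [← hfn]
      exact natDegree_lt_natDegree (fun h ↦ h0 (by simp [h])) hlt
    have hfne : f ≠ 0 := by
      rintro rfl
      simp at hf0
    refine ⟨f, hf, fun P ↦ ?_⟩
    induction hn : P.natDegree using Nat.strong_induction_on generalizing P with
    | _ n ih =>
    intro hP
    have hdiv : f * (P / f) + P % f = P := EuclideanDomain.div_add_mod P f
    have hdeg : (P % f).degree < f.degree := degree_mod_lt P hfne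
    have key : ∀ i, τ i (P / f) = P / f ∧ τ i (P % f) = P % f := by
      intro i
      have h1 : f * τ i (P / f) + τ i (P % f) = P := by
        conv_rhs => rw [← hP i, ← hdiv]
        rw [map_add, map_mul, hf i]
      have h2 : f * (τ i (P / f) - P / f) = P % f - τ i (P % f) := by
        linear_combination h1 - hdiv
      have h3 : (P % f - τ i (P % f)).degree < f.degree :=
        (degree_sub_le _ _).trans_lt (by simp [hτ, hdeg])
      have h4 : τ i (P / f) - P / f = 0 := by
        by_contra hne
        rw [← h2, degree_mul] at h3
        exact absurd h3 (not_lt.2 (le_add_of_nonneg_right (zero_le_degree_iff.2 hne)))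
      rw [h4, mul_zero, eq_comm, sub_eq_zero] at h2
      exact ⟨sub_eq_zero.1 h4, h2.symm⟩
    have hr := hmin _ (fun i ↦ (key i).2) hdeg
    rw [natDegree_eq_zero] at hr
    obtain ⟨c, hc⟩ := hr
    by_cases hPf : P / f = 0
    · refine ⟨C c, ?_, fun i j ↦ ?_⟩
      · rw [hPf, mul_zero, zero_add] at hdiv
        rw [C_comp, hc, hdiv]
      · rw [coeff_C]
        split_ifs
        · rw [hc, (key i).2]
        · simp
    have hlt : (P / f).natDegree < n := by
      have hle : f.degree ≤ P.degree := by
        by_contra! hlt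
        exact hPf ((Polynomial.div_eq_zero_iff hfne).2 hlt)
      have hadd := degree_add_div hfne hle
      have hPne : P ≠ 0 := by
        rintro rfl
        simp at hPf
      rw [degree_eq_natDegree hfne, degree_eq_natDegree hPf, degree_eq_natDegree hPne] at hadd
      norm_cast at hadd
      lia
    obtain ⟨Q, hQ, hQc⟩ := ih _ hlt (P / f) rfl fun i ↦ (key i).1
    refine ⟨X * Q + C c, ?_, fun i j ↦ ?_⟩
    · rw [add_comp, mul_comp, X_comp, C_comp, ← hQ, hc, hdiv]
    · have hcτ : τ i (C c) = C c := by rw [hc, (key i).2]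
      cases j with
      | zero => simpa using hcτ
      | succ j => simpa [coeff_X_mul, coeff_C] using hQc i j
  · push Not at hex
    refine ⟨0, by simp, fun P hP ↦ ?_⟩
    have h0 : P.natDegree = 0 := by
      by_contra h
      exact hex _ P hP (Nat.pos_of_ne_zero h) rfl
    obtain ⟨c, rfl⟩ := natDegree_eq_zero.1 h0
    refine ⟨C c, by simp, fun i j ↦ ?_⟩
    rw [coeff_C]
    split_ifs
    · exact hP i
    · simp

open IntermediateField in
/-- Let a finite group `H` act on `K` stabilizing the subfield `F`, and let `y` be transcendental
over `F` with `σ y - y ∈ F` for all `σ ∈ H`. Then the invariants of `F(y)` are generated by those of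
`F` together with one further element. -/
lemma IntermediateField.exists_inf_fixedField_le_adjoin_insert {k K : Type*} [Field k] [Field K]
    [Algebra k K] (H : Subgroup (K ≃ₐ[k] K)) [Finite H] (F : IntermediateField k K)
    (hF : ∀ σ ∈ H, ∀ x ∈ F, σ x ∈ F) {y : K} (hy : Transcendental F y)
    (hyF : ∀ σ ∈ H, σ y - y ∈ F) :
    ∃ f ∈ F⟮y⟯, f ∈ fixedField H ∧ ∀ z ∈ F⟮y⟯, z ∈ fixedField H →
      z ∈ adjoin k (insert f ↑(F ⊓ fixedField H)) := by
  let res (σ : H) : F →+* F := (σ : K ≃ₐ[k] K).toRingEquiv.toRingHom.restrict F F (hF σ σ.2)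
  let τ (σ : H) : F[X] →+* F[X] :=
    (taylorAlgHom (⟨(σ : K ≃ₐ[k] K) y - y, hyF σ σ.2⟩ : F)).toRingHom.comp (mapRingHom (res σ))
  have hτdeg : ∀ σ P, (τ σ P).degree = P.degree := fun σ P ↦
    (degree_taylor _ _).trans (degree_map P (res σ))
  have hτ : ∀ (σ : H) (P : F[X]), aeval y (τ σ P) = (σ : K ≃ₐ[k] K) (aeval y P) := by
    intro σ P
    have : (aeval y : F[X] →ₐ[F] K).toRingHom.comp (τ σ) =
        (σ : K ≃ₐ[k] K).toRingEquiv.toRingHom.comp (aeval y : F[X] →ₐ[F] K).toRingHom := by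
      ext x
      · simp [τ, res]
      · simp [τ]
    exact congrArg (fun φ : F[X] →+* K ↦ φ P) this
  have hinj : Function.Injective (aeval y : F[X] →ₐ[F] K) := transcendental_iff_injective.1 hy
  have hfix : ∀ P : F[X], aeval y P ∈ fixedField H ↔ ∀ σ, τ σ P = P := by
    intro P
    rw [mem_fixedField_iff]
    exact ⟨fun h σ ↦ hinj ((hτ σ P).trans (h σ σ.2)),
      fun h σ hσ ↦ (hτ ⟨σ, hσ⟩ P).symm.trans (by rw [h])⟩
  obtain ⟨f, hf, hcomp⟩ := exists_forall_fixed_eq_comp τ hτdeg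
  set E := adjoin k (insert (aeval y f) ↑(F ⊓ fixedField H))
  have hmem : ∀ P : F[X], aeval y P ∈ fixedField H → aeval y P ∈ E := by
    intro P hP
    obtain ⟨Q, rfl, hQ⟩ := hcomp P ((hfix P).1 hP)
    rw [aeval_comp, aeval_eq_sum_range]
    refine sum_mem fun j _ ↦ ?_
    rw [Algebra.smul_def]
    have hc : ((Q.coeff j : F) : K) ∈ fixedField H := by
      have := (hfix (C (Q.coeff j))).2 fun σ ↦ hQ σ j
      rwa [aeval_C] at this
    have hcE : ((Q.coeff j : F) : K) ∈ E :=
      subset_adjoin k _ (Set.mem_insert_of_mem _ ⟨(Q.coeff j).2, hc⟩)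
    exact mul_mem hcE (pow_mem (subset_adjoin k _ (Set.mem_insert _ _)) j)
  refine ⟨aeval y f, (mem_adjoin_simple_iff _ _).2 ⟨f, 1, by simp⟩, (hfix f).2 hf, ?_⟩
  intro z hz hzfix
  obtain ⟨r, s, rfl⟩ := (mem_adjoin_simple_iff _ _).1 hz
  by_cases hs : s = 0
  · simp [hs]
  classical
  cases nonempty_fintype H
  have hs' : aeval y s ≠ 0 := by simpa using hinj.ne hs
  have hN : aeval y (∏ σ, τ σ s) ∈ fixedField H := by
    rw [mem_fixedField_iff]
    intro ρ hρ
    simp only [map_prod, hτ]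
    exact Fintype.prod_equiv (Equiv.mulLeft (⟨ρ, hρ⟩ : H)) _ _ fun σ ↦ rfl
  have hN0 : aeval y (∏ σ, τ σ s) ≠ 0 := by
    simp only [map_prod, hτ]
    exact Finset.prod_ne_zero_iff.2 fun σ _ ↦ by simpa using hs'
  have hnum : aeval y r / aeval y s * aeval y (∏ σ, τ σ s) =
      aeval y (r * ∏ σ ∈ Finset.univ.erase 1, τ σ s) := by
    rw [← Finset.mul_prod_erase _ _ (Finset.mem_univ (1 : H)), map_mul, map_mul, hτ]
    simp only [OneMemClass.coe_one, AlgEquiv.one_apply]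
    field_simp
  rw [← mul_div_cancel_right₀ (aeval y r / aeval y s) hN0]
  refine div_mem ?_ (hmem _ hN)
  rw [hnum]
  apply hmem
  rw [← hnum]
  exact mul_mem hzfix hN

open IntermediateField in
open scoped algebraAdjoinAdjoin in
/-- A finite set generating `K` up to algebraic extensions, with at most `trdeg k K` elements, is
algebraically independent. -/
lemma isTranscendenceBasis_val_of_ncard_le_trdeg {k K : Type*} [Field k] [Field K]
    [Algebra k K] {B : Set K} (hB : B.Finite) (hcard : (B.ncard : Cardinal) ≤ Algebra.trdeg k K)
    (halg : Algebra.IsAlgebraic (adjoin k B) K) : IsTranscendenceBasis k (Subtype.val : B → K) := by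
  have := hB.to_subtype
  have : Algebra.IsAlgebraic (Algebra.adjoin k (Set.range (Subtype.val : B → K))) K := by
    rw [Subtype.range_val]
    exact (IsFractionRing.comap_isAlgebraic_iff (K := adjoin k B)).2 halg
  refine Algebra.IsAlgebraic.isTranscendenceBasis_of_le_trdeg_of_finite k _ ?_
  rwa [← Set.cast_ncard hB]


/-- A linearly independent subset of a finite-dimensional subspace is finite, with at most as many
elements as the dimension. -/
lemma LinearIndepOn.finite_and_ncard_le_finrank {k V : Type*} [Field k] [AddCommGroup V]
    [Module k V] {B : Set V} (hB : LinearIndepOn k id B) {L : Submodule k V}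
    [FiniteDimensional k L] (hBL : B ⊆ L) : B.Finite ∧ B.ncard ≤ Module.finrank k L := by
  have hli : LinearIndependent k fun b : B ↦ (⟨b, hBL b.2⟩ : L) :=
    LinearIndependent.of_comp L.subtype hB
  have hfin : Finite B := hli.finite
  have := Fintype.ofFinite B
  refine ⟨Set.toFinite B, ?_⟩
  rw [← Nat.card_coe_set_eq, Nat.card_eq_fintype_card]
  exact hli.fintype_card_le_finrank

open IntermediateField in
open scoped algebraAdjoinAdjoin in
/-- Let `k` have characteristic `p` and let a finite `p`-group act on `K/k`, stabilizing a subspace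
`L` which generates `K` and has dimension at most `trdeg k K`. Then the fixed field is generated by
`dim L` elements. -/
lemma IsPGroup.exists_fixedField_eq_adjoin {p : ℕ} [Fact p.Prime] {k K : Type*} [Field k]
    [CharP k p] [Field K] [Algebra k K] {H : Subgroup (K ≃ₐ[k] K)} [Finite H] (hH : IsPGroup p H)
    (L : Submodule k K) [FiniteDimensional k L] (hL : ∀ σ ∈ H, ∀ x ∈ L, σ x ∈ L)
    (hgen : adjoin k (L : Set K) = ⊤) (hcard : (Module.finrank k L : Cardinal) ≤ Algebra.trdeg k K) :
    ∃ T : Set K, T.Finite ∧ T.ncard ≤ Module.finrank k L ∧ fixedField H = adjoin k T := by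
  have hspan_le (S : Set K) : (Submodule.span k S : Set K) ⊆ adjoin k S :=
    (Submodule.span_le (p := (adjoin k S).toSubalgebra.toSubmodule)).2 (subset_adjoin k S)
  have hspan {S : Set K} (hS : (L : Set K) ⊆ Submodule.span k S) : adjoin k S = ⊤ := by
    rw [← top_le_iff, ← hgen, adjoin_le_iff]
    exact hS.trans (hspan_le S)
  have hbasis {B : Set K} (hBL : B ⊆ L) (hB : LinearIndepOn k id B)
      (hLB : (L : Set K) ⊆ Submodule.span k B) :
      IsTranscendenceBasis k (Subtype.val : B → K) := by
    obtain ⟨hfin, hle⟩ := hB.finite_and_ncard_le_finrank hBL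
    refine isTranscendenceBasis_val_of_ncard_le_trdeg hfin
      ((Nat.cast_le.2 hle).trans hcard) ?_
    rw [hspan hLB]
    exact ⟨fun x ↦ isAlgebraic_algebraMap (⟨x, mem_top⟩ : (⊤ : IntermediateField k K))⟩
  have key : ∀ i ≤ Module.finrank k L, ∃ S T : Set K, S ⊆ L ∧ LinearIndepOn k id S ∧
      S.ncard = i ∧ (∀ σ ∈ H, ∀ s ∈ S, σ s ∈ Submodule.span k S) ∧ T.Finite ∧ T.ncard ≤ i ∧
      adjoin k S ⊓ fixedField H = adjoin k T := by
    have := charP_of_injective_algebraMap (algebraMap k K).injective p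
    intro i
    induction i with
    | zero =>
      exact fun _ ↦ ⟨∅, ∅, by simp, linearIndepOn_empty k id, by simp, by simp, by simp, by simp,
        by simp⟩
    | succ i ih =>
      intro hi
      obtain ⟨S, T, hSL, hS, hSi, hSH, hTfin, hTi, hST⟩ := ih (by lia)
      have hSfin := (hS.finite_and_ncard_le_finrank hSL).1
      obtain ⟨u, huL, huS⟩ : ∃ u ∈ L, u ∉ Submodule.span k S := by
        by_contra! hle
        have := hSfin.fintype
        have h1 : Module.finrank k L ≤ Module.finrank k (Submodule.span k S) := by
          have := FiniteDimensional.span_of_finite k hSfin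
          exact Submodule.finrank_mono hle
        have h2 := finrank_span_le_card (R := k) S
        rw [← Set.ncard_eq_toFinset_card'] at h2
        lia
      have hspanH : ∀ σ ∈ H, ∀ w ∈ Submodule.span k S, σ w ∈ Submodule.span k S := by
        intro σ hσ
        exact (Submodule.span_le (p := (Submodule.span k S).comap σ.toLinearMap)).2 (hSH σ hσ)
      obtain ⟨v, hv, hvS, hvH⟩ := hH.exists_notMem_smul_sub_mem
        (fun x : K ↦ by rw [nsmul_eq_mul, (CharP.cast_eq_zero_iff K p p).2 dvd_rfl, zero_mul])
        (Submodule.span k S).toAddSubgroup (fun σ w hw ↦ hspanH σ σ.2 w hw) (u := u) huS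
      have hvL : v ∈ L := by
        refine (AddSubgroup.closure_le L.toAddSubgroup).2 ?_ hv
        rintro _ ⟨σ, rfl⟩
        exact hL σ σ.2 u huL
      have hvS' : v ∉ S := fun h ↦ hvS (Submodule.subset_span h)
      have hS' : LinearIndepOn k id (insert v S) := hS.id_insert hvS
      obtain ⟨B, hBL, hSB, hLB, hB⟩ :=
        exists_linearIndepOn_id_extension hS' (Set.insert_subset hvL hSL)
      have htrans : Transcendental (adjoin k S) v := by
        have := (hbasis hBL hB hLB).1.transcendental_adjoin (s := Subtype.val ⁻¹' S)
          (i := ⟨v, hSB (Set.mem_insert v S)⟩) hvS'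
        rw [Subtype.image_preimage_coe, Set.inter_eq_right.2 ((Set.subset_insert v S).trans hSB)]
          at this
        exact fun h ↦ this
          ((IsFractionRing.isAlgebraic_iff (Algebra.adjoin k S) (adjoin k S) K).2 h)
      have hstab : ∀ σ ∈ H, ∀ x ∈ adjoin k S, σ x ∈ adjoin k S := by
        intro σ hσ
        have : adjoin k S ≤ (adjoin k S).comap (σ : K →ₐ[k] K) :=
          adjoin_le_iff.2 fun s hs ↦ hspan_le S (hSH σ hσ s hs)
        exact fun x hx ↦ this hx
      obtain ⟨f, hfv, hfH, hf⟩ := exists_inf_fixedField_le_adjoin_insert H (adjoin k S) hstab htrans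
        fun σ hσ ↦ hspan_le S (hvH ⟨σ, hσ⟩)
      have hadj (z : K) : z ∈ adjoin k (insert v S) ↔ z ∈ (adjoin k S)⟮v⟯ := by
        rw [← Set.union_singleton, ← adjoin_adjoin_left, mem_restrictScalars]
      refine ⟨insert v S, insert f T, Set.insert_subset hvL hSL, hS', ?_, ?_, hTfin.insert f,
        (Set.ncard_insert_le f T).trans (by lia), le_antisymm ?_ ?_⟩
      · rw [Set.ncard_insert_of_notMem hvS' hSfin, hSi]
      · have hle := Submodule.span_mono (R := k) (Set.subset_insert v S)
        rintro σ hσ s (rfl | hs)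
        · rw [← sub_add_cancel (σ s) s]
          exact add_mem (hle (hvH ⟨σ, hσ⟩)) (Submodule.subset_span (Set.mem_insert s S))
        · exact hle (hSH σ hσ s hs)
      · rintro z ⟨hz, hzH⟩
        have hzf := hf z ((hadj z).1 hz) hzH
        rw [hST] at hzf
        refine (adjoin_le_iff.2 (Set.insert_subset ?_ ?_) : _ ≤ adjoin k (insert f T)) hzf
        · exact subset_adjoin k _ (Set.mem_insert f T)
        · exact adjoin.mono k _ _ (Set.subset_insert f T)
      · rw [adjoin_le_iff]
        refine Set.insert_subset ⟨(hadj f).2 hfv, hfH⟩ fun t ht ↦ ?_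
        have ht' : t ∈ adjoin k S ⊓ fixedField H := hST ▸ subset_adjoin k T ht
        exact ⟨adjoin.mono k _ _ (Set.subset_insert v S) ht'.1, ht'.2⟩
  obtain ⟨S, T, hSL, hS, hSn, -, hTfin, hTn, hST⟩ := key _ le_rfl
  refine ⟨T, hTfin, hTn, ?_⟩
  have hSfin := (hS.finite_and_ncard_le_finrank hSL).1
  have hSspan : Submodule.span k S = L := by
    have := hSfin.fintype
    refine Submodule.eq_of_le_of_finrank_le (Submodule.span_le.2 hSL) ?_
    rw [finrank_span_set_eq_card hS, ← Set.ncard_eq_toFinset_card', hSn]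
  rw [← hST, hspan hSspan.ge, top_inf_eq]

end

open MvPolynomial

/-- **Noether's problem for `p`-groups in characteristic `p` (Kuniyoshi–Gaschütz).**
Let `p` be a prime, `G` a finite `p`-group and `k` a field of characteristic `p`.  Let `K` be
the rational function field `k(x_h)_{h ∈ G}` in variables indexed by the elements of `G` (the
fraction field of the polynomial ring `k[x_h : h ∈ G]`), on which `G` acts by `k`-algebra
automorphisms by left translation of the variables: `g • x_h = x_{g h}`, encoded by the
homomorphism `φ`.  Then the fixed field `k(G) = K^G` is purely transcendental over `k` of
transcendence degree `|G|`. -/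
theorem pGroup_translation_fixedField_is_rational
    (p : ℕ) (hp : p.Prime)
    (k : Type*) [Field k] [CharP k p]
    (G : Type*) [Group G] [Finite G] (hG : IsPGroup p G)
    (K : Type*) [Field K] [Algebra k K]
    [Algebra (MvPolynomial G k) K] [IsScalarTower k (MvPolynomial G k) K]
    [IsFractionRing (MvPolynomial G k) K]
    (φ : G →* (K ≃ₐ[k] K))
    (hφ : ∀ (g h : G),
      φ g (algebraMap (MvPolynomial G k) K (X h)) =
        algebraMap (MvPolynomial G k) K (X (g * h))) :
    Nonempty (↥(IntermediateField.fixedField φ.range) ≃ₐ[k]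
      FractionRing (MvPolynomial (Fin (Nat.card G)) k)) := by
  have : Fact p.Prime := ⟨hp⟩
  let H := φ.range
  have : Finite H := Finite.of_surjective φ.rangeRestrict φ.rangeRestrict_surjective
  have hH : IsPGroup p H := hG.of_surjective φ.rangeRestrict φ.rangeRestrict_surjective
  let x : G → K := fun h ↦ algebraMap (MvPolynomial G k) K (X h)
  have hinj : Function.Injective (algebraMap (MvPolynomial G k) K) := IsFractionRing.injective _ _
  have hx : AlgebraicIndependent k x :=
    (algebraicIndependent_X G k).map' (f := IsScalarTower.toAlgHom k (MvPolynomial G k) K) hinj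
  let L : Submodule k K := Submodule.span k (Set.range x)
  have : FiniteDimensional k L := FiniteDimensional.span_of_finite k (Set.finite_range x)
  have hrank : Module.finrank k L = Nat.card G := by
    have := Fintype.ofFinite G
    rw [Nat.card_eq_fintype_card]
    exact finrank_span_eq_card hx.linearIndependent
  have hL : ∀ σ ∈ H, ∀ y ∈ L, σ y ∈ L := by
    rintro _ ⟨g, rfl⟩
    refine (Submodule.span_le (p := L.comap (φ g).toLinearMap)).2 ?_
    rintro _ ⟨h, rfl⟩
    exact Submodule.subset_span ⟨g * h, (hφ g h).symm⟩
  have hgen : IntermediateField.adjoin k (L : Set K) = ⊤ := by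
    rw [← top_le_iff]
    intro z _
    have hpoly (P : MvPolynomial G k) :
        algebraMap (MvPolynomial G k) K P ∈ IntermediateField.adjoin k (L : Set K) := by
      induction P using MvPolynomial.induction_on with
      | C a =>
        rw [← MvPolynomial.algebraMap_eq, ← IsScalarTower.algebraMap_apply]
        exact IntermediateField.algebraMap_mem _ a
      | add P Q hP hQ => rw [map_add]; exact add_mem hP hQ
      | mul_X P h hP =>
        rw [map_mul]
        exact mul_mem hP (IntermediateField.subset_adjoin k _ (Submodule.subset_span ⟨h, rfl⟩))
    obtain ⟨P, Q, -, rfl⟩ := IsFractionRing.div_surjective (A := MvPolynomial G k) z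
    exact div_mem (hpoly P) (hpoly Q)
  have htrdeg : (Nat.card G : Cardinal) ≤ Algebra.trdeg k K := by
    simpa [← Nat.cast_card] using! hx.lift_cardinalMk_le_trdeg
  obtain ⟨T, hTfin, hTcard, hT⟩ :=
    hH.exists_fixedField_eq_adjoin L hL hgen (by rwa [hrank])
  rw [hrank] at hTcard
  have hTbasis := isTranscendenceBasis_val_of_ncard_le_trdeg hTfin
    ((Nat.cast_le.2 hTcard).trans htrdeg) <| by
      rw [← hT]
      exact ⟨fun y ↦ (FixedPoints.isIntegral H K y).isAlgebraic⟩
  have hTcard' : Nat.card T = Nat.card G := by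
    refine le_antisymm hTcard ?_
    rw [← hTbasis.cardinalMk_eq_trdeg, ← Set.cast_ncard hTfin] at htrdeg
    exact_mod_cast htrdeg
  have := hTfin.to_subtype
  let e : Fin (Nat.card G) ≃ T := (Finite.equivFinOfCardEq hTcard').symm
  have he : Set.range (Subtype.val ∘ e) = T := by
    rw [e.surjective.range_comp, Subtype.range_val]
  have hfix : IntermediateField.adjoin k (Set.range (Subtype.val ∘ e)) =
      IntermediateField.fixedField φ.range := by
    rw [he, ← hT]
  exact ⟨((hTbasis.1.comp e e.injective).aevalEquivField.trans
    (IntermediateField.equivOfEq hfix)).symm⟩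
end

section
/- Let G be a finite abelian group of exponent e, and let k be a field such that either char k = 0 or char k is coprime to e, and such that k contains a primitive e-th root of unity. Then k(G), the fixed field of G acting by left translation on the rational function field in variables indexed by the elements of G, is purely transcendental over k of transcendence degree |G|. -/
open MvPolynomial

section LaurentMonomials

variable {k K G ι : Type*} [Field k] [Field K] [Algebra k K] [CommGroup G] [Fintype ι]

/-- The Laurent monomial `∏ i, y i ^ a i` with exponent vector `a`. -/
def laurentMonomial (y : ι → K) (a : ι → ℤ) : K := ∏ i, y i ^ a i

/-- The exponent vectors of the Laurent monomials that are invariant under a group acting on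
the `i`-th variable through the character `χ i`. -/
def invariantExponents (χ : ι → G →* kˣ) : Submodule ℤ (ι → ℤ) where
  carrier := {a | ∀ g, ∏ i, χ i g ^ a i = 1}
  add_mem' ha hb g := by simp [zpow_add, Finset.prod_mul_distrib, ha g, hb g]
  zero_mem' g := by simp
  smul_mem' n a ha g := by simp [mul_comm n, zpow_mul, Finset.prod_zpow, ha g]

lemma laurentMonomial_add {y : ι → K} (hy : ∀ i, y i ≠ 0) (a b : ι → ℤ) :
    laurentMonomial y (a + b) = laurentMonomial y a * laurentMonomial y b := by
  simp [laurentMonomial, zpow_add₀ (hy _), Finset.prod_mul_distrib]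

lemma laurentMonomial_zsmul (y : ι → K) (n : ℤ) (a : ι → ℤ) :
    laurentMonomial y (n • a) = laurentMonomial y a ^ n := by
  simp [laurentMonomial, mul_comm n, zpow_mul, Finset.prod_zpow]

@[simp]
lemma laurentMonomial_zero (y : ι → K) : laurentMonomial y 0 = 1 := by
  simp [laurentMonomial]

@[simp]
lemma laurentMonomial_single [DecidableEq ι] (y : ι → K) (i : ι) (n : ℤ) :
    laurentMonomial y (Pi.single i n) = y i ^ n := by
  rw [laurentMonomial, Finset.prod_eq_single i] <;> simp +contextual

lemma map_laurentMonomial {σ : K ≃ₐ[k] K} {y : ι → K} {c : ι → kˣ}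
    (h : ∀ i, σ (y i) = (c i : k) • y i) (a : ι → ℤ) :
    σ (laurentMonomial y a) = ((∏ i, c i ^ a i : kˣ) : k) • laurentMonomial y a := by
  simp only [laurentMonomial, map_prod, map_zpow₀, h, Algebra.smul_def, mul_zpow,
    Finset.prod_mul_distrib, Units.coe_prod, Units.val_zpow_eq_zpow_val]

lemma exists_laurentMonomial_eq_of_mem_closure {y : ι → K} (hy : ∀ i, y i ≠ 0) {z : K}
    (hz : z ∈ Submonoid.closure (Set.range y)) : ∃ a, laurentMonomial y a = z := by
  classical
  induction hz using Submonoid.closure_induction with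
  | mem z hz =>
    obtain ⟨i, rfl⟩ := hz
    exact ⟨Pi.single i 1, by simp⟩
  | one => exact ⟨0, by simp⟩
  | mul z w _ _ hz hw =>
    obtain ⟨a, rfl⟩ := hz
    obtain ⟨b, rfl⟩ := hw
    exact ⟨a + b, laurentMonomial_add hy a b⟩

/-- A subfield containing the Laurent monomials of a spanning set of exponent vectors contains
all Laurent monomials with exponent vector in the span. -/
lemma laurentMonomial_mem_of_mem_span {y : ι → K} (hy : ∀ i, y i ≠ 0)
    (E : IntermediateField k K) {s : Set (ι → ℤ)} (hs : ∀ a ∈ s, laurentMonomial y a ∈ E)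
    {a : ι → ℤ} (ha : a ∈ Submodule.span ℤ s) : laurentMonomial y a ∈ E := by
  induction ha using Submodule.span_induction with
  | mem a ha => exact hs a ha
  | zero => simp
  | add a b _ _ ha hb => rw [laurentMonomial_add hy]; exact mul_mem ha hb
  | smul n a _ ha => rw [laurentMonomial_zsmul]; exact zpow_mem ha n

lemma sum_char_eq_zero [Fintype G] {c : G →* kˣ} (hc : c ≠ 1) : ∑ g, (c g : k) = 0 := by
  obtain ⟨g₀, hg₀⟩ := DFunLike.ne_iff.mp hc
  have h : (c g₀ : k) * ∑ g, (c g : k) = ∑ g, (c g : k) := by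
    rw [Finset.mul_sum]
    exact Fintype.sum_equiv (Equiv.mulLeft g₀) _ _ fun g ↦ by simp
  have h' : ((c g₀ : k) - 1) * ∑ g, (c g : k) = 0 := by rw [sub_mul, h, one_mul, sub_self]
  refine (mul_eq_zero.mp h').resolve_left fun h0 ↦ hg₀ ?_
  exact Units.ext (by simpa using sub_eq_zero.mp h0)

lemma pow_natCard_mem_invariantExponents [Finite G] [DecidableEq ι] (χ : ι → G →* kˣ) (i : ι) :
    Pi.single i (Nat.card G : ℤ) ∈ invariantExponents χ := by
  intro g
  rw [Finset.prod_eq_single i (by simp +contextual) (by simp)]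
  simp [← map_pow]

variable {φ : G →* (K ≃ₐ[k] K)} {χ : ι → G →* kˣ} {y : ι → K} {E : IntermediateField k K}

/-- If `G` acts diagonally on generators `y` of `K`, then `K` is spanned by Laurent monomials over
any intermediate field containing the invariant Laurent monomials. -/
lemma mem_span_range_laurentMonomial [Finite G] (hy : ∀ i, y i ≠ 0)
    (htop : IntermediateField.adjoin k (Set.range y) = ⊤)
    (hE : ∀ a ∈ invariantExponents χ, laurentMonomial y a ∈ E) (f : K) :
    f ∈ Submodule.span E (Set.range (laurentMonomial y)) := by
  classical
  have halg : ∀ x ∈ Set.range y, IsAlgebraic E x := by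
    rintro _ ⟨i, rfl⟩
    refine IsAlgebraic.of_pow (n := Nat.card G) Nat.card_pos ?_
    have h := hE _ (pow_natCard_mem_invariantExponents χ i)
    rw [laurentMonomial_single, zpow_natCast] at h
    exact isAlgebraic_algebraMap (⟨_, h⟩ : E)
  have hle : IntermediateField.adjoin k (Set.range y) ≤
      (IntermediateField.adjoin E (Set.range y)).restrictScalars k :=
    IntermediateField.adjoin_le_iff.mpr (IntermediateField.subset_adjoin E _)
  have hf : f ∈ IntermediateField.adjoin E (Set.range y) := hle (htop ▸ trivial)
  rw [← IntermediateField.mem_toSubalgebra,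
    IntermediateField.adjoin_toSubalgebra_of_isAlgebraic halg,
    ← Subalgebra.mem_toSubmodule, Algebra.adjoin_eq_span] at hf
  refine Submodule.span_mono (fun z hz ↦ ?_) hf
  exact exists_laurentMonomial_eq_of_mem_closure hy hz

lemma isAlgebraic_of_invariant_laurentMonomial_mem [Finite G]
    (htop : IntermediateField.adjoin k (Set.range y) = ⊤)
    (hE : ∀ a ∈ invariantExponents χ, laurentMonomial y a ∈ E) :
    Algebra.IsAlgebraic E K := by
  classical
  have hle : IntermediateField.adjoin k (Set.range y) ≤
      (algebraicClosure E K).restrictScalars k := by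
    rw [IntermediateField.adjoin_le_iff]
    rintro _ ⟨i, rfl⟩
    have h := hE _ (pow_natCard_mem_invariantExponents χ i)
    rw [laurentMonomial_single, zpow_natCast] at h
    exact mem_algebraicClosure_iff.mpr
      (IsAlgebraic.of_pow (n := Nat.card G) Nat.card_pos (isAlgebraic_algebraMap (⟨_, h⟩ : E)))
  exact ⟨fun x ↦ mem_algebraicClosure_iff.mp (hle (htop ▸ trivial))⟩

/-- The fixed field of a diagonal action is generated by the invariant Laurent monomials. -/
lemma fixedField_le_of_invariant_laurentMonomial_mem [Finite G] (hcard : (Nat.card G : k) ≠ 0)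
    (hφ : ∀ g i, φ g (y i) = (χ i g : k) • y i) (hy : ∀ i, y i ≠ 0)
    (htop : IntermediateField.adjoin k (Set.range y) = ⊤)
    (hfix : E ≤ IntermediateField.fixedField φ.range)
    (hE : ∀ a ∈ invariantExponents χ, laurentMonomial y a ∈ E) :
    IntermediateField.fixedField φ.range ≤ E := by
  classical
  have := Fintype.ofFinite G
  have hfixE (g : G) (c : E) : φ g c = c := hfix c.2 ⟨φ g, g, rfl⟩
  have key (f : K) : ∑ g, φ g f ∈ E := by
    induction mem_span_range_laurentMonomial hy htop hE f using Submodule.span_induction with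
    | mem f hf =>
      obtain ⟨a, rfl⟩ := hf
      simp only [map_laurentMonomial (hφ _), ← Finset.sum_smul]
      by_cases ha : a ∈ invariantExponents χ
      · exact E.smul_mem (hE a ha)
      · let c : G →* kˣ := ∏ i, χ i ^ a i
        have hc (g : G) : c g = ∏ i, χ i g ^ a i := by simp [c]
        have hne : c ≠ 1 := fun h ↦ ha fun g ↦ by rw [← hc, h, MonoidHom.one_apply]
        simp only [← hc, sum_char_eq_zero hne, zero_smul, zero_mem]
    | zero => simp
    | add a b _ _ ha hb => simpa [Finset.sum_add_distrib] using add_mem ha hb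
    | smul c a _ ha =>
      simp only [Algebra.smul_def, map_mul, IntermediateField.algebraMap_apply, hfixE,
        ← Finset.mul_sum]
      exact mul_mem c.2 ha
  intro f hf
  have h := key f
  have hsum : ∑ g, φ g f = (Nat.card G : k) • f := by
    rw [Finset.sum_congr rfl fun g _ ↦ show φ g f = f from hf ⟨φ g, g, rfl⟩]
    simp [Nat.card_eq_fintype_card, Algebra.smul_def]
  rw [hsum] at h
  simpa only [inv_smul_smul₀ hcard] using E.smul_mem (x := (Nat.card G : k)⁻¹) h

/-- The fixed field of a finite abelian group acting diagonally on generators of `K` is generated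
by at most as many elements, and `K` is algebraic over it. -/
lemma exists_adjoin_eq_fixedField [Finite G] (hcard : (Nat.card G : k) ≠ 0)
    (hφ : ∀ g i, φ g (y i) = (χ i g : k) • y i) (hy : ∀ i, y i ≠ 0)
    (htop : IntermediateField.adjoin k (Set.range y) = ⊤) :
    ∃ m ≤ Fintype.card ι, ∃ u : Fin m → K,
      IntermediateField.adjoin k (Set.range u) = IntermediateField.fixedField φ.range ∧
      Algebra.IsAlgebraic (IntermediateField.adjoin k (Set.range u)) K := by
  classical
  obtain ⟨m, b⟩ := Submodule.basisOfPid (Pi.basisFun ℤ ι) (invariantExponents χ)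
  have hm : m ≤ Fintype.card ι := by
    have := (b.linearIndependent.map' _ (Submodule.ker_subtype _)).fintype_card_le_finrank
    simpa using this
  let u : Fin m → K := fun j ↦ laurentMonomial y (b j)
  have hspan : Submodule.span ℤ (Set.range fun j ↦ (b j : ι → ℤ)) = invariantExponents χ := by
    have := congrArg (Submodule.map (invariantExponents χ).subtype) b.span_eq
    rwa [Submodule.map_span, Submodule.map_subtype_top, ← Set.range_comp] at this
  have hE : ∀ a ∈ invariantExponents χ,
      laurentMonomial y a ∈ IntermediateField.adjoin k (Set.range u) := by
    intro a ha
    refine laurentMonomial_mem_of_mem_span hy _ ?_ (hspan ▸ ha)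
    rintro _ ⟨j, rfl⟩
    exact IntermediateField.subset_adjoin k _ ⟨j, rfl⟩
  have hfix : IntermediateField.adjoin k (Set.range u) ≤
      IntermediateField.fixedField φ.range := by
    rw [IntermediateField.adjoin_le_iff]
    rintro _ ⟨j, rfl⟩ ⟨_, g, rfl⟩
    change φ g (laurentMonomial y (b j)) = laurentMonomial y (b j)
    rw [map_laurentMonomial (hφ g), (b j).2 g, Units.val_one, one_smul]
  exact ⟨m, hm, u, hfix.antisymm
    (fixedField_le_of_invariant_laurentMonomial_mem hcard hφ hy htop hfix hE),
    isAlgebraic_of_invariant_laurentMonomial_mem htop hE⟩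

end LaurentMonomials

open scoped IntermediateField.algebraAdjoinAdjoin in
/-- If `K` has transcendence degree at least `m` and is algebraic over `k(u₁, …, uₘ)`, then the
`uᵢ` form a transcendence basis. -/
lemma isTranscendenceBasis_of_isAlgebraic_adjoin {k K : Type*} [Field k] [Field K] [Algebra k K]
    {m : ℕ} (u : Fin m → K) [Algebra.IsAlgebraic (IntermediateField.adjoin k (Set.range u)) K]
    (hm : (m : Cardinal) ≤ Algebra.trdeg k K) : IsTranscendenceBasis k u := by
  have : Algebra.IsAlgebraic (Algebra.adjoin k (Set.range u)) K :=
    (IsFractionRing.comap_isAlgebraic_iff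
      (K := IntermediateField.adjoin k (Set.range u))).mpr inferInstance
  exact Algebra.IsAlgebraic.isTranscendenceBasis_of_lift_le_trdeg_of_finite k u
    (by simpa using hm)

section Fourier

variable {k G K : Type*} [Field k] [CommGroup G] [Fintype G] [Field K] [Algebra k K]

/-- The Fourier transform of a family `x` indexed by `G`. -/
def characterSum (x : G → K) (χ : G →* kˣ) : K := ∑ h, ((χ h)⁻¹ : kˣ).val • x h

lemma map_characterSum {σ : K ≃ₐ[k] K} {x : G → K} {g : G} (h : ∀ h, σ (x h) = x (g * h))
    (χ : G →* kˣ) : σ (characterSum x χ) = (χ g : k) • characterSum x χ := by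
  simp only [characterSum, map_sum, map_smul, h, Finset.smul_sum, smul_smul]
  exact Fintype.sum_equiv (Equiv.mulLeft g) _ _ fun a ↦ by
    simp [← Units.val_mul, -Units.val_inv_eq_inv_val]

lemma characterSum_ne_zero {x : G → K} (hx : LinearIndependent k x) (χ : G →* kˣ) :
    characterSum x χ ≠ 0 := fun h ↦
  Units.ne_zero _ (Fintype.linearIndependent_iff.mp hx (fun h ↦ ((χ h)⁻¹ : kˣ).val) h 1)

lemma sum_characters_eq_zero [HasEnoughRootsOfUnity k (Monoid.exponent G)]
    [Fintype (G →* kˣ)] {g : G} (hg : g ≠ 1) : ∑ χ : G →* kˣ, (χ g : k) = 0 := by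
  refine sum_char_eq_zero (G := G →* kˣ) (c := MonoidHom.eval g) fun h ↦ ?_
  obtain ⟨χ, hχ⟩ := CommGroup.exists_apply_ne_one_of_hasEnoughRootsOfUnity G k hg
  exact hχ (DFunLike.congr_fun h χ)

/-- Fourier inversion. -/
lemma sum_smul_characterSum [HasEnoughRootsOfUnity k (Monoid.exponent G)]
    [Fintype (G →* kˣ)] (x : G → K) (g : G) :
    ∑ χ : G →* kˣ, (χ g : k) • characterSum x χ = (Nat.card G : k) • x g := by
  classical
  simp only [characterSum, Finset.smul_sum, smul_smul]
  rw [Finset.sum_comm, Finset.sum_eq_single g]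
  · rw [← CommGroup.card_monoidHom_of_hasEnoughRootsOfUnity G k]
    simp [← Units.val_mul, -Units.val_inv_eq_inv_val, Nat.card_eq_fintype_card, Algebra.smul_def]
  · intro h _ hh
    have hne : g * h⁻¹ ≠ 1 := fun H ↦ hh (mul_inv_eq_one.mp H).symm
    rw [← Finset.sum_smul]
    simpa using congrArg (· • x h) (sum_characters_eq_zero (k := k) hne)
  · simp

end Fourier

/-- **Noether's problem for abelian groups with enough roots of unity (Fischer).**
Let `G` be a finite abelian group of exponent `e`, and let `k` be a field such that either
`char k = 0` or `char k` is coprime to `e`, and such that `k` contains a primitive `e`-th root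
of unity.  Let `K` be the rational function field `k(x_h)_{h ∈ G}` in variables indexed by the
elements of `G` (the fraction field of `k[x_h : h ∈ G]`), on which `G` acts by `k`-algebra
automorphisms by left translation of the variables: `g • x_h = x_{g h}`, encoded by the
homomorphism `φ`.  Then the fixed field `k(G) = K^G` is purely transcendental over `k` of
transcendence degree `|G|`. -/
theorem abelian_translation_fixedField_is_rational
    (k : Type*) [Field k]
    (G : Type*) [CommGroup G] [Finite G]
    (hchar : ringChar k = 0 ∨ Nat.Coprime (ringChar k) (Monoid.exponent G))
    (hroot : ∃ ζ : k, IsPrimitiveRoot ζ (Monoid.exponent G))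
    (K : Type*) [Field K] [Algebra k K]
    [Algebra (MvPolynomial G k) K] [IsScalarTower k (MvPolynomial G k) K]
    [IsFractionRing (MvPolynomial G k) K]
    (φ : G →* (K ≃ₐ[k] K))
    (hφ : ∀ (g h : G),
      φ g (algebraMap (MvPolynomial G k) K (X h)) =
        algebraMap (MvPolynomial G k) K (X (g * h))) :
    Nonempty (↥(IntermediateField.fixedField φ.range) ≃ₐ[k]
      FractionRing (MvPolynomial (Fin (Nat.card G)) k)) := by
  classical
  obtain ⟨ζ, hζ⟩ := hroot
  have := Fintype.ofFinite G
  have := NeZero.mk (Monoid.exponent_ne_zero_of_finite (G := G))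
  have : HasEnoughRootsOfUnity k (Monoid.exponent G) := ⟨⟨ζ, hζ⟩, inferInstance⟩
  have := Fintype.ofFinite (G →* kˣ)
  have hcard : (Nat.card G : k) ≠ 0 := by
    obtain ⟨c, hc⟩ := card_dvd_exponent_pow_rank G
    have h : ((Monoid.exponent G ^ Group.rank G : ℕ) : k) ≠ 0 := by
      rw [Nat.cast_pow]
      exact pow_ne_zero _ hζ.neZero'.out
    rw [hc, Nat.cast_mul] at h
    exact left_ne_zero_of_mul h
  have : Algebra.IsAlgebraic (MvPolynomial G k) K := IsLocalization.isAlgebraic _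
    (nonZeroDivisors (MvPolynomial G k))
  have hbasis : IsTranscendenceBasis k (fun h : G ↦ algebraMap (MvPolynomial G k) K (X h)) :=
    (IsTranscendenceBasis.mvPolynomial G k).algebraMap_comp
  set x : G → K := fun h ↦ algebraMap (MvPolynomial G k) K (X h)
  have hxtop : IntermediateField.adjoin k (Set.range x) = ⊤ := by
    have h := IsFractionRing.algHom_fieldRange_eq_of_comp_eq_of_range_eq (f := AlgHom.id k K)
      (g := IsScalarTower.toAlgHom k (MvPolynomial G k) K) (s := Set.range x) rfl (by
        rw [← Algebra.map_top, ← MvPolynomial.adjoin_range_X, AlgHom.map_adjoin, ← Set.range_comp]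
        rfl)
    rw [← h, eq_top_iff]
    exact fun z _ ↦ ⟨z, rfl⟩
  have hytop : IntermediateField.adjoin k (Set.range (characterSum (k := k) x)) = ⊤ := by
    rw [eq_top_iff, ← hxtop, IntermediateField.adjoin_le_iff]
    rintro _ ⟨g, rfl⟩
    have h : (Nat.card G : k) • x g ∈
        IntermediateField.adjoin k (Set.range (characterSum (k := k) x)) := by
      rw [← sum_smul_characterSum]
      exact sum_mem fun χ _ ↦ IntermediateField.smul_mem _
        (IntermediateField.subset_adjoin k _ (Set.mem_range_self χ))
    simpa only [inv_smul_smul₀ hcard, SetLike.mem_coe] using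
      IntermediateField.smul_mem _ (x := (Nat.card G : k)⁻¹) h
  obtain ⟨m, hm, u, hu, halg⟩ := exists_adjoin_eq_fixedField (φ := φ) (χ := id) hcard
    (fun g χ ↦ map_characterSum (hφ g) χ)
    (characterSum_ne_zero hbasis.1.linearIndependent) hytop
  have htrdeg : Algebra.trdeg k K = Nat.card G := by
    rw [← Cardinal.lift_inj, ← hbasis.lift_cardinalMk_eq_trdeg]
    simp
  rw [← Nat.card_eq_fintype_card, CommGroup.card_monoidHom_of_hasEnoughRootsOfUnity G k] at hm
  have hu' := isTranscendenceBasis_of_isAlgebraic_adjoin u (htrdeg ▸ Nat.cast_le.mpr hm)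
  obtain rfl : m = Nat.card G := by
    have h := hu'.lift_cardinalMk_eq_trdeg
    rw [htrdeg] at h
    simpa using h
  exact ⟨(hu'.1.aevalEquivField.trans (IntermediateField.equivOfEq hu)).symm⟩
end

section
/- Let k be a field and G an arbitrary finite subgroup of GL_2(k), acting on the rational function field k(x_1,x_2) by linear substitutions of the variables. Then the fixed field k(x_1,x_2)^G is purely transcendental over k of transcendence degree 2. -/
open Polynomial in
/-- If `K = F(t, y)` with `t` a root of `p` and `y ^ m ∈ F(t)`, then `[K : F] ≤ deg p * m`. -/
theorem finite_and_finrank_le_of_pow_mem {F K : Type*} [Field F] [Field K] [Algebra F K]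
    {t y : K} (hgen : IntermediateField.adjoin F {t, y} = ⊤)
    {p : F[X]} (hp : p ≠ 0) (hpt : aeval t p = 0)
    {m : ℕ} (hm : 0 < m) (hy : y ^ m ∈ IntermediateField.adjoin F {t}) :
    FiniteDimensional F K ∧ Module.finrank F K ≤ p.natDegree * m := by
  have htint : IsIntegral F t := IsAlgebraic.isIntegral ⟨p, hp, hpt⟩
  set L := IntermediateField.adjoin F {t} with hL
  have hroot : aeval y (X ^ m - C (⟨y ^ m, hy⟩ : L)) = 0 := by simp
  have hq : (X ^ m - C (⟨y ^ m, hy⟩ : L)) ≠ 0 := X_pow_sub_C_ne_zero hm _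
  have hyint : IsIntegral L y := IsAlgebraic.isIntegral ⟨_, hq, hroot⟩
  have htop : IntermediateField.adjoin L {y} = ⊤ := by
    rw [← IntermediateField.restrictScalars_eq_top_iff (K := F),
      IntermediateField.adjoin_simple_adjoin_simple, hgen]
  have h1 : Module.finrank F L ≤ p.natDegree := by
    rw [IntermediateField.adjoin.finrank htint]
    exact Polynomial.natDegree_le_of_dvd (minpoly.dvd F t hpt) hp
  have h2 : Module.finrank L K ≤ m := by
    rw [← IntermediateField.finrank_top', ← htop, IntermediateField.adjoin.finrank hyint]
    exact (Polynomial.natDegree_le_of_dvd (minpoly.dvd L y hroot) hq).trans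
      (natDegree_X_pow_sub_C).le
  have : FiniteDimensional F L := IntermediateField.adjoin.finiteDimensional htint
  have : FiniteDimensional L K := by
    have := IntermediateField.adjoin.finiteDimensional hyint
    rw [htop] at this
    exact Module.Finite.equiv (IntermediateField.topEquiv (F := L) (E := K)).toLinearEquiv
  exact ⟨Module.Finite.trans L K, (Module.finrank_mul_finrank F L K).symm.trans_le (Nat.mul_le_mul h1 h2)⟩

theorem algebraicIndependent_of_isAlgebraic_adjoin {k K : Type*} [Field k] [Field K] [Algebra k K]
    (htr : Algebra.trdeg k K = 2) (u v : K)
    (halg : Algebra.IsAlgebraic (IntermediateField.adjoin k {u, v}) K) :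
    AlgebraicIndependent k ![u, v] := by
  have hr : Set.range ![u, v] = {u, v} := by simp [Set.pair_comm]
  have : Algebra.IsAlgebraic (Algebra.adjoin k (Set.range ![u, v])) K := by
    rw [hr]
    open scoped IntermediateField.algebraAdjoinAdjoin in
    exact (IsFractionRing.comap_isAlgebraic_iff
      (K := IntermediateField.adjoin k {u, v})).mpr halg
  exact (Algebra.IsAlgebraic.isTranscendenceBasis_of_lift_le_trdeg_of_finite k ![u, v]
    (by simp [htr])).1

theorem exists_sum_pow_mul_ne_zero {K : Type*} [Field K] (S : Finset K) (hS : S.Nonempty)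
    (b : K → K) (hb : ∀ s ∈ S, b s ≠ 0) : ∃ i : ℕ, ∑ s ∈ S, s ^ i * b s ≠ 0 := by
  by_contra! h
  obtain ⟨s, hs⟩ := hS
  have := Matrix.eq_zero_of_forall_pow_sum_mul_pow_eq_zero
    (f := fun j => ((S.equivFin.symm j : S) : K)) (v := fun j => b (S.equivFin.symm j : S))
    (fun i j hij => S.equivFin.symm.injective (Subtype.ext hij)) (fun i => by
      rw [← h i, ← Finset.sum_coe_sort S,
        Equiv.sum_comp S.equivFin.symm (fun s : S => b s * (s : K) ^ (i : ℕ))]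
      simp_rw [mul_comm])
  exact hb s hs (by simpa using congrFun this (S.equivFin ⟨s, hs⟩))

open Polynomial in
/-- If every `s ∈ S` is a fractional linear expression in `t`, then the coefficients of
`∏ s ∈ S, (X - s)` are quotients of polynomials in `t` of degree at most `#S` with a common
denominator. -/
theorem exists_coeff_prod_X_sub_C_eq_div {k K : Type*} [Field k] [Field K] [Algebra k K]
    (t : K) (S : Finset K)
    (hS : ∀ s ∈ S, ∃ p q : k[X], p.natDegree ≤ 1 ∧ q.natDegree ≤ 1 ∧ aeval t q ≠ 0 ∧
      aeval t q * s = aeval t p) :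
    ∃ q : k[X], q.natDegree ≤ S.card ∧ aeval t q ≠ 0 ∧ ∀ i, ∃ p : k[X], p.natDegree ≤ S.card ∧
      aeval t q * (∏ s ∈ S, (X - C s)).coeff i = aeval t p := by
  classical
  induction S using Finset.induction_on with
  | empty =>
    refine ⟨1, by simp, by simp, fun i => ?_⟩
    by_cases hi : i = 0
    · exact ⟨1, by simp, by simp [hi]⟩
    · exact ⟨0, by simp, by simp [coeff_one, hi]⟩
  | insert s S hs ih =>
    obtain ⟨q, hq, hq0, h⟩ := ih fun s hs => hS s (Finset.mem_insert_of_mem hs)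
    obtain ⟨p', q', hp', hq', hq0', hs'⟩ := hS s (Finset.mem_insert_self s S)
    choose P hP hP' using h
    rw [Finset.card_insert_of_notMem hs]
    refine ⟨q * q', natDegree_mul_le_of_le hq hq', by simp [hq0, hq0'], fun i => ?_⟩
    rw [Finset.prod_insert hs, sub_mul, coeff_sub, coeff_C_mul]
    have key : ∀ i, (p' * P i).natDegree ≤ S.card + 1 := fun i => by
      rw [mul_comm]; exact natDegree_mul_le_of_le (hP i) hp'
    rcases i with _ | i
    · refine ⟨-(p' * P 0), by simpa using key 0, ?_⟩
      simp only [map_mul, map_neg, ← hs', ← hP', mul_coeff_zero, coeff_X_zero]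
      ring
    · refine ⟨P i * q' - p' * P (i + 1),
        natDegree_sub_le_of_le (natDegree_mul_le_of_le (hP i) hq') (key _) |>.trans (by simp), ?_⟩
      simp only [map_mul, map_sub, ← hs', ← hP', coeff_X_mul]
      ring

theorem card_image_smul_mul_card_stabilizer {G X : Type*} [Group G] [Fintype G] [MulAction G X]
    [DecidableEq X] (x : X) :
    (Finset.univ.image fun g : G => g • x).card * Nat.card (MulAction.stabilizer G x) =
      Nat.card G := by
  rw [← Nat.card_congr (MulAction.orbitProdStabilizerEquivGroup G x), Nat.card_prod,
    Nat.card_coe_set_eq, ← Set.ncard_coe_finset]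
  simp [MulAction.orbit]

open Polynomial in
theorem exists_polynomial_of_eq_div {k K : Type*} [Field k] [Field K] [Algebra k K]
    (E : IntermediateField k K) {t u : K} (hu : u ∈ E) (hu' : u ∉ Set.range (algebraMap k K))
    {n : ℕ} {p q : k[X]} (hp : p.natDegree ≤ n) (hq : q.natDegree ≤ n) (hq0 : aeval t q ≠ 0)
    (h : aeval t q * u = aeval t p) :
    ∃ f : E[X], f ≠ 0 ∧ aeval t f = 0 ∧ f.natDegree ≤ n := by
  refine ⟨p.map (algebraMap k E) - C ⟨u, hu⟩ * q.map (algebraMap k E), fun h0 => hu' ?_, ?_, ?_⟩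
  · have hq1 : q ≠ 0 := by rintro rfl; simp at hq0
    obtain ⟨j, hj⟩ : ∃ j, q.coeff j ≠ 0 := by
      by_contra! hc
      exact hq1 (Polynomial.ext hc)
    refine ⟨p.coeff j / q.coeff j, ?_⟩
    have := congrArg (algebraMap E K) (congrArg (coeff · j) h0)
    simp only [coeff_sub, coeff_map, coeff_C_mul, map_sub, map_mul, coeff_zero, map_zero,
      ← IsScalarTower.algebraMap_apply, sub_eq_zero] at this
    rw [map_div₀, this]
    exact mul_div_cancel_right₀ _ (by simpa using hj)
  · simp [← h, aeval_map_algebraMap, mul_comm]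
  · refine (natDegree_sub_le_of_le (natDegree_map_le.trans hp) ?_).trans (max_self n).le
    exact (natDegree_C_mul_le _ _).trans (natDegree_map_le.trans hq)

open Polynomial in
/-- A finite group acting faithfully on `K = k(t, y)`, by fractional linear transformations on `t`
and by multiplying `y` with the corresponding denominators, has purely transcendental fixed
field. -/
theorem fixedField_purelyTranscendental_of_fractional_linear {k K G : Type*} [Field k] [Field K]
    [Algebra k K] [Group G] [Finite G] (htr : Algebra.trdeg k K = 2) (φ : G →* (K ≃ₐ[k] K))
    (hφ : Function.Injective φ) (t y : K) (hgen : IntermediateField.adjoin k {t, y} = ⊤)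
    (a b c d : G → k)
    (ht : ∀ g, φ g t * (algebraMap k K (c g) * t + algebraMap k K (d g)) =
      algebraMap k K (a g) * t + algebraMap k K (b g))
    (hy : ∀ g, φ g y = (algebraMap k K (c g) * t + algebraMap k K (d g)) * y) :
    Nonempty (IntermediateField.fixedField φ.range ≃ₐ[k]
      FractionRing (MvPolynomial (Fin 2) k)) := by
  classical
  have : Fintype G := Fintype.ofFinite G
  have hind : AlgebraicIndependent k ![t, y] := by
    refine algebraicIndependent_of_isAlgebraic_adjoin htr t y ?_
    rw [hgen]
    exact ⟨fun z => isAlgebraic_algebraMap (⟨z, trivial⟩ : (⊤ : IntermediateField k K))⟩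
  have htt : Transcendental k t := hind.transcendental 0
  have hy0 : y ≠ 0 := fun h => hind.transcendental 1 (by simpa [h] using isAlgebraic_zero)
  have hden : ∀ g, algebraMap k K (c g) * t + algebraMap k K (d g) ≠ 0 := fun g h0 => by
    have := hy g
    rw [h0, zero_mul] at this
    exact hy0 ((map_eq_zero (φ g)).1 this)
  have hc : ∀ g, φ g t = t → c g = 0 := fun g hg => by
    by_contra hcg
    refine htt ⟨C (c g) * X ^ 2 + C (d g - a g) * X + C (-b g), fun h0 => hcg ?_, ?_⟩
    · simpa using congrArg (coeff · 2) h0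
    · have := ht g
      rw [hg] at this
      simp only [map_add, map_mul, aeval_C, aeval_X, map_pow, map_sub, map_neg]
      linear_combination this
  let S : Finset K := Finset.univ.image fun g => φ g t
  obtain ⟨m, hm, hcard, hpow⟩ : ∃ m, 0 < m ∧ S.card * m = Nat.card G ∧
      ∀ g, φ g t = t → (φ g y) ^ m = y ^ m := by
    let : MulAction G K := MulAction.compHom K φ
    refine ⟨Nat.card (MulAction.stabilizer G t), Nat.card_pos,
      card_image_smul_mul_card_stabilizer t, fun g hg => ?_⟩
    have hgy : φ g y = algebraMap k K (d g) * y := by rw [hy, hc g hg]; simp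
    have hpowy : ∀ n : ℕ, φ (g ^ n) y = algebraMap k K (d g) ^ n * y := fun n => by
      induction n with
      | zero => simp
      | succ n ih => simp [pow_succ', ih, hgy, mul_left_comm, ← map_pow, mul_assoc]
    have h1 : g ^ Nat.card (MulAction.stabilizer G t) = 1 :=
      congrArg Subtype.val (pow_card_eq_one' (x := (⟨g, hg⟩ : MulAction.stabilizer G t)))
    have h2 := hpowy (Nat.card (MulAction.stabilizer G t))
    rw [h1, map_one, AlgEquiv.one_apply] at h2
    have h3 := mul_right_cancel₀ hy0 ((one_mul y).trans h2)
    rw [hgy, mul_pow, ← h3, one_mul]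
  have hS : ∀ g, S.image (φ g) = S := fun g => by
    refine Finset.eq_of_subset_of_card_le ?_
      (Finset.card_image_of_injective _ (φ g).injective).ge
    intro z hz
    simp only [S, Finset.mem_image, Finset.mem_univ, true_and, exists_exists_eq_and] at hz ⊢
    obtain ⟨h, rfl⟩ := hz
    exact ⟨g * h, by simp⟩
  -- the first invariant is a coefficient of the orbit polynomial of `t`
  let F : K[X] := ∏ s ∈ S, (X - C s)
  have hFφ : ∀ g, F.map (φ g : K →+* K) = F := fun g => by
    conv_rhs => rw [show F = ∏ s ∈ S, (X - C s) from rfl, ← hS g,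
      Finset.prod_image (φ g).injective.injOn]
    simp [F, Polynomial.map_prod]
  obtain ⟨i, hi⟩ : ∃ i, F.coeff i ∉ Set.range (algebraMap k K) := by
    by_contra! h
    choose f hf using h
    have hlift : F ∈ Polynomial.lifts (algebraMap k K) :=
      (Polynomial.lifts_iff_coeff_lifts _).2 fun n => ⟨f n, hf n⟩
    obtain ⟨q, hq⟩ := hlift
    have hF0 : F ≠ 0 := Finset.prod_ne_zero_iff.2 fun s _ => X_sub_C_ne_zero s
    refine htt ⟨q, ?_, ?_⟩
    · rintro rfl
      simp at hq
      exact hF0 hq.symm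
    · rw [← eval_map_algebraMap, ← coe_mapRingHom, hq, eval_prod]
      exact Finset.prod_eq_zero (i := t)
        (Finset.mem_image.2 ⟨(1 : G), Finset.mem_univ _, by simp⟩) (by simp)
  set u := F.coeff i with hu
  have hufix : ∀ g, φ g u = u := fun g => by
    conv_rhs => rw [hu, ← hFφ g, coeff_map]
    rfl
  -- the second invariant is homogeneous of degree `m`
  let β : K → K := Function.extend (fun g => φ g t) (fun g => (φ g y) ^ m) 0
  have hβ : ∀ g, β (φ g t) = (φ g y) ^ m := by
    refine fun g => Function.FactorsThrough.extend_apply (f := fun g => φ g t)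
      (g := fun g => (φ g y) ^ m) (fun g h hgh => ?_) 0 g
    have := hpow (g⁻¹ * h) (by
      rw [map_mul, AlgEquiv.mul_apply, show φ h t = φ g t from hgh.symm, ← AlgEquiv.mul_apply,
        ← map_mul]
      simp)
    have := congrArg (φ g) this
    rw [map_pow, map_pow, ← AlgEquiv.mul_apply, ← map_mul, mul_inv_cancel_left] at this
    exact this.symm
  obtain ⟨j, hj⟩ := exists_sum_pow_mul_ne_zero S
    ⟨t, Finset.mem_image.2 ⟨(1 : G), Finset.mem_univ _, by simp⟩⟩ β (fun s hs => by
      obtain ⟨g, -, rfl⟩ := Finset.mem_image.1 hs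
      rw [hβ]
      exact pow_ne_zero _ ((map_ne_zero (φ g)).2 hy0))
  set v := ∑ s ∈ S, s ^ j * β s with hv
  have hvfix : ∀ g, φ g v = v := fun g => by
    conv_rhs => rw [hv, ← hS g, Finset.sum_image (φ g).injective.injOn]
    rw [hv, map_sum]
    refine Finset.sum_congr rfl fun s hs => ?_
    obtain ⟨h, -, rfl⟩ := Finset.mem_image.1 hs
    rw [map_mul, map_pow, hβ, ← AlgEquiv.mul_apply, ← map_mul, hβ, map_pow, map_mul,
      AlgEquiv.mul_apply, AlgEquiv.mul_apply]
  set E := IntermediateField.adjoin k {u, v} with hE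
  have huE : u ∈ E := IntermediateField.subset_adjoin _ _ (by simp)
  have hvE : v ∈ E := IntermediateField.subset_adjoin _ _ (by simp)
  obtain ⟨q, hqdeg, hq0, hq⟩ := exists_coeff_prod_X_sub_C_eq_div (k := k) t S fun s hs => by
    obtain ⟨g, -, rfl⟩ := Finset.mem_image.1 hs
    refine ⟨C (a g) * X + C (b g), C (c g) * X + C (d g), natDegree_linear_le,
      natDegree_linear_le, by simpa using hden g, ?_⟩
    simp only [map_add, map_mul, aeval_C, aeval_X]
    rw [← ht g, mul_comm]
  obtain ⟨p, hpdeg, hp⟩ := hq i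
  obtain ⟨f, hf0, hft, hfdeg⟩ := exists_polynomial_of_eq_div E huE hi hpdeg hqdeg hq0 hp
  have hgenE : IntermediateField.adjoin E {t, y} = ⊤ := by
    rw [← IntermediateField.restrictScalars_eq_top_iff (K := k), eq_top_iff, ← hgen,
      IntermediateField.adjoin_le_iff]
    exact IntermediateField.subset_adjoin E _
  have hym : y ^ m ∈ IntermediateField.adjoin E {t} := by
    set L := IntermediateField.adjoin E {t} with hL
    have htL : t ∈ L := IntermediateField.mem_adjoin_simple_self E t
    have hkL : ∀ z : k, algebraMap k K z ∈ L := fun z =>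
      (L.restrictScalars k).algebraMap_mem z
    have hdL : ∀ g, algebraMap k K (c g) * t + algebraMap k K (d g) ∈ L := fun g =>
      add_mem (mul_mem (hkL _) htL) (hkL _)
    have hvym : v = (∑ s ∈ S, s ^ j * (β s / y ^ m)) * y ^ m := by
      rw [Finset.sum_mul, hv]
      refine Finset.sum_congr rfl fun s _ => ?_
      field_simp
    have hsum : ∑ s ∈ S, s ^ j * (β s / y ^ m) ∈ L := by
      refine sum_mem fun s hs => ?_
      obtain ⟨g, -, rfl⟩ := Finset.mem_image.1 hs
      refine mul_mem (pow_mem ?_ _) ?_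
      · rw [eq_div_of_mul_eq (hden g) (ht g)]
        exact div_mem (add_mem (mul_mem (hkL _) htL) (hkL _)) (hdL g)
      · rw [hβ, hy, mul_pow, mul_div_cancel_right₀ _ (pow_ne_zero _ hy0)]
        exact pow_mem (hdL g) _
    have hne : ∑ s ∈ S, s ^ j * (β s / y ^ m) ≠ 0 := fun h0 => hj (by rw [hvym, h0, zero_mul])
    rw [eq_div_of_mul_eq hne ((mul_comm _ _).trans hvym.symm)]
    exact div_mem (L.algebraMap_mem ⟨v, hvE⟩) hsum
  obtain ⟨hfin, hrank⟩ := finite_and_finrank_le_of_pow_mem hgenE hf0 hft hm hym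
  have hle : E ≤ IntermediateField.fixedField φ.range := by
    rw [hE, IntermediateField.adjoin_le_iff]
    rintro z (rfl | rfl) ⟨_, g, rfl⟩
    exacts [hufix g, hvfix g]
  have heq : E = IntermediateField.fixedField φ.range := by
    refine IntermediateField.eq_of_le_of_finrank_le' hle ?_
    have h1 : Module.finrank (IntermediateField.fixedField φ.range) K = Nat.card G := by
      have : Fintype φ.range := Fintype.ofFinite _
      rw [Nat.card_congr (MonoidHom.ofInjective hφ).toEquiv, Nat.card_eq_fintype_card]
      exact FixedPoints.finrank_eq_card φ.range K
    rw [h1, ← hcard]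
    exact hrank.trans (Nat.mul_le_mul_right m hfdeg)
  have huv := algebraicIndependent_of_isAlgebraic_adjoin htr u v inferInstance
  have hrange : IntermediateField.adjoin k (Set.range ![u, v]) =
      IntermediateField.fixedField φ.range := by
    rw [← heq, hE]
    simp [Set.pair_comm]
  exact ⟨(IntermediateField.equivOfEq hrange).symm.trans huv.aevalEquivField.symm⟩

open MvPolynomial Matrix

/-- **Linear Noether's problem in two variables.**
Let `k` be a field and `G` an arbitrary finite subgroup of `GL_2(k)`, acting on the rational
function field `K = k(x_1, x_2)` (the fraction field of `k[x_1, x_2]`) by `k`-algebra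
automorphisms via linear substitutions of the variables: `g • x_j = ∑ i, g i j • x_i`, encoded
by the homomorphism `φ`.  Then the fixed field `K^G` is purely transcendental over `k` of
transcendence degree `2`. -/
theorem linearNoether_dim_two
    (k : Type*) [Field k]
    (G : Subgroup (GL (Fin 2) k)) [Finite G]
    (K : Type*) [Field K] [Algebra k K]
    [Algebra (MvPolynomial (Fin 2) k) K] [IsScalarTower k (MvPolynomial (Fin 2) k) K]
    [IsFractionRing (MvPolynomial (Fin 2) k) K]
    (φ : ↥G →* (K ≃ₐ[k] K))
    (hφ : ∀ (g : ↥G) (j : Fin 2),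
      φ g (algebraMap (MvPolynomial (Fin 2) k) K (X j)) =
        algebraMap (MvPolynomial (Fin 2) k) K
          (∑ i, C (((g : GL (Fin 2) k) : Matrix (Fin 2) (Fin 2) k) i j) * X i)) :
    Nonempty (↥(IntermediateField.fixedField φ.range) ≃ₐ[k]
      FractionRing (MvPolynomial (Fin 2) k)) := by
  set ι := algebraMap (MvPolynomial (Fin 2) k) K with hι
  have hinj : Function.Injective ι := IsFractionRing.injective _ _
  have hιC : ∀ z, ι (C z) = algebraMap k K z := fun z =>
    (IsScalarTower.algebraMap_apply k (MvPolynomial (Fin 2) k) K z).symm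
  have hX : ∀ i, ι (X i) ≠ 0 := fun i => (map_ne_zero_iff ι hinj).2 (X_ne_zero i)
  have htr : Algebra.trdeg k K = 2 := by
    have := IsLocalization.isAlgebraic K (nonZeroDivisors (MvPolynomial (Fin 2) k))
    have := ((IsTranscendenceBasis.mvPolynomial (Fin 2) k).algebraMap_comp (A := K))
    simpa using this.lift_cardinalMk_eq_trdeg.symm
  have hgen : IntermediateField.adjoin k {ι (X 0) / ι (X 1), ι (X 1)} = ⊤ := by
    set L := IntermediateField.adjoin k {ι (X 0) / ι (X 1), ι (X 1)}
    have h1 : ι (X 1) ∈ L := IntermediateField.subset_adjoin _ _ (by simp)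
    have h0 : ι (X 0) ∈ L := by
      rw [← div_mul_cancel₀ (ι (X 0)) (hX 1)]
      exact mul_mem (IntermediateField.subset_adjoin _ _ (by simp)) h1
    have hp : ∀ p, ι p ∈ L := fun p => by
      induction p using MvPolynomial.induction_on with
      | C z => rw [hιC]; exact L.algebraMap_mem z
      | add p q hp hq => rw [map_add]; exact add_mem hp hq
      | mul_X p i hp =>
        rw [map_mul]
        refine mul_mem hp ?_
        fin_cases i
        exacts [h0, h1]
    refine eq_top_iff.2 fun z _ => ?_
    obtain ⟨p, q, -, rfl⟩ := IsFractionRing.div_surjective (A := MvPolynomial (Fin 2) k) z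
    exact div_mem (hp p) (hp q)
  have hφ' : ∀ (g : G) (j : Fin 2), φ g (ι (X j)) =
      algebraMap k K ((g : GL (Fin 2) k) 0 j) * ι (X 0) +
        algebraMap k K ((g : GL (Fin 2) k) 1 j) * ι (X 1) := fun g j => by
    rw [hφ, Fin.sum_univ_two, map_add, map_mul, map_mul, hιC, hιC]
  have hφinj : Function.Injective φ := by
    refine (injective_iff_map_eq_one φ).2 fun g hg => ?_
    refine Subtype.ext (Units.ext (Matrix.ext fun i j => ?_))
    have h := hφ g j
    rw [hg, AlgEquiv.one_apply] at h
    have := congrArg (coeff (Finsupp.single i 1)) (hinj h)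
    fin_cases i <;> fin_cases j <;> simpa [coeff_X, Finsupp.single_left_inj, eq_comm] using this
  refine fixedField_purelyTranscendental_of_fractional_linear htr φ hφinj _ _ hgen
    (fun g => (g : GL (Fin 2) k) 0 0) (fun g => (g : GL (Fin 2) k) 1 0)
    (fun g => (g : GL (Fin 2) k) 0 1) (fun g => (g : GL (Fin 2) k) 1 1) (fun g => ?_)
    (fun g => ?_)
  · have h1 : φ g (ι (X 1)) ≠ 0 := (map_ne_zero (φ g)).2 (hX 1)
    have := hX 1
    rw [map_div₀, div_mul_eq_mul_div, div_eq_iff h1, hφ', hφ']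
    field_simp
  · have := hX 1
    rw [hφ']
    field_simp
end

section
/- Let k be a field, V a finite-dimensional k-vector space of dimension n, and G a finite subgroup of GL(V) whose order is invertible in k (char k does not divide |G|). If G is generated by pseudo-reflections, then the fixed field of G acting on the fraction field of the symmetric algebra S(V*) is purely transcendental over k of transcendence degree n. -/
open MvPolynomial Matrix

section LinearSubstitution

variable {σ k : Type*} [Fintype σ] [Field k]

/-- The linear substitution `x_j ↦ ∑ i, A i j • x_i` attached to a square matrix. -/
noncomputable def linSubst (A : Matrix σ σ k) : MvPolynomial σ k →ₐ[k] MvPolynomial σ k :=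
  aeval fun j => ∑ i, C (A i j) * X i

@[simp]
lemma linSubst_X (A : Matrix σ σ k) (j : σ) : linSubst A (X j) = ∑ i, C (A i j) * X i := by
  simp [linSubst]

@[simp]
lemma linSubst_C (A : Matrix σ σ k) (c : k) : linSubst A (C c) = C c := by
  simp [linSubst]

lemma isHomogeneous_linSubst (A : Matrix σ σ k) {p : MvPolynomial σ k} {d : ℕ}
    (hp : p.IsHomogeneous d) : (linSubst A p).IsHomogeneous d := by
  have := hp.aeval (fun j => ∑ i, C (A i j) * X i) (n := 1) fun j =>
    IsHomogeneous.sum _ _ _ fun i _ => by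
      simpa using (isHomogeneous_C σ (A i j)).mul (isHomogeneous_X k i)
  simpa [linSubst] using this

lemma linSubst_mul (A B : Matrix σ σ k) : linSubst (A * B) = (linSubst A).comp (linSubst B) := by
  ext j : 1
  simp only [linSubst_X, AlgHom.comp_apply, map_sum, map_mul, linSubst_C, Matrix.mul_apply,
    Finset.sum_mul, Finset.mul_sum]
  rw [Finset.sum_comm]
  exact Finset.sum_congr rfl fun _ _ => Finset.sum_congr rfl fun _ _ => by ring

lemma linSubst_mul_apply (A B : Matrix σ σ k) (p : MvPolynomial σ k) :
    linSubst (A * B) p = linSubst A (linSubst B p) := by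
  rw [linSubst_mul, AlgHom.comp_apply]

/-- The diagonal action of a matrix on polynomial vectors: it acts on the entries by linear
substitution and on vectors by multiplication. -/
noncomputable def vecSubst (A : Matrix σ σ k) (w : σ → MvPolynomial σ k) :
    σ → MvPolynomial σ k :=
  fun i => ∑ j, C (A i j) * linSubst A (w j)

lemma vecSubst_mul (A B : Matrix σ σ k) (w : σ → MvPolynomial σ k) :
    vecSubst (A * B) w = vecSubst A (vecSubst B w) := by
  ext1 i
  simp only [vecSubst, linSubst_mul_apply, Matrix.mul_apply, map_sum, map_mul, linSubst_C,
    Finset.sum_mul, Finset.mul_sum]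
  rw [Finset.sum_comm]
  exact Finset.sum_congr rfl fun _ _ => Finset.sum_congr rfl fun _ _ => by ring

lemma sum_vecSubst_mul_X (A : Matrix σ σ k) (w : σ → MvPolynomial σ k) :
    ∑ i, vecSubst A w i * X i = linSubst A (∑ i, w i * X i) := by
  simp only [vecSubst, map_sum, map_mul, linSubst_X, Finset.sum_mul, Finset.mul_sum]
  rw [Finset.sum_comm]
  exact Finset.sum_congr rfl fun _ _ => Finset.sum_congr rfl fun _ _ => by ring

lemma linSubst_one [DecidableEq σ] : linSubst (1 : Matrix σ σ k) = AlgHom.id k _ := by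
  ext j : 1
  simp [Matrix.one_apply]

lemma constantCoeff_linSubst (A : Matrix σ σ k) (p : MvPolynomial σ k) :
    constantCoeff (linSubst A p) = constantCoeff p := by
  have h : ((constantCoeff : MvPolynomial σ k →+* k).comp (linSubst A).toRingHom) =
      constantCoeff := by
    ext j <;> simp
  exact DFunLike.congr_fun h p

lemma homogeneousComponent_linSubst (A : Matrix σ σ k) (p : MvPolynomial σ k) (d : ℕ) :
    homogeneousComponent d (linSubst A p) = linSubst A (homogeneousComponent d p) := by
  conv_lhs => rw [← sum_homogeneousComponent p]
  simp only [map_sum]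
  have h (i : ℕ) : homogeneousComponent d (linSubst A (homogeneousComponent i p)) =
      if i = d then linSubst A (homogeneousComponent d p) else 0 := by
    rw [homogeneousComponent_of_mem
      (isHomogeneous_linSubst A (homogeneousComponent_isHomogeneous i p))]
    split_ifs with h₁ h₂ h₂ <;> simp_all
  simp only [h, Finset.sum_ite_eq', Finset.mem_range]
  split_ifs with hd
  · rfl
  · rw [homogeneousComponent_eq_zero _ _ (by omega), map_zero]

lemma totalDegree_linSubst_le (A : Matrix σ σ k) (p : MvPolynomial σ k) :
    (linSubst A p).totalDegree ≤ p.totalDegree := by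
  conv_lhs => rw [← sum_homogeneousComponent p, map_sum]
  refine totalDegree_finsetSum_le fun i hi => ?_
  exact (isHomogeneous_linSubst A (homogeneousComponent_isHomogeneous i p)).totalDegree_le.trans
    (Nat.lt_succ_iff.1 (Finset.mem_range.1 hi))

/-- A matrix `A` with `A - 1` of rank one moves polynomials by multiples of a fixed nonzero
linear form. -/
lemma exists_linearForm_dvd_linSubst_sub [DecidableEq σ] {A : Matrix σ σ k}
    (hA : Module.finrank k (LinearMap.ker (Matrix.mulVecLin (A - 1))) + 1 = Fintype.card σ) :
    ∃ l : MvPolynomial σ k, l ≠ 0 ∧ l.IsHomogeneous 1 ∧ ∀ p, l ∣ linSubst A p - p := by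
  have hr : Module.finrank k (LinearMap.range (Matrix.mulVecLin (A - 1))) = 1 := by
    have := LinearMap.finrank_range_add_finrank_ker (Matrix.mulVecLin (A - 1))
    rw [Module.finrank_fintype_fun_eq_card] at this
    omega
  obtain ⟨a, ha0, ha⟩ := finrank_eq_one_iff'.1 hr
  have hcol (j : σ) : ∃ c : k, ∀ i, A i j - (1 : Matrix σ σ k) i j = c * a.1 i := by
    obtain ⟨c, hc⟩ := ha ⟨_, LinearMap.mem_range_self _ (Pi.single j 1)⟩
    refine ⟨c, fun i => ?_⟩
    have := congr_fun (congrArg Subtype.val hc) i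
    simpa [Matrix.one_apply, Pi.single_apply] using this.symm
  have hl : (∑ i, C (a.1 i) * X i : MvPolynomial σ k) ≠ 0 := by
    intro h
    apply ha0
    ext i
    have := congrArg (coeff (Finsupp.single i 1)) h
    simpa [coeff_sum, coeff_C_mul, coeff_X, Finsupp.single_left_inj] using this
  refine ⟨_, hl, IsHomogeneous.sum _ _ _ fun i _ => by
    simpa using (isHomogeneous_C σ (a.1 i)).mul (isHomogeneous_X k i), fun p => ?_⟩
  rw [← Ideal.mem_span_singleton]
  set J := Ideal.span {(∑ i, C (a.1 i) * X i : MvPolynomial σ k)}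
  have h : (Ideal.Quotient.mkₐ k J).comp (linSubst A) = Ideal.Quotient.mkₐ k J := by
    ext j
    obtain ⟨c, hc⟩ := hcol j
    rw [AlgHom.comp_apply, Ideal.Quotient.mkₐ_eq_mk, Ideal.Quotient.eq, linSubst_X,
      Ideal.mem_span_singleton]
    refine ⟨C c, ?_⟩
    have hX : (X j : MvPolynomial σ k) = ∑ i, C ((1 : Matrix σ σ k) i j) * X i := by
      simp [Matrix.one_apply]
    rw [hX, ← Finset.sum_sub_distrib, Finset.sum_mul]
    refine Finset.sum_congr rfl fun i _ => ?_
    rw [← sub_mul, ← C_sub, hc, C_mul]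
    ring
  exact Ideal.Quotient.eq.1 ((DFunLike.congr_fun h p))

end LinearSubstitution

section Invariants

variable {σ k : Type*} [Fintype σ] [DecidableEq σ] [Field k]

/-- The algebra of polynomials invariant under a linear group. -/
noncomputable def polyInvariants (G : Subgroup (GL σ k)) : Subalgebra k (MvPolynomial σ k) where
  carrier := {p | ∀ g : G, linSubst (g.1 : Matrix σ σ k) p = p}
  mul_mem' hp hq g := by rw [map_mul, hp g, hq g]
  add_mem' hp hq g := by rw [map_add, hp g, hq g]
  algebraMap_mem' c g := by simp [algebraMap_eq]

/-- The invariant polynomials without constant term. -/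
noncomputable def irrelevantInvariants (G : Subgroup (GL σ k)) :
    Submodule k (MvPolynomial σ k) :=
  Subalgebra.toSubmodule (polyInvariants G) ⊓ LinearMap.ker (lcoeff k (0 : σ →₀ ℕ))

/-- The ideal generated by the invariants without constant term. -/
noncomputable def hilbertIdeal (G : Subgroup (GL σ k)) : Ideal (MvPolynomial σ k) :=
  Ideal.span (irrelevantInvariants G : Set (MvPolynomial σ k))

/-- Averaging over a finite linear group. -/
noncomputable def reynolds (G : Subgroup (GL σ k)) [Fintype G] :
    MvPolynomial σ k →ₗ[k] MvPolynomial σ k :=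
  (Nat.card G : k)⁻¹ • ∑ g : G, (linSubst (g.1 : Matrix σ σ k)).toLinearMap

variable {G : Subgroup (GL σ k)}

lemma mem_irrelevantInvariants {p : MvPolynomial σ k} :
    p ∈ irrelevantInvariants G ↔ p ∈ polyInvariants G ∧ constantCoeff p = 0 := by
  simp [irrelevantInvariants, constantCoeff_eq]

lemma linSubst_coe_mul (g h : G) (p : MvPolynomial σ k) :
    linSubst ((g * h : G).1 : Matrix σ σ k) p =
      linSubst (g.1 : Matrix σ σ k) (linSubst (h.1 : Matrix σ σ k) p) := by
  simp [linSubst_mul_apply]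

lemma linSubst_mem_hilbertIdeal (g : G) {p : MvPolynomial σ k} (hp : p ∈ hilbertIdeal G) :
    linSubst (g.1 : Matrix σ σ k) p ∈ hilbertIdeal G := by
  suffices h : hilbertIdeal G ≤ (hilbertIdeal G).comap (linSubst (g.1 : Matrix σ σ k)) from h hp
  refine Ideal.span_le.2 fun q hq => ?_
  have hq' := mem_irrelevantInvariants.1 hq
  simp only [SetLike.mem_coe, Ideal.mem_comap, hq'.1 g]
  exact Ideal.subset_span hq

lemma homogeneousComponent_mem_polyInvariants {p : MvPolynomial σ k} (hp : p ∈ polyInvariants G)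
    (d : ℕ) : homogeneousComponent d p ∈ polyInvariants G := fun g => by
  rw [← homogeneousComponent_linSubst, hp g]

lemma sub_C_constantCoeff_mem_hilbertIdeal {p : MvPolynomial σ k} (hp : p ∈ polyInvariants G) :
    p - C (constantCoeff p) ∈ hilbertIdeal G :=
  Ideal.subset_span (mem_irrelevantInvariants.2
    ⟨sub_mem hp ((polyInvariants G).algebraMap_mem _), by simp⟩)

section Averaging

variable [Fintype G]

lemma reynolds_apply (p : MvPolynomial σ k) :
    reynolds G p = C (Nat.card G : k)⁻¹ * ∑ g : G, linSubst (g.1 : Matrix σ σ k) p := by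
  simp [reynolds, LinearMap.sum_apply, smul_eq_C_mul]

lemma reynolds_mem (p : MvPolynomial σ k) : reynolds G p ∈ polyInvariants G := fun g => by
  have h : ∑ h : G, linSubst (g.1 : Matrix σ σ k) (linSubst (h.1 : Matrix σ σ k) p) =
      ∑ h : G, linSubst (h.1 : Matrix σ σ k) p :=
    Fintype.sum_equiv (Equiv.mulLeft g) _ _ fun h => (linSubst_coe_mul g h p).symm
  rw [reynolds_apply, map_mul, linSubst_C, map_sum, h]

lemma reynolds_mul {p : MvPolynomial σ k} (hp : p ∈ polyInvariants G) (q : MvPolynomial σ k) :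
    reynolds G (p * q) = p * reynolds G q := by
  simp only [reynolds_apply, map_mul, hp _, ← Finset.mul_sum]
  ring

lemma C_card_inv_mul_card (hord : (Nat.card G : k) ≠ 0) :
    (C (Nat.card G : k)⁻¹ * (Fintype.card G : MvPolynomial σ k)) = 1 := by
  rw [← C_eq_coe_nat, ← C_mul, ← Nat.card_eq_fintype_card, inv_mul_cancel₀ hord, C_1]

lemma reynolds_of_mem (hord : (Nat.card G : k) ≠ 0) {p : MvPolynomial σ k}
    (hp : p ∈ polyInvariants G) : reynolds G p = p := by
  simp only [reynolds_apply, hp _, Finset.sum_const, Finset.card_univ, nsmul_eq_mul]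
  rw [← mul_assoc, C_card_inv_mul_card hord, one_mul]

lemma constantCoeff_reynolds (hord : (Nat.card G : k) ≠ 0) (p : MvPolynomial σ k) :
    constantCoeff (reynolds G p) = constantCoeff p := by
  simp only [reynolds_apply, map_mul, constantCoeff_C, map_sum, constantCoeff_linSubst,
    Finset.sum_const, Finset.card_univ, nsmul_eq_mul, ← Nat.card_eq_fintype_card]
  field_simp

lemma reynolds_sub_self_mem (hord : (Nat.card G : k) ≠ 0) {I : Ideal (MvPolynomial σ k)}
    {p : MvPolynomial σ k} (h : ∀ g : G, linSubst (g.1 : Matrix σ σ k) p - p ∈ I) :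
    reynolds G p - p ∈ I := by
  have : reynolds G p - p =
      C (Nat.card G : k)⁻¹ * ∑ g : G, (linSubst (g.1 : Matrix σ σ k) p - p) := by
    rw [Finset.sum_sub_distrib, mul_sub, ← reynolds_apply, Finset.sum_const, Finset.card_univ,
      nsmul_eq_mul, ← mul_assoc, C_card_inv_mul_card hord, one_mul]
  rw [this]
  exact I.mul_mem_left _ (I.sum_mem fun g _ => h g)

/-- The trace form of a finite linear group is nondegenerate. -/
lemma eq_zero_of_reynolds_mul_eq_zero (hord : (Nat.card G : k) ≠ 0) {p : MvPolynomial σ k}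
    (h : ∀ t, reynolds G (t * p) = 0) : p = 0 := by
  classical
  have hN : (∏ g : G, linSubst (g.1 : Matrix σ σ k) p) ∈ polyInvariants G := fun g => by
    rw [map_prod]
    exact Fintype.prod_equiv (Equiv.mulLeft g) _ _ fun h => (linSubst_coe_mul g h p).symm
  have h1 : linSubst (((1 : G) : GL σ k) : Matrix σ σ k) p = p := by simp [linSubst_one]
  have := h (∏ g ∈ Finset.univ.erase (1 : G), linSubst (g.1 : Matrix σ σ k) p)
  nth_rw 2 [← h1] at this
  rw [Finset.prod_erase_mul _ _ (Finset.mem_univ _), reynolds_of_mem hord hN,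
    Finset.prod_eq_zero_iff] at this
  obtain ⟨g, -, hg⟩ := this
  have hinv : linSubst ((g⁻¹ * g : G).1 : Matrix σ σ k) p = 0 := by
    rw [linSubst_coe_mul, hg, map_zero]
  rwa [inv_mul_cancel, h1] at hinv

/-- Chevalley's lemma, localized at the irrelevant ideal of the invariant algebra. -/
lemma mem_hilbertIdeal_of_sum_eq_zero (hord : (Nat.card G : k) ≠ 0) {T : Set (GL σ k)}
    (hT : Subgroup.closure T = G)
    (hrefl : ∀ g ∈ T, ∃ l : MvPolynomial σ k, l ≠ 0 ∧ l.IsHomogeneous 1 ∧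
      ∀ p, l ∣ linSubst (g : Matrix σ σ k) p - p)
    {ι : Type*} [Fintype ι] {r₀ : MvPolynomial σ k} {r : ι → MvPolynomial σ k}
    (hr₀ : r₀ ∈ polyInvariants G) (hr : ∀ i, r i ∈ polyInvariants G)
    (hmin : ∀ u ∈ polyInvariants G, ∀ c : ι → MvPolynomial σ k,
      (∀ i, c i ∈ polyInvariants G) → u * r₀ = ∑ i, c i * r i → constantCoeff u = 0)
    (p₀ : MvPolynomial σ k) (p : ι → MvPolynomial σ k) (h : r₀ * p₀ + ∑ i, r i * p i = 0) :
    p₀ ∈ hilbertIdeal G := by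
  induction hd : p₀.totalDegree using Nat.strong_induction_on generalizing p₀ p with
  | _ d ih =>
  have hgen (g : GL σ k) (hg : g ∈ T) : linSubst (g : Matrix σ σ k) p₀ - p₀ ∈ hilbertIdeal G := by
    obtain ⟨l, hl0, hl1, hl⟩ := hrefl g hg
    have hgG : g ∈ G := hT ▸ Subgroup.subset_closure hg
    obtain ⟨q₀, hq₀⟩ := hl p₀
    choose q hq using fun i => hl (p i)
    have hrel : r₀ * q₀ + ∑ i, r i * q i = 0 := by
      apply mul_left_cancel₀ hl0
      have h' := congrArg (linSubst (g : Matrix σ σ k)) h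
      simp only [map_add, map_mul, map_sum, hr₀ ⟨g, hgG⟩, (fun i => hr i ⟨g, hgG⟩), map_zero] at h'
      have : l * (r₀ * q₀ + ∑ i, r i * q i) = r₀ * (l * q₀) + ∑ i, r i * (l * q i) := by
        rw [mul_add, Finset.mul_sum]
        congr 1
        · ring
        · exact Finset.sum_congr rfl fun i _ => by ring
      rw [this, ← hq₀]
      simp only [← hq, mul_sub, Finset.sum_sub_distrib, mul_zero]
      linear_combination h' - h
    rw [hq₀]
    by_cases hq0 : q₀ = 0
    · simp [hq0]
    refine Ideal.mul_mem_left _ _ (ih _ ?_ q₀ q hrel rfl)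
    have hle : (linSubst (g : Matrix σ σ k) p₀ - p₀).totalDegree ≤ p₀.totalDegree := by
      exact (totalDegree_sub _ _).trans (max_le (totalDegree_linSubst_le _ _) le_rfl)
    rw [hq₀, totalDegree_mul_of_isDomain hl0 hq0, hl1.totalDegree hl0, hd] at hle
    omega
  have hall (g : G) : linSubst (g.1 : Matrix σ σ k) p₀ - p₀ ∈ hilbertIdeal G := by
    obtain ⟨g, hg⟩ := g
    have hg' : g ∈ Subgroup.closure T := hT ▸ hg
    change linSubst (g : Matrix σ σ k) p₀ - p₀ ∈ hilbertIdeal G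
    have hmul {x y : GL σ k} (hx : x ∈ G)
        (hx' : linSubst (x : Matrix σ σ k) p₀ - p₀ ∈ hilbertIdeal G)
        (hy' : linSubst (y : Matrix σ σ k) p₀ - p₀ ∈ hilbertIdeal G) :
        linSubst ((x * y : GL σ k) : Matrix σ σ k) p₀ - p₀ ∈ hilbertIdeal G := by
      rw [Units.val_mul, linSubst_mul_apply]
      have := add_mem (linSubst_mem_hilbertIdeal ⟨x, hx⟩ hy') hx'
      simpa using this
    induction hg' using Subgroup.closure_induction with
    | mem x hx => exact hgen x hx
    | one => simp [linSubst_one]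
    | mul x y hx hy ihx ihy =>
      rw [hT] at hx hy
      exact hmul hx (ihx hx) (ihy hy)
    | inv x hx ihx =>
      rw [hT] at hx
      have := neg_mem (linSubst_mem_hilbertIdeal ⟨x⁻¹, inv_mem hx⟩ (ihx hx))
      rw [map_sub, ← linSubst_mul_apply, ← Units.val_mul, inv_mul_cancel, Units.val_one,
        linSubst_one] at this
      simpa using this
  have hρ : reynolds G p₀ ∈ hilbertIdeal G := by
    refine Ideal.subset_span (mem_irrelevantInvariants.2 ⟨reynolds_mem _, ?_⟩)
    refine hmin _ (reynolds_mem _) (fun i => -reynolds G (p i))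
      (fun i => neg_mem (reynolds_mem _)) ?_
    have := congrArg (reynolds G) h
    simp only [map_add, map_sum, reynolds_mul hr₀, reynolds_mul (hr _), map_zero] at this
    have hneg : ∑ i, -reynolds G (p i) * r i = -∑ i, r i * reynolds G (p i) := by
      rw [← Finset.sum_neg_distrib]
      exact Finset.sum_congr rfl fun i _ => by ring
    rw [hneg]
    linear_combination this
  simpa using sub_mem hρ (reynolds_sub_self_mem hord hall)

/-- Vectors of polynomials that are linearly independent modulo the Hilbert ideal are linearly
independent over the invariants. -/
lemma eq_zero_of_sum_mul_eq_zero (hord : (Nat.card G : k) ≠ 0) {T : Set (GL σ k)}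
    (hT : Subgroup.closure T = G)
    (hrefl : ∀ g ∈ T, ∃ l : MvPolynomial σ k, l ≠ 0 ∧ l.IsHomogeneous 1 ∧
      ∀ p, l ∣ linSubst (g : Matrix σ σ k) p - p)
    {τ : Type*} {s : ℕ} (v : Fin s → τ → MvPolynomial σ k) (r : Fin s → MvPolynomial σ k)
    (hr : ∀ i, r i ∈ polyInvariants G)
    (hv : ∀ c : Fin s → k, (∀ j, ∑ i, C (c i) * v i j ∈ hilbertIdeal G) → ∀ i, c i = 0)
    (h : ∀ j, ∑ i, r i * v i j = 0) (i : Fin s) : r i = 0 := by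
  induction s with
  | zero => exact i.elim0
  | succ s ih =>
  simp only [Fin.sum_univ_succ] at h hv
  obtain ⟨j, hj⟩ : ∃ j, v 0 j ∉ hilbertIdeal G := by
    by_contra! hcon
    simpa using hv (Pi.single 0 1) (fun j => by simpa [Fin.succ_ne_zero] using hcon j) 0
  obtain ⟨u, hu, c, hc, huc, hu0⟩ : ∃ u ∈ polyInvariants G, ∃ c : Fin s → MvPolynomial σ k,
      (∀ i, c i ∈ polyInvariants G) ∧ u * r 0 = ∑ i, c i * r i.succ ∧ constantCoeff u ≠ 0 := by
    by_contra! hcon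
    exact hj (mem_hilbertIdeal_of_sum_eq_zero (r₀ := r 0) (r := fun i : Fin s => r i.succ)
      hord hT hrefl (hr 0) (fun i => hr i.succ) hcon (v 0 j) (fun i => v i.succ j) (h j))
  have hsucc := ih (fun i j => u * v i.succ j + c i * v 0 j) (fun i => r i.succ)
    (fun i => hr i.succ) (fun d hd => ?_) (fun j => ?_)
  · have hr0 : r 0 = 0 := by
      simp only [hsucc, mul_zero, Finset.sum_const_zero] at huc
      refine (mul_eq_zero.1 huc).resolve_left fun hu' => hu0 (by simp [hu'])
    exact Fin.cases hr0 hsucc i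
  · have key := hv (Fin.cons (∑ i, d i * constantCoeff (c i)) fun i => d i * constantCoeff u)
      fun j => ?_
    · intro i
      simpa [hu0] using key i.succ
    · have hmem : ∑ i, C (d i) * ((u - C (constantCoeff u)) * v i.succ j +
          (c i - C (constantCoeff (c i))) * v 0 j) ∈ hilbertIdeal G :=
        Ideal.sum_mem _ fun i _ => Ideal.mul_mem_left _ _ (add_mem
          (Ideal.mul_mem_right _ _ (sub_C_constantCoeff_mem_hilbertIdeal hu))
          (Ideal.mul_mem_right _ _ (sub_C_constantCoeff_mem_hilbertIdeal (hc i))))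
      have := sub_mem (hd j) hmem
      rw [← Finset.sum_sub_distrib] at this
      convert this using 1
      simp only [Fin.cons_zero, Fin.cons_succ, map_sum, Finset.sum_mul, ← Finset.sum_add_distrib]
      refine Finset.sum_congr rfl fun i _ => ?_
      simp only [C_mul]
      ring
  · have h1 : ∑ i, r (Fin.succ i) * (u * v i.succ j + c i * v 0 j) =
        u * ∑ i, r (Fin.succ i) * v i.succ j + (∑ i, c i * r i.succ) * v 0 j := by
      rw [Finset.mul_sum, Finset.sum_mul, ← Finset.sum_add_distrib]
      exact Finset.sum_congr rfl fun i _ => by ring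
    rw [h1, ← huc]
    linear_combination u * h j

/-- Invariant vectors that are linearly independent over the invariants are linearly independent
over the polynomial ring. -/
lemma linearIndependent_of_vecSubst_eq (hord : (Nat.card G : k) ≠ 0) {ι : Type*} [Fintype ι]
    {v : ι → σ → MvPolynomial σ k}
    (hinv : ∀ (g : G) i, vecSubst (g.1 : Matrix σ σ k) (v i) = v i)
    (hv : ∀ r : ι → MvPolynomial σ k, (∀ i, r i ∈ polyInvariants G) →
      (∀ j, ∑ i, r i * v i j = 0) → ∀ i, r i = 0) :
    LinearIndependent (MvPolynomial σ k) v := by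
  rw [Fintype.linearIndependent_iff]
  intro a ha i
  have ha' (j : σ) : ∑ i, a i * v i j = 0 := by simpa using congr_fun ha j
  refine eq_zero_of_reynolds_mul_eq_zero hord fun t => ?_
  refine hv (fun i => reynolds G (t * a i)) (fun i => reynolds_mem _) (fun l => ?_) i
  have hg (g : G) : ∑ i, linSubst (g.1 : Matrix σ σ k) (t * a i) * v i l = 0 := by
    have h1 : ∑ i, linSubst (g.1 : Matrix σ σ k) (t * a i) * v i l =
        ∑ j, C ((g.1 : Matrix σ σ k) l j) *
          linSubst (g.1 : Matrix σ σ k) (t * ∑ i, a i * v i j) := by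
      conv_lhs => enter [2, i]; rw [← hinv g i]
      simp only [vecSubst, map_mul, map_sum, Finset.mul_sum]
      rw [Finset.sum_comm]
      exact Finset.sum_congr rfl fun _ _ => Finset.sum_congr rfl fun _ _ => by ring
    simp only [h1, ha', mul_zero, map_zero, Finset.sum_const_zero]
  simp only [reynolds_apply, mul_assoc, Finset.sum_mul, ← Finset.mul_sum]
  rw [Finset.sum_comm]
  simp only [hg, Finset.sum_const_zero, mul_zero]

/-- Every invariant without constant term is the contraction of an invariant vector. -/
lemma exists_vecSubst_eq_sum_mul_X_eq (hord : (Nat.card G : k) ≠ 0) {p : MvPolynomial σ k}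
    (hp : p ∈ irrelevantInvariants G) :
    ∃ v : σ → MvPolynomial σ k,
      (∀ g : G, vecSubst (g.1 : Matrix σ σ k) v = v) ∧ ∑ j, v j * X j = p := by
  obtain ⟨hp, hp0⟩ := mem_irrelevantInvariants.1 hp
  obtain ⟨w, hw⟩ : ∃ w : σ → MvPolynomial σ k, ∑ j, w j * X j = p := by
    have : p ∈ idealOfVars σ k := by
      rw [← pow_one (idealOfVars σ k), mem_pow_idealOfVars_iff']
      intro x hx
      have : x = 0 := (Finsupp.degree_eq_zero_iff x).1 (by simpa using hx)
      rw [this, ← constantCoeff_eq, hp0]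
    simpa [Ideal.mem_span_range_iff_exists_fun] using this
  refine ⟨fun i => C (Nat.card G : k)⁻¹ * ∑ g : G, vecSubst (g.1 : Matrix σ σ k) w i,
    fun g => funext fun i => ?_, ?_⟩
  · have h1 : ∑ h : G, vecSubst (g.1 : Matrix σ σ k) (vecSubst (h.1 : Matrix σ σ k) w) i =
        ∑ h : G, vecSubst (h.1 : Matrix σ σ k) w i :=
      Fintype.sum_equiv (Equiv.mulLeft g) _ _ fun h => by
        simp [vecSubst_mul]
    rw [← h1]
    conv_lhs => rw [vecSubst]
    conv_rhs => enter [2, 2, h]; rw [vecSubst]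
    simp only [map_mul, linSubst_C, map_sum, Finset.mul_sum]
    rw [Finset.sum_comm]
    exact Finset.sum_congr rfl fun _ _ => Finset.sum_congr rfl fun _ _ => by ring
  · rw [← reynolds_of_mem hord hp, reynolds_apply]
    simp only [mul_assoc, Finset.sum_mul, ← Finset.mul_sum]
    rw [Finset.sum_comm]
    simp only [sum_vecSubst_mul_X, hw]

lemma reynolds_mul_mem_of_mem_hilbertIdeal (hord : (Nat.card G : k) ≠ 0) {y : MvPolynomial σ k}
    (hy : y ∈ hilbertIdeal G) {s : MvPolynomial σ k} (hs : constantCoeff s = 0) :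
    reynolds G (s * y) ∈ irrelevantInvariants G * irrelevantInvariants G := by
  induction hy using Submodule.span_induction generalizing s with
  | mem p hp =>
    rw [mul_comm s p, reynolds_mul (mem_irrelevantInvariants.1 hp).1]
    exact Submodule.mul_mem_mul hp (mem_irrelevantInvariants.2
      ⟨reynolds_mem _, by rw [constantCoeff_reynolds hord, hs]⟩)
  | zero => simp
  | add y z _ _ hy hz => rw [mul_add, map_add]; exact add_mem (hy hs) (hz hs)
  | smul a y _ hy =>
    rw [smul_eq_mul, ← mul_assoc]
    exact hy (by simp [hs])

/-- The cotangent space of the invariant algebra at the origin has dimension at most the number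
of variables. -/
lemma card_le_of_independent_mod_sq (hord : (Nat.card G : k) ≠ 0) {T : Set (GL σ k)}
    (hT : Subgroup.closure T = G)
    (hrefl : ∀ g ∈ T, ∃ l : MvPolynomial σ k, l ≠ 0 ∧ l.IsHomogeneous 1 ∧
      ∀ p, l ∣ linSubst (g : Matrix σ σ k) p - p)
    {s : ℕ} (b : Fin s → MvPolynomial σ k) (hb : ∀ i, b i ∈ irrelevantInvariants G)
    (hind : ∀ c : Fin s → k,
      ∑ i, c i • b i ∈ irrelevantInvariants G * irrelevantInvariants G → ∀ i, c i = 0) :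
    s ≤ Fintype.card σ := by
  choose v hv hvb using fun i => exists_vecSubst_eq_sum_mul_X_eq hord (hb i)
  have hli : LinearIndependent (MvPolynomial σ k) v := by
    refine linearIndependent_of_vecSubst_eq hord (fun g i => hv i g) fun r hr h i =>
      eq_zero_of_sum_mul_eq_zero hord hT hrefl v r hr (fun c hc => hind c ?_) h i
    have h1 : ∑ i, c i • b i = ∑ j, X j * ∑ i, C (c i) * v i j := by
      simp only [← hvb, smul_eq_C_mul, Finset.mul_sum]
      rw [Finset.sum_comm]
      exact Finset.sum_congr rfl fun _ _ => Finset.sum_congr rfl fun _ _ => by ring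
    have h2 : ∑ i, c i • b i ∈ polyInvariants G :=
      sum_mem fun i _ => Subalgebra.smul_mem _ (mem_irrelevantInvariants.1 (hb i)).1 _
    rw [← reynolds_of_mem hord h2, h1, map_sum]
    exact sum_mem fun j _ => reynolds_mul_mem_of_mem_hilbertIdeal hord (hc j) (by simp)
  simpa using hli.fintype_card_le_finrank

end Averaging

/-- Homogeneous invariants spanning the cotangent space at the origin generate the invariant
algebra. -/
lemma polyInvariants_le_adjoin {B : Set (MvPolynomial σ k)}
    (hBh : ∀ b ∈ B, ∃ d, b.IsHomogeneous d)
    (hB : ∀ p ∈ irrelevantInvariants G, ∀ d, p.IsHomogeneous d →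
      p ∈ Submodule.span k B ⊔ irrelevantInvariants G * irrelevantInvariants G) :
    polyInvariants G ≤ Algebra.adjoin k B := by
  have key (d : ℕ) : ∀ p ∈ polyInvariants G, p.IsHomogeneous d → p ∈ Algebra.adjoin k B := by
    induction d using Nat.strong_induction_on with
    | _ d ih =>
    intro p hp hpd
    rcases Nat.eq_zero_or_pos d with rfl | hd
    · obtain ⟨c, rfl⟩ : ∃ c, p = C c :=
        ⟨_, totalDegree_eq_zero_iff_eq_C.1 (Nat.le_zero.1 hpd.totalDegree_le)⟩
      exact Subalgebra.algebraMap_mem _ c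
    have hp0 : constantCoeff p = 0 := by
      rw [constantCoeff_eq]
      exact hpd.coeff_eq_zero (by simpa using hd.ne)
    obtain ⟨b, hb, q, hq, hbq⟩ := Submodule.mem_sup.1
      (hB p (mem_irrelevantInvariants.2 ⟨hp, hp0⟩) d hpd)
    have hpc : homogeneousComponent d p = p := by
      rw [homogeneousComponent_of_mem hpd, if_pos rfl]
    rw [← hpc, ← hbq, map_add]
    clear hbq
    refine add_mem ?_ ?_
    · induction hb using Submodule.span_induction with
      | mem x hx =>
        obtain ⟨e, he⟩ := hBh x hx
        rw [homogeneousComponent_of_mem he]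
        split_ifs
        · exact Algebra.subset_adjoin hx
        · exact zero_mem _
      | zero => simp
      | add x y _ _ hx hy => rw [map_add]; exact add_mem hx hy
      | smul a x _ hx => rw [map_smul]; exact Subalgebra.smul_mem _ hx a
    · induction hq using Submodule.mul_induction_on' with
      | mem_mul_mem x hx y hy =>
        obtain ⟨hx, hx0⟩ := mem_irrelevantInvariants.1 hx
        obtain ⟨hy, hy0⟩ := mem_irrelevantInvariants.1 hy
        rw [← sum_homogeneousComponent x, ← sum_homogeneousComponent y, Finset.sum_mul_sum]
        simp only [map_sum]
        refine sum_mem fun i _ => sum_mem fun j _ => ?_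
        have hi := homogeneousComponent_isHomogeneous i x
        have hj := homogeneousComponent_isHomogeneous j y
        rw [homogeneousComponent_of_mem (hi.mul hj)]
        split_ifs with hij
        · rcases Nat.eq_zero_or_pos i with rfl | hi0
          · simp [homogeneousComponent_zero, ← constantCoeff_eq, hx0]
          rcases Nat.eq_zero_or_pos j with rfl | hj0
          · simp [homogeneousComponent_zero, ← constantCoeff_eq, hy0]
          exact mul_mem
            (ih i (by omega) _ (homogeneousComponent_mem_polyInvariants hx i) hi)
            (ih j (by omega) _ (homogeneousComponent_mem_polyInvariants hy j) hj)
        · exact zero_mem _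
      | add x _ y _ hx hy => rw [map_add]; exact add_mem hx hy
  intro p hp
  rw [← sum_homogeneousComponent p]
  exact sum_mem fun i _ => key i _ (homogeneousComponent_mem_polyInvariants hp i)
    (homogeneousComponent_isHomogeneous i p)

/-- **Chevalley–Shephard–Todd**: in the nonmodular case, the invariant algebra of a group generated
by elements moving polynomials by multiples of linear forms is generated by as many elements as
there are variables. -/
theorem exists_adjoin_range_eq_polyInvariants [Finite G] (hord : (Nat.card G : k) ≠ 0)
    {T : Set (GL σ k)} (hT : Subgroup.closure T = G)
    (hrefl : ∀ g ∈ T, ∃ l : MvPolynomial σ k, l ≠ 0 ∧ l.IsHomogeneous 1 ∧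
      ∀ p, l ∣ linSubst (g : Matrix σ σ k) p - p) :
    ∃ f : σ → MvPolynomial σ k, Algebra.adjoin k (Set.range f) = polyInvariants G := by
  have := Fintype.ofFinite G
  set P := irrelevantInvariants G
  obtain ⟨B, hBH, -, hspan, hind⟩ := exists_linearIndepOn_extension (K := k) (v := (P * P).mkQ)
    (s := ∅) (t := {p | p ∈ P ∧ ∃ d, p.IsHomogeneous d}) (linearIndepOn_empty _ _)
    (Set.empty_subset _)
  have hcard : B.encard ≤ Fintype.card σ := by
    by_contra! hlt
    obtain ⟨t, htB, ht⟩ := Set.exists_subset_encard_eq (Order.add_one_le_of_lt hlt)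
    have htfin : t.Finite :=
      Set.finite_of_encard_eq_coe (k := Fintype.card σ + 1) (by simpa using ht)
    have htcard : Nat.card t = Fintype.card σ + 1 := by
      rw [Nat.card_coe_set_eq, Set.ncard, ht]
      rfl
    have := htfin.to_subtype
    let e := (Finite.equivFinOfCardEq htcard).symm
    have hli := (hind.mono htB).linearIndependent.comp e e.injective
    have := card_le_of_independent_mod_sq hord hT hrefl (fun i => (e i : MvPolynomial σ k))
      (fun i => (hBH (htB (e i).2)).1) fun c hc =>
        Fintype.linearIndependent_iff.1 hli c (by
          have hc' := (Submodule.Quotient.mk_eq_zero (P * P)).2 hc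
          rw [← Submodule.mkQ_apply, map_sum] at hc'
          simpa only [map_smul, Function.comp_apply] using hc')
    omega
  have hBfin : B.Finite := Set.finite_of_encard_le_coe hcard
  have := hBfin.fintype
  obtain ⟨e⟩ : Nonempty (B ↪ σ) := Function.Embedding.nonempty_of_card_le (by
    rw [← Nat.card_eq_fintype_card, Nat.card_coe_set_eq]
    exact (ENat.toNat_le_toNat hcard (by simp)).trans (by simp))
  refine ⟨Function.extend e Subtype.val 0, le_antisymm (Algebra.adjoin_le ?_) ?_⟩
  · rintro _ ⟨i, rfl⟩
    by_cases hi : ∃ b, e b = i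
    · obtain ⟨b, rfl⟩ := hi
      rw [e.injective.extend_apply]
      exact (mem_irrelevantInvariants.1 (hBH b.2).1).1
    · rw [Function.extend_apply' _ _ _ hi]
      exact zero_mem _
  · refine (polyInvariants_le_adjoin (B := B) (fun b hb => (hBH hb).2) fun p hp d hpd => ?_).trans
      (Algebra.adjoin_mono fun b hb => ⟨e ⟨b, hb⟩, e.injective.extend_apply _ _ _⟩)
    have hmem := hspan ⟨p, ⟨hp, d, hpd⟩, rfl⟩
    rw [SetLike.mem_coe, ← Submodule.map_span, ← Submodule.mem_comap, Submodule.comap_map_mkQ]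
      at hmem
    rwa [sup_comm]

end Invariants

section FixedField

variable {σ k K : Type*} [Fintype σ] [DecidableEq σ] [Field k] [Field K] [Algebra k K]
  [Algebra (MvPolynomial σ k) K] [IsScalarTower k (MvPolynomial σ k) K] {G : Subgroup (GL σ k)}

lemma apply_algebraMap_eq_algebraMap_linSubst {φ : G →* (K ≃ₐ[k] K)}
    (hφ : ∀ (g : G) (j : σ), φ g (algebraMap (MvPolynomial σ k) K (X j)) =
      algebraMap (MvPolynomial σ k) K (∑ i, C ((g.1 : Matrix σ σ k) i j) * X i))
    (g : G) (p : MvPolynomial σ k) :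
    φ g (algebraMap (MvPolynomial σ k) K p) =
      algebraMap (MvPolynomial σ k) K (linSubst (g.1 : Matrix σ σ k) p) := by
  have h : (φ g : K →ₐ[k] K).comp (IsScalarTower.toAlgHom k (MvPolynomial σ k) K) =
      (IsScalarTower.toAlgHom k (MvPolynomial σ k) K).comp (linSubst (g.1 : Matrix σ σ k)) := by
    ext j
    simpa using hφ g j
  exact DFunLike.congr_fun h p

variable [IsFractionRing (MvPolynomial σ k) K]

/-- The fixed field of a finite linear group is the fraction field of its invariant algebra. -/
lemma exists_eq_div_of_mem_fixedField [Finite G] {φ : G →* (K ≃ₐ[k] K)}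
    (hφ : ∀ (g : G) (j : σ), φ g (algebraMap (MvPolynomial σ k) K (X j)) =
      algebraMap (MvPolynomial σ k) K (∑ i, C ((g.1 : Matrix σ σ k) i j) * X i))
    {z : K} (hz : z ∈ IntermediateField.fixedField φ.range) :
    ∃ p ∈ polyInvariants G, ∃ q ∈ polyInvariants G,
      z = algebraMap (MvPolynomial σ k) K p / algebraMap (MvPolynomial σ k) K q := by
  classical
  have := Fintype.ofFinite G
  have hφ' := apply_algebraMap_eq_algebraMap_linSubst hφ
  have hinj := IsFractionRing.injective (MvPolynomial σ k) K
  obtain ⟨a, b, hb, rfl⟩ := IsFractionRing.div_surjective (A := MvPolynomial σ k) z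
  have hb0 : b ≠ 0 := nonZeroDivisors.ne_zero hb
  set N := ∏ g : G, linSubst (g.1 : Matrix σ σ k) b with hN
  set N' := ∏ g ∈ Finset.univ.erase (1 : G), linSubst (g.1 : Matrix σ σ k) b with hN'
  have hNN' : N = N' * b := by
    rw [hN, ← Finset.prod_erase_mul _ _ (Finset.mem_univ (1 : G))]
    simp [linSubst_one, hN']
  have hNinv : N ∈ polyInvariants G := fun g => by
    rw [hN, map_prod]
    exact Fintype.prod_equiv (Equiv.mulLeft g) _ _ fun h => (linSubst_coe_mul g h b).symm
  have hg0 (g : G) : linSubst (g.1 : Matrix σ σ k) b ≠ 0 := fun h => by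
    have := hφ' g b
    rw [h, map_zero, map_eq_zero, map_eq_zero_iff _ hinj] at this
    exact hb0 this
  have hN'0 : N' ≠ 0 := Finset.prod_ne_zero_iff.2 fun g _ => hg0 g
  have hbK : algebraMap (MvPolynomial σ k) K b ≠ 0 := (map_ne_zero_iff _ hinj).2 hb0
  have hN'K : algebraMap (MvPolynomial σ k) K N' ≠ 0 := (map_ne_zero_iff _ hinj).2 hN'0
  have hdiv : algebraMap (MvPolynomial σ k) K a / algebraMap (MvPolynomial σ k) K b =
      algebraMap (MvPolynomial σ k) K (N' * a) / algebraMap (MvPolynomial σ k) K N := by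
    rw [hNN', map_mul, map_mul, mul_div_mul_left _ _ hN'K]
  refine ⟨N' * a, fun g => hinj ?_, N, hNinv, hdiv⟩
  have hNK : algebraMap (MvPolynomial σ k) K N ≠ 0 := by
    rw [hNN', map_mul]
    exact mul_ne_zero hN'K hbK
  have hfix := (IntermediateField.mem_fixedField_iff _ _).1 hz (φ g) ⟨g, rfl⟩
  rwa [hdiv, map_div₀, hφ', hφ', hNinv g, div_left_inj' hNK] at hfix

/-- If the invariant algebra of a finite linear group is generated by as many elements as there
are variables, then its field of invariants is purely transcendental. -/
lemma nonempty_fixedField_algEquiv_fractionRing [Finite G] {φ : G →* (K ≃ₐ[k] K)}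
    (hφ : ∀ (g : G) (j : σ), φ g (algebraMap (MvPolynomial σ k) K (X j)) =
      algebraMap (MvPolynomial σ k) K (∑ i, C ((g.1 : Matrix σ σ k) i j) * X i))
    {f : σ → MvPolynomial σ k} (hf : Algebra.adjoin k (Set.range f) = polyInvariants G) :
    Nonempty (IntermediateField.fixedField φ.range ≃ₐ[k] FractionRing (MvPolynomial σ k)) := by
  set F := IntermediateField.fixedField φ.range with hF
  let ι := IsScalarTower.toAlgHom k (MvPolynomial σ k) K
  have hadj : IntermediateField.adjoin k (Set.range (ι ∘ f)) = F := by
    refine le_antisymm (IntermediateField.adjoin_le_iff.2 ?_) fun z hz => ?_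
    · rintro _ ⟨i, rfl⟩
      rw [SetLike.mem_coe, hF, IntermediateField.mem_fixedField_iff]
      rintro _ ⟨g, rfl⟩
      have hfi : f i ∈ polyInvariants G := hf ▸ Algebra.subset_adjoin ⟨i, rfl⟩
      exact (apply_algebraMap_eq_algebraMap_linSubst hφ g (f i)).trans (congrArg _ (hfi g))
    · have hmem (p) (hp : p ∈ polyInvariants G) :
          algebraMap (MvPolynomial σ k) K p ∈ IntermediateField.adjoin k (Set.range (ι ∘ f)) := by
        rw [← hf] at hp
        have : ι p ∈ (Algebra.adjoin k (Set.range f)).map ι := ⟨p, hp, rfl⟩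
        rw [AlgHom.map_adjoin, ← Set.range_comp] at this
        exact IntermediateField.algebra_adjoin_le_adjoin _ _ this
      obtain ⟨p, hp, q, hq, rfl⟩ := exists_eq_div_of_mem_fixedField hφ hz
      exact div_mem (hmem p hp) (hmem q hq)
  have : Finite φ.range := Finite.of_surjective _ φ.rangeRestrict_surjective
  have halgF : Algebra.IsAlgebraic (IntermediateField.fixedField φ.range) K :=
    inferInstanceAs (Algebra.IsAlgebraic (FixedPoints.subfield φ.range K) K)
  have : Algebra.IsAlgebraic (MvPolynomial σ k) K :=
    IsLocalization.isAlgebraic _ (nonZeroDivisors (MvPolynomial σ k))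
  have : FaithfulSMul (MvPolynomial σ k) K :=
    (faithfulSMul_iff_algebraMap_injective _ _).2 (IsFractionRing.injective _ _)
  have hX := (IsTranscendenceBasis.mvPolynomial σ k).algebraMap_comp (A := K)
  have halg : Algebra.IsAlgebraic (Algebra.adjoin k (Set.range (ι ∘ f))) K := by
    rw [← IntermediateField.isAlgebraic_adjoin_iff_top, hadj]
    exact halgF
  have hind : AlgebraicIndependent k (ι ∘ f) :=
    (Algebra.IsAlgebraic.isTranscendenceBasis_of_lift_le_trdeg_of_finite k (ι ∘ f)
      hX.lift_cardinalMk_eq_trdeg.le).1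
  exact ⟨(IntermediateField.equivOfEq hadj).symm.trans hind.aevalEquivField.symm⟩

end FixedField

/-- **Noether's problem for pseudo-reflection groups (via Chevalley–Shephard–Todd).**
Let `k` be a field and `V = k^n` an `n`-dimensional `k`-vector space, and let `G` be a finite
subgroup of `GL(V) = GL_n(k)` whose order is invertible in `k`.  A pseudo-reflection is an
element `g ≠ 1` whose fixed subspace `ker (g - 1)` has codimension `1` in `V`.  The algebra of
polynomial functions on `V` (the symmetric algebra `S(V*)`) is the polynomial ring
`k[x_1, …, x_n]`, on which `G` acts by `k`-algebra automorphisms by linear substitutions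
`g • x_j = ∑ i, g i j • x_i`; this action extends to the fraction field `K` of `S(V*)`, a
rational function field in `n` variables, and is encoded by the homomorphism `φ`.  If `G` is
generated by pseudo-reflections, then the fixed field `K^G` is purely transcendental over `k`
of transcendence degree `n`. -/
theorem pseudoReflectionGroup_fixedField_is_rational
    (k : Type*) [Field k] (n : ℕ)
    (G : Subgroup (GL (Fin n) k)) [Finite G]
    (hord : (Nat.card G : k) ≠ 0)
    (hgen : Subgroup.closure
      {g : GL (Fin n) k | g ∈ G ∧ g ≠ 1 ∧
        Module.finrank k
          ↥(LinearMap.ker (Matrix.mulVecLin ((g : Matrix (Fin n) (Fin n) k) - 1))) + 1 = n}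
      = G)
    (K : Type*) [Field K] [Algebra k K]
    [Algebra (MvPolynomial (Fin n) k) K] [IsScalarTower k (MvPolynomial (Fin n) k) K]
    [IsFractionRing (MvPolynomial (Fin n) k) K]
    (φ : ↥G →* (K ≃ₐ[k] K))
    (hφ : ∀ (g : ↥G) (j : Fin n),
      φ g (algebraMap (MvPolynomial (Fin n) k) K (X j)) =
        algebraMap (MvPolynomial (Fin n) k) K
          (∑ i, C (((g : GL (Fin n) k) : Matrix (Fin n) (Fin n) k) i j) * X i)) :
    Nonempty (↥(IntermediateField.fixedField φ.range) ≃ₐ[k]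
      FractionRing (MvPolynomial (Fin n) k)) := by
  obtain ⟨f, hf⟩ := exists_adjoin_range_eq_polyInvariants hord hgen fun g hg =>
    exists_linearForm_dvd_linSubst_sub (by simpa using hg.2.2)
  exact nonempty_fixedField_algEquiv_fractionRing hφ hf
end

section
/- (Chevalley–Shephard–Todd) Let k be a field, V a finite-dimensional k-vector space, and G a finite subgroup of GL(V) whose order is invertible in k (char k does not divide |G|). Then the invariant ring S(V*)^G is isomorphic as a k-algebra to a polynomial ring (in dim V variables) if and only if G is generated by pseudo-reflections. -/
open MvPolynomial Matrix

/-- The subalgebra of invariants of a group acting by `k`-algebra automorphisms, the action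
being encoded by a homomorphism `ψ` into the group of `k`-algebra automorphisms. -/
def invariantSubalgebra {k A : Type*} [CommSemiring k] [Semiring A] [Algebra k A]
    {G : Type*} [Group G] (ψ : G →* (A ≃ₐ[k] A)) : Subalgebra k A where
  carrier := {a | ∀ g : G, ψ g a = a}
  add_mem' := fun {a b} ha hb g => by rw [map_add, ha g, hb g]
  mul_mem' := fun {a b} ha hb g => by rw [_root_.map_mul, ha g, hb g]
  algebraMap_mem' := fun c g => (ψ g).commutes c

noncomputable section

namespace PolynomialInvariants

/-! ### Linear substitutions -/

section LinearSubstitution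

variable {k : Type*} [Field k] {n : ℕ}

/-- The algebra endomorphism of `k[x_1, …, x_n]` given by `x_j ↦ ∑ i, M i j • x_i`. -/
def linSubst (M : Matrix (Fin n) (Fin n) k) :
    MvPolynomial (Fin n) k →ₐ[k] MvPolynomial (Fin n) k :=
  aeval fun j => ∑ i, C (M i j) * X i

theorem linSubst_X (M : Matrix (Fin n) (Fin n) k) (j : Fin n) :
    linSubst M (X j) = ∑ i, C (M i j) * X i := by
  simp [linSubst]

theorem linSubst_one : linSubst (1 : Matrix (Fin n) (Fin n) k) = AlgHom.id k _ := by
  ext1 j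
  simp [linSubst_X, Matrix.one_apply, apply_ite C, ite_mul]

theorem linSubst_mul (M N : Matrix (Fin n) (Fin n) k) :
    linSubst (M * N) = (linSubst M).comp (linSubst N) := by
  ext1 j
  simp only [linSubst_X, AlgHom.comp_apply, map_sum, _root_.map_mul, Matrix.mul_apply,
    Finset.sum_mul, Finset.mul_sum, algHom_C, algebraMap_eq]
  rw [Finset.sum_comm]
  exact Finset.sum_congr rfl fun i _ => Finset.sum_congr rfl fun l _ => by ring

theorem isHomogeneous_linSubst (M : Matrix (Fin n) (Fin n) k) {p : MvPolynomial (Fin n) k}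
    {d : ℕ} (hp : p.IsHomogeneous d) : (linSubst M p).IsHomogeneous d := by
  have := hp.aeval (fun j => ∑ i, C (M i j) * X i)
    (fun j => IsHomogeneous.sum _ _ 1 fun i _ => isHomogeneous_C_mul_X (M i j) i)
  rwa [one_mul] at this

theorem homogeneousComponent_linSubst (M : Matrix (Fin n) (Fin n) k)
    (p : MvPolynomial (Fin n) k) (d : ℕ) :
    homogeneousComponent d (linSubst M p) = linSubst M (homogeneousComponent d p) := by
  conv_lhs => rw [← sum_homogeneousComponent p, map_sum, map_sum]
  have h : ∀ i, homogeneousComponent d (linSubst M (homogeneousComponent i p)) =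
      if d = i then linSubst M (homogeneousComponent i p) else 0 := fun i =>
    homogeneousComponent_of_mem (isHomogeneous_linSubst M (homogeneousComponent_isHomogeneous i p))
  simp only [h, Finset.sum_ite_eq]
  split_ifs with hd
  · rfl
  · rw [homogeneousComponent_eq_zero, map_zero]
    simpa using hd

/-- The action of `GL_n(k)` on the polynomial ring by linear substitutions. -/
instance instGLAction : MulSemiringAction (GL (Fin n) k) (MvPolynomial (Fin n) k) where
  smul g p := linSubst (g : Matrix (Fin n) (Fin n) k) p
  one_smul p := by
    change linSubst ((1 : GL (Fin n) k) : Matrix (Fin n) (Fin n) k) p = p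
    rw [Units.val_one, linSubst_one, AlgHom.id_apply]
  mul_smul g h p := by
    change linSubst ((g * h : GL (Fin n) k) : Matrix (Fin n) (Fin n) k) p =
      linSubst (g : Matrix (Fin n) (Fin n) k) (linSubst (h : Matrix (Fin n) (Fin n) k) p)
    rw [Units.val_mul, linSubst_mul, AlgHom.comp_apply]
  smul_zero g := map_zero (linSubst _)
  smul_add g := map_add (linSubst _)
  smul_one g := map_one (linSubst _)
  smul_mul g := _root_.map_mul (linSubst _)

theorem gl_smul_def (g : GL (Fin n) k) (p : MvPolynomial (Fin n) k) :
    g • p = linSubst (g : Matrix (Fin n) (Fin n) k) p := rfl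

theorem gl_smul_C (g : GL (Fin n) k) (c : k) : g • (C c : MvPolynomial (Fin n) k) = C c :=
  (linSubst _).commutes c

theorem gl_smul_C_mul (g : GL (Fin n) k) (c : k) (p : MvPolynomial (Fin n) k) :
    g • (C c * p) = C c * g • p := by
  rw [smul_mul', gl_smul_C]

theorem isHomogeneous_gl_smul (g : GL (Fin n) k) {p : MvPolynomial (Fin n) k} {d : ℕ}
    (hp : p.IsHomogeneous d) : (g • p).IsHomogeneous d :=
  isHomogeneous_linSubst _ hp

/-- The algebra of polynomials invariant under a subgroup of `GL_n(k)`. -/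
def invariants (G : Subgroup (GL (Fin n) k)) : Subalgebra k (MvPolynomial (Fin n) k) where
  carrier := {p | ∀ g ∈ G, g • p = p}
  add_mem' := fun ha hb g hg => by rw [smul_add, ha g hg, hb g hg]
  mul_mem' := fun ha hb g hg => by rw [smul_mul', ha g hg, hb g hg]
  algebraMap_mem' := fun c g _ => gl_smul_C g c

variable {G : Subgroup (GL (Fin n) k)}

theorem homogeneousComponent_mem_invariants {p : MvPolynomial (Fin n) k}
    (hp : p ∈ invariants G) (d : ℕ) : homogeneousComponent d p ∈ invariants G := fun g hg => by
  rw [gl_smul_def, ← homogeneousComponent_linSubst, ← gl_smul_def, hp g hg]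

/-- The Reynolds operator, averaging over the group. -/
def reynolds (G : Subgroup (GL (Fin n) k)) [Finite G] (p : MvPolynomial (Fin n) k) :
    MvPolynomial (Fin n) k :=
  C (Nat.card G : k)⁻¹ * ∑ᶠ g : G, (g : GL (Fin n) k) • p

variable [Finite G]

theorem reynolds_mem (p : MvPolynomial (Fin n) k) : reynolds G p ∈ invariants G := by
  intro g hg
  cases nonempty_fintype G
  rw [reynolds, gl_smul_C_mul, finsum_eq_sum_of_fintype, Finset.smul_sum]
  refine congrArg (C (Nat.card G : k)⁻¹ * ·) ?_
  exact Fintype.sum_equiv (Equiv.mulLeft (⟨g, hg⟩ : G)) _ _ fun h =>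
    (mul_smul g (h : GL (Fin n) k) p).symm

theorem sum_sub_reynolds (hG : (Nat.card G : k) ≠ 0) (p : MvPolynomial (Fin n) k) :
    reynolds G p - p = C (Nat.card G : k)⁻¹ * ∑ᶠ g : G, ((g : GL (Fin n) k) • p - p) := by
  cases nonempty_fintype G
  have h : C (Nat.card G : k)⁻¹ * ((Nat.card G : MvPolynomial (Fin n) k) * p) = p := by
    rw [← map_natCast (C : k →+* MvPolynomial (Fin n) k), ← mul_assoc, ← C_mul,
      inv_mul_cancel₀ hG, C_1, one_mul]
  rw [reynolds, finsum_eq_sum_of_fintype, finsum_eq_sum_of_fintype, Finset.sum_sub_distrib,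
    Finset.sum_const, nsmul_eq_mul, Finset.card_univ, ← Nat.card_eq_fintype_card, mul_sub, h]

theorem reynolds_mul (p : MvPolynomial (Fin n) k) {q : MvPolynomial (Fin n) k}
    (hq : q ∈ invariants G) : reynolds G (p * q) = reynolds G p * q := by
  cases nonempty_fintype G
  simp only [reynolds, finsum_eq_sum_of_fintype, smul_mul', hq _ (Subtype.coe_prop _),
    ← Finset.sum_mul, mul_assoc]

theorem reynolds_eq_self (hG : (Nat.card G : k) ≠ 0) {p : MvPolynomial (Fin n) k}
    (hp : p ∈ invariants G) : reynolds G p = p := by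
  have h := sum_sub_reynolds hG p
  simp only [hp _ (Subtype.coe_prop _), sub_self, finsum_zero, mul_zero] at h
  exact sub_eq_zero.mp h

theorem reynolds_sum {ι : Type*} (s : Finset ι) (p : ι → MvPolynomial (Fin n) k) :
    reynolds G (∑ i ∈ s, p i) = ∑ i ∈ s, reynolds G (p i) := by
  cases nonempty_fintype G
  simp only [reynolds, finsum_eq_sum_of_fintype, Finset.smul_sum, ← Finset.mul_sum]
  rw [Finset.sum_comm]

end LinearSubstitution

/-! ### Pseudo-reflections -/

section Reflections

variable {k : Type*} [Field k] {n : ℕ}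

/-- The linear form with prescribed coefficients. -/
def linForm (v : Fin n → k) : MvPolynomial (Fin n) k := ∑ i, C (v i) * X i

theorem coeff_linForm (v : Fin n → k) (i : Fin n) :
    coeff (Finsupp.single i 1) (linForm v) = v i := by
  classical
  simp [linForm, coeff_sum, coeff_C_mul, coeff_X, Finsupp.single_left_inj]

theorem isHomogeneous_linForm (v : Fin n → k) : (linForm v).IsHomogeneous 1 :=
  IsHomogeneous.sum _ _ 1 fun i _ => isHomogeneous_C_mul_X (v i) i

theorem linForm_injective : Function.Injective (linForm : (Fin n → k) → _) := fun v w h => by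
  ext i
  rw [← coeff_linForm v, h, coeff_linForm]

theorem linForm_smul (c : k) (v : Fin n → k) : linForm (c • v) = C c * linForm v := by
  simp [linForm, Finset.mul_sum, mul_assoc]

theorem gl_smul_X_sub_X (g : GL (Fin n) k) (j : Fin n) :
    g • (X j : MvPolynomial (Fin n) k) - X j =
      linForm (((g : Matrix (Fin n) (Fin n) k) - 1).col j) := by
  have h : (X j : MvPolynomial (Fin n) k) = linForm ((1 : Matrix (Fin n) (Fin n) k).col j) := by
    simp [linForm, Matrix.one_apply, apply_ite C, ite_mul]
  nth_rw 2 [h]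
  rw [gl_smul_def, linSubst_X]
  simp [linForm, sub_mul, Finset.sum_sub_distrib]

/-- The condition that the fixed space of `g` has codimension one. -/
def HasFixedHyperplane (g : GL (Fin n) k) : Prop :=
  Module.finrank k
    ↥(LinearMap.ker (Matrix.mulVecLin ((g : Matrix (Fin n) (Fin n) k) - 1))) + 1 = n

theorem hasFixedHyperplane_iff (g : GL (Fin n) k) :
    HasFixedHyperplane g ↔ Module.finrank k
      ↥(LinearMap.range (Matrix.mulVecLin ((g : Matrix (Fin n) (Fin n) k) - 1))) = 1 := by
  have h := LinearMap.finrank_range_add_finrank_ker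
    (Matrix.mulVecLin ((g : Matrix (Fin n) (Fin n) k) - 1))
  rw [Module.finrank_fin_fun] at h
  unfold HasFixedHyperplane
  lia

theorem col_eq_mulVecLin_single (M : Matrix (Fin n) (Fin n) k) (j : Fin n) :
    M.col j = M.mulVecLin (Pi.single j 1) := by
  ext i
  simp

theorem dvd_gl_smul_sub {g : GL (Fin n) k} {l : MvPolynomial (Fin n) k}
    (h : ∀ j, l ∣ g • (X j : MvPolynomial (Fin n) k) - X j) (p : MvPolynomial (Fin n) k) :
    l ∣ g • p - p := by
  induction p using MvPolynomial.induction_on with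
  | C c => simp [gl_smul_C]
  | add p q hp hq =>
    rw [smul_add, add_sub_add_comm]
    exact dvd_add hp hq
  | mul_X p j hp =>
    have : g • (p * X j) - p * X j =
        (g • p - p) * g • X j + p * (g • (X j : MvPolynomial (Fin n) k) - X j) := by
      rw [smul_mul']
      ring
    rw [this]
    exact dvd_add (hp.mul_right _) ((h j).mul_left _)

theorem HasFixedHyperplane.exists_linForm_dvd {g : GL (Fin n) k} (hg : HasFixedHyperplane g) :
    ∃ l : MvPolynomial (Fin n) k, l ≠ 0 ∧ l.IsHomogeneous 1 ∧
      ∀ p : MvPolynomial (Fin n) k, l ∣ g • p - p := by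
  rw [hasFixedHyperplane_iff, finrank_eq_one_iff'] at hg
  obtain ⟨v, hv, hspan⟩ := hg
  refine ⟨linForm (v : Fin n → k), fun h => hv ?_, isHomogeneous_linForm _,
    dvd_gl_smul_sub fun j => ?_⟩
  · exact Subtype.ext (linForm_injective (h.trans (by simp [linForm])))
  · obtain ⟨c, hc⟩ := hspan ⟨_, LinearMap.mem_range_self _ (Pi.single j 1)⟩
    have hc' : c • (v : Fin n → k) =
        ((g : Matrix (Fin n) (Fin n) k) - 1).mulVecLin (Pi.single j 1) := congrArg Subtype.val hc
    rw [gl_smul_X_sub_X, col_eq_mulVecLin_single, ← hc', linForm_smul]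
    exact dvd_mul_left _ _

theorem eq_C_mul_of_dvd_of_totalDegree_le {q a b : MvPolynomial (Fin n) k}
    (hq : q.totalDegree ≠ 0) (ha0 : a ≠ 0) (ha : a.IsHomogeneous 1) (hb : b.IsHomogeneous 1)
    (hqa : q ∣ a) (hqb : q ∣ b) : ∃ c : k, b = C c * a := by
  have key : ∀ p : MvPolynomial (Fin n) k, p.IsHomogeneous 1 → q ∣ p →
      ∃ c : k, p = C c * q := by
    rintro p hp ⟨u, rfl⟩
    by_cases hu : q * u = 0
    · exact ⟨0, by simp [hu]⟩
    have hd := hp.totalDegree hu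
    rw [totalDegree_mul_of_isDomain (left_ne_zero_of_mul hu) (right_ne_zero_of_mul hu)] at hd
    have hu0 : u.totalDegree = 0 := by lia
    refine ⟨coeff 0 u, ?_⟩
    rw [mul_comm]
    congr 1
    exact totalDegree_eq_zero_iff_eq_C.mp hu0
  obtain ⟨c, rfl⟩ := key a ha hqa
  obtain ⟨d, rfl⟩ := key b hb hqb
  have hc : c ≠ 0 := by
    rintro rfl
    simp at ha0
  refine ⟨d * c⁻¹, ?_⟩
  rw [← mul_assoc, ← C_mul, mul_assoc, inv_mul_cancel₀ hc, mul_one]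

/-- If a nontrivial linear substitution is trivial modulo a nonconstant polynomial, then it is
a pseudo-reflection. -/
theorem hasFixedHyperplane_of_dvd {g : GL (Fin n) k} (hg : g ≠ 1)
    {q : MvPolynomial (Fin n) k} (hq : q.totalDegree ≠ 0)
    (h : ∀ p : MvPolynomial (Fin n) k, q ∣ g • p - p) : HasFixedHyperplane g := by
  set M := (g : Matrix (Fin n) (Fin n) k) - 1 with hM
  have hM0 : M ≠ 0 := fun h0 => hg (Units.ext (sub_eq_zero.mp h0))
  obtain ⟨j₀, hj₀⟩ : ∃ j, M.col j ≠ 0 := by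
    by_contra! hcon
    exact hM0 (Matrix.ext fun i j => congrFun (hcon j) i)
  have hdvd : ∀ j, q ∣ linForm (M.col j) := fun j => by
    rw [← gl_smul_X_sub_X]
    exact h _
  have hj₀' : linForm (M.col j₀) ≠ 0 := fun h0 =>
    hj₀ (linForm_injective (h0.trans (by simp [linForm])))
  have hcol : ∀ j, ∃ c : k, M.col j = c • M.col j₀ := fun j => by
    obtain ⟨c, hc⟩ := eq_C_mul_of_dvd_of_totalDegree_le hq hj₀' (isHomogeneous_linForm _)
      (isHomogeneous_linForm _) (hdvd j₀) (hdvd j)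
    exact ⟨c, linForm_injective (by rw [hc, linForm_smul])⟩
  choose c hc using hcol
  rw [hasFixedHyperplane_iff, finrank_eq_one_iff']
  refine ⟨⟨M.col j₀, Pi.single j₀ 1, (col_eq_mulVecLin_single M j₀).symm⟩,
    fun h0 => hj₀ (congrArg Subtype.val h0), ?_⟩
  rintro ⟨_, w, rfl⟩
  refine ⟨∑ j, w j * c j, Subtype.ext ?_⟩
  ext i
  simp only [SetLike.val_smul, Pi.smul_apply, smul_eq_mul, Matrix.mulVecLin_apply, Matrix.mulVec,
    dotProduct, Finset.sum_mul]
  refine Finset.sum_congr rfl fun j _ => ?_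
  have := congrFun (hc j) i
  simp only [Matrix.col_apply, Pi.smul_apply, smul_eq_mul] at this
  rw [← hM, this, Matrix.col_apply]
  ring

end Reflections

/-! ### Chevalley's syzygy lemma -/

section Syzygy

variable {k : Type*} [Field k] {n : ℕ}

theorem homogeneousComponent_mul_of_isHomogeneous {a : MvPolynomial (Fin n) k} {d : ℕ}
    (ha : a.IsHomogeneous d) (p : MvPolynomial (Fin n) k) (e : ℕ) :
    homogeneousComponent e (p * a) =
      if d ≤ e then homogeneousComponent (e - d) p * a else 0 := by
  conv_lhs => rw [← sum_homogeneousComponent p, Finset.sum_mul, map_sum]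
  have h : ∀ i, homogeneousComponent e (homogeneousComponent i p * a) =
      if e = i + d then homogeneousComponent i p * a else 0 := fun i =>
    homogeneousComponent_of_mem ((homogeneousComponent_isHomogeneous i p).mul ha)
  simp only [h]
  split_ifs with hd
  · have : ∀ i, e = i + d ↔ i = e - d := fun i => by lia
    simp only [this, Finset.sum_ite_eq']
    split_ifs with hmem
    · rfl
    · rw [homogeneousComponent_eq_zero, zero_mul]
      have h' : p.totalDegree + d < e := by simpa using hmem
      lia
  · refine Finset.sum_eq_zero fun i _ => if_neg ?_
    lia

theorem homogeneousComponent_mem_span {B : Set (MvPolynomial (Fin n) k)}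
    (hB : ∀ b ∈ B, ∃ d, b.IsHomogeneous d) {p : MvPolynomial (Fin n) k}
    (hp : p ∈ Ideal.span B) (d : ℕ) : homogeneousComponent d p ∈ Ideal.span B := by
  induction hp using Submodule.span_induction generalizing d with
  | mem x hx =>
    obtain ⟨e, he⟩ := hB x hx
    rw [homogeneousComponent_of_mem he]
    split_ifs
    · exact Ideal.subset_span hx
    · exact Ideal.zero_mem _
  | zero => simp
  | add x y _ _ hx hy =>
    rw [map_add]
    exact Ideal.add_mem _ (hx d) (hy d)
  | smul r x _ hx =>
    rw [smul_eq_mul, ← sum_homogeneousComponent x, Finset.mul_sum, map_sum]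
    refine Ideal.sum_mem _ fun i _ => ?_
    rw [homogeneousComponent_mul_of_isHomogeneous (homogeneousComponent_isHomogeneous i x)]
    split_ifs
    · exact Ideal.mul_mem_left _ _ (hx i)
    · exact Ideal.zero_mem _

/-- The Hilbert ideal: the ideal generated by the invariants without constant term. -/
def hilbertIdeal (G : Subgroup (GL (Fin n) k)) : Ideal (MvPolynomial (Fin n) k) :=
  Ideal.span {p | p ∈ invariants G ∧ constantCoeff p = 0}

variable {G : Subgroup (GL (Fin n) k)}

theorem constantCoeff_of_mem_hilbertIdeal {p : MvPolynomial (Fin n) k}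
    (hp : p ∈ hilbertIdeal G) : constantCoeff p = 0 := by
  have : hilbertIdeal G ≤ RingHom.ker (constantCoeff : MvPolynomial (Fin n) k →+* k) :=
    Ideal.span_le.mpr fun q hq => hq.2
  exact this hp

theorem exists_gl_smul_eq_add_mul_of_mem_span {B : Set (MvPolynomial (Fin n) k)}
    {g : GL (Fin n) k} (hB : ∀ b ∈ B, g • b = b) {l : MvPolynomial (Fin n) k}
    (hl : ∀ p : MvPolynomial (Fin n) k, l ∣ g • p - p) {x : MvPolynomial (Fin n) k}
    (hx : x ∈ Ideal.span B) : ∃ y ∈ Ideal.span B, g • x = x + l * y := by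
  induction hx using Submodule.span_induction with
  | mem x hx => exact ⟨0, Ideal.zero_mem _, by rw [hB x hx, mul_zero, add_zero]⟩
  | zero => exact ⟨0, Ideal.zero_mem _, by simp⟩
  | add x x' _ _ hx hx' =>
    obtain ⟨y, hy, h⟩ := hx
    obtain ⟨y', hy', h'⟩ := hx'
    exact ⟨y + y', Ideal.add_mem _ hy hy', by rw [smul_add, h, h']; ring⟩
  | smul r x hx' hx =>
    obtain ⟨y, hy, h⟩ := hx
    obtain ⟨q, hq⟩ := hl r
    refine ⟨q * (x + l * y) + r * y, Ideal.add_mem _ (Ideal.mul_mem_left _ _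
      (Ideal.add_mem _ hx' (Ideal.mul_mem_left _ _ hy))) (Ideal.mul_mem_left _ _ hy), ?_⟩
    rw [smul_eq_mul, smul_mul', h, sub_eq_iff_eq_add.mp hq]
    ring

theorem gl_smul_mem_hilbertIdeal {g : GL (Fin n) k} (hg : g ∈ G) {x : MvPolynomial (Fin n) k}
    (hx : x ∈ hilbertIdeal G) : g • x ∈ hilbertIdeal G := by
  obtain ⟨y, hy, h⟩ := exists_gl_smul_eq_add_mul_of_mem_span (fun b hb => hb.1 g hg)
    (fun p => one_dvd _) hx
  rw [h]
  exact Ideal.add_mem _ hx (Ideal.mul_mem_left _ _ hy)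

/-- For a group generated by pseudo-reflections, a homogeneous invariant `a` which is not in the
ideal generated by a set `B` of homogeneous invariants satisfies `((B) : a) ≤ I`, where `I` is the
Hilbert ideal. -/
theorem mem_hilbertIdeal_of_mul_mem_span [Finite G] (hG : (Nat.card G : k) ≠ 0)
    {T : Set (GL (Fin n) k)} (hT : ∀ g ∈ T, HasFixedHyperplane g)
    (hGT : Subgroup.closure T = G) {B : Set (MvPolynomial (Fin n) k)}
    (hB : ∀ b ∈ B, b ∈ invariants G) (hBh : ∀ b ∈ B, ∃ d, b.IsHomogeneous d)
    {a : MvPolynomial (Fin n) k} (ha : a ∈ invariants G) {d : ℕ} (had : a.IsHomogeneous d)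
    (haB : a ∉ Ideal.span B) {p : MvPolynomial (Fin n) k} (hp : p * a ∈ Ideal.span B) :
    p ∈ hilbertIdeal G := by
  induction hN : p.totalDegree using Nat.strong_induction_on generalizing p with
  | _ N ih =>
  subst hN
  have hgen : ∀ g ∈ T, g • p - p ∈ hilbertIdeal G := by
    intro g hg
    have hgG : g ∈ G := hGT ▸ Subgroup.subset_closure hg
    obtain ⟨l, hl0, hl1, hl⟩ := (hT g hg).exists_linForm_dvd
    obtain ⟨q, hq⟩ := hl p
    by_cases hq0 : q = 0
    · rw [hq, hq0, mul_zero]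
      exact Ideal.zero_mem _
    rw [hq]
    refine Ideal.mul_mem_left _ _ (ih q.totalDegree ?_ ?_ rfl)
    · have h1 : (l * q).totalDegree = 1 + q.totalDegree := by
        rw [totalDegree_mul_of_isDomain hl0 hq0, hl1.totalDegree hl0]
      have h2 : (g • p).totalDegree ≤ p.totalDegree := by
        conv_lhs => rw [← sum_homogeneousComponent p, Finset.smul_sum]
        refine totalDegree_finsetSum_le fun i hi => ?_
        refine
          (isHomogeneous_gl_smul g (homogeneousComponent_isHomogeneous i p)).totalDegree_le.trans ?_
        simpa [Nat.lt_succ_iff] using hi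
      have h3 := totalDegree_sub (g • p) p
      rw [hq, h1, max_eq_right h2] at h3
      lia
    · obtain ⟨y, hy, h⟩ := exists_gl_smul_eq_add_mul_of_mem_span (fun b hb => hB b hb g hgG) hl hp
      have : l * (q * a) = l * y := by
        rw [smul_mul', ha g hgG, sub_eq_iff_eq_add.mp hq] at h
        linear_combination h
      rwa [mul_left_cancel₀ hl0 this]
  have hall : ∀ g ∈ G, g • p - p ∈ hilbertIdeal G := by
    intro g hg
    rw [← hGT] at hg
    induction hg using Subgroup.closure_induction with
    | mem g hg => exact hgen g hg
    | one => simp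
    | mul g h hg hh ihg ihh =>
      rw [hGT] at hg
      have : (g * h) • p - p = g • (h • p - p) + (g • p - p) := by
        rw [mul_smul, smul_sub]
        ring
      rw [this]
      exact Ideal.add_mem _ (gl_smul_mem_hilbertIdeal hg ihh) ihg
    | inv g hg ihg =>
      rw [hGT] at hg
      have : g⁻¹ • p - p = - (g⁻¹ • (g • p - p)) := by
        rw [smul_sub, inv_smul_smul]
        ring
      rw [this]
      exact neg_mem (gl_smul_mem_hilbertIdeal (inv_mem hg) ihg)
  have hrey : reynolds G p - p ∈ hilbertIdeal G := by
    cases nonempty_fintype G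
    rw [sum_sub_reynolds hG, finsum_eq_sum_of_fintype]
    exact Ideal.mul_mem_left _ _ (Ideal.sum_mem _ fun g _ => hall g g.2)
  set c := constantCoeff (reynolds G p) with hc
  have hpc : p - C c ∈ hilbertIdeal G := by
    have h : reynolds G p - C c ∈ hilbertIdeal G :=
      Ideal.subset_span ⟨Subalgebra.sub_mem _ (reynolds_mem p)
        ((invariants G).algebraMap_mem c), by simp [hc]⟩
    have := Ideal.sub_mem _ h hrey
    rwa [sub_sub_sub_cancel_left] at this
  have hcc : coeff 0 p = c := by
    have := constantCoeff_of_mem_hilbertIdeal hpc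
    rwa [map_sub, constantCoeff_C, sub_eq_zero] at this
  have hca := homogeneousComponent_mem_span hBh hp d
  rw [homogeneousComponent_mul_of_isHomogeneous had, if_pos le_rfl, Nat.sub_self,
    homogeneousComponent_zero, hcc] at hca
  have hc0 : c = 0 := by
    by_contra hne
    apply haB
    have := Ideal.mul_mem_left _ (C c⁻¹) hca
    rwa [← mul_assoc, ← C_mul, inv_mul_cancel₀ hne, C_1, one_mul] at this
  rwa [hc0, C_0, sub_zero] at hpc

end Syzygy

/-! ### A Koszul complex argument -/

section Koszul

theorem mem_ideal_smul_top_iff {R M ι : Type*} [CommRing R] [AddCommGroup M] [Module R M]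
    (b : Module.Basis ι R M) (I : Ideal R) (x : M) :
    x ∈ I • (⊤ : Submodule R M) ↔ ∀ i, b.repr x i ∈ I := by
  constructor
  · intro hx i
    induction hx using Submodule.smul_induction_on' with
    | smul r hr m _ => simpa using I.mul_mem_right _ hr
    | add x _ y _ hx hy => simpa using I.add_mem hx hy
  · intro h
    rw [← b.linearCombination_repr x, Finsupp.linearCombination_apply]
    exact Submodule.sum_mem _ fun i _ => Submodule.smul_mem_smul (h i) trivial

variable {R : Type*} [CommRing R] {n : ℕ}

local notation "Λ" => ExteriorAlgebra R (Fin n → R)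

/-- The Koszul differential on the exterior algebra. -/
def koszul (d : Module.Dual R (Fin n → R)) :
    ExteriorAlgebra R (Fin n → R) →ₗ[R] ExteriorAlgebra R (Fin n → R) :=
  CliffordAlgebra.contractLeft (Q := 0) d

theorem koszul_one (d : Module.Dual R (Fin n → R)) : koszul d 1 = 0 :=
  CliffordAlgebra.contractLeft_one (Q := 0) d

theorem koszul_koszul (d : Module.Dual R (Fin n → R)) (x : Λ) : koszul d (koszul d x) = 0 :=
  CliffordAlgebra.contractLeft_contractLeft _ _

theorem koszul_ι_mul (d : Module.Dual R (Fin n → R)) (v : Fin n → R) (x : Λ) :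
    koszul d (ExteriorAlgebra.ι R v * x) = d v • x - ExteriorAlgebra.ι R v * koszul d x :=
  CliffordAlgebra.contractLeft_ι_mul (Q := 0) (d := d) v x

theorem mul_mem_ideal_smul_top (I : Ideal R) (y : Λ) {x : Λ}
    (hx : x ∈ I • (⊤ : Submodule R Λ)) : y * x ∈ I • (⊤ : Submodule R Λ) :=
  Submodule.smul_top_le_comap_smul_top I (LinearMap.mulLeft R y) hx

theorem koszul_mem_ideal_smul_top {d : Module.Dual R (Fin n → R)} {m : Ideal R}
    (hd : ∀ v, d v ∈ m) (x : Λ) : koszul d x ∈ m • (⊤ : Submodule R Λ) := by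
  induction x using CliffordAlgebra.left_induction with
  | algebraMap r =>
    rw [Algebra.algebraMap_eq_smul_one, map_smul, koszul_one, smul_zero]
    exact Submodule.zero_mem _
  | add x y hx hy =>
    rw [map_add]
    exact Submodule.add_mem _ hx hy
  | ι_mul x v hx =>
    exact (koszul_ι_mul d v x).symm ▸ Submodule.sub_mem _
      (Submodule.smul_mem_smul (hd v) trivial) (mul_mem_ideal_smul_top m _ hx)

theorem one_notMem_ideal_smul_top {m : Ideal R} (hm : m ≠ ⊤) :
    (1 : Λ) ∉ m • (⊤ : Submodule R Λ) := fun h => by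
  have := Submodule.smul_top_le_comap_smul_top m
    (ExteriorAlgebra.algebraMapInv (M := Fin n → R)).toLinearMap h
  rw [Submodule.mem_comap, AlgHom.toLinearMap_apply, map_one, smul_eq_mul, Ideal.mul_top] at this
  exact hm ((Ideal.eq_top_iff_one _).mpr this)

theorem koszul_prod_mem {d : Module.Dual R (Fin n → R)} {J : Ideal R} {w : R → Fin n → R}
    (L : List R) (hL : ∀ a ∈ L, d (w a) ∈ J) :
    koszul d (L.map fun a => ExteriorAlgebra.ι R (w a)).prod ∈ J • (⊤ : Submodule R Λ) := by
  induction L with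
  | nil => simp [koszul_one]
  | cons a L ih =>
    rw [List.map_cons, List.prod_cons, koszul_ι_mul]
    exact Submodule.sub_mem _ (Submodule.smul_mem_smul (hL a List.mem_cons_self) trivial)
      (mul_mem_ideal_smul_top J _ (ih fun b hb => hL b (List.mem_cons_of_mem _ hb)))

theorem prod_notMem_ideal_smul_top_sup_range {d : Module.Dual R (Fin n → R)} {m : Ideal R}
    (hm : m ≠ ⊤) (hd : ∀ v, d v ∈ m) {s : Set R} (hs : ∀ a ∈ s, a ∈ m) {w : R → Fin n → R}
    (hw : ∀ a ∈ s, d (w a) = a)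
    (hsyz : ∀ a ∈ s, ∀ p, p * a ∈ Ideal.span (s \ {a}) → p ∈ Ideal.span s)
    (L : List R) (hL : L.Nodup) (hLs : ∀ a ∈ L, a ∈ s) :
    (L.map fun a => ExteriorAlgebra.ι R (w a)).prod ∉
      Ideal.span s • (⊤ : Submodule R Λ) ⊔ LinearMap.range (koszul d) := by
  induction L with
  | nil =>
    intro h
    refine one_notMem_ideal_smul_top (n := n) hm ((sup_le (Submodule.smul_mono_left ?_) ?_ :
      Ideal.span s • (⊤ : Submodule R Λ) ⊔ LinearMap.range (koszul d) ≤ m • ⊤) h)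
    · exact Ideal.span_le.mpr hs
    · rintro _ ⟨x, rfl⟩
      exact koszul_mem_ideal_smul_top hd x
  | cons a L ih =>
    intro h
    rw [List.nodup_cons] at hL
    have has := hLs a List.mem_cons_self
    refine ih hL.2 (fun b hb => hLs b (List.mem_cons_of_mem _ hb)) ?_
    rw [List.map_cons, List.prod_cons] at h
    set Z := (L.map fun a => ExteriorAlgebra.ι R (w a)).prod
    have hZ : koszul d Z ∈ Ideal.span (s \ {a}) • (⊤ : Submodule R Λ) := by
      refine koszul_prod_mem L fun b hb => ?_
      have hbs := hLs b (List.mem_cons_of_mem _ hb)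
      rw [hw b hbs]
      refine Ideal.subset_span ⟨hbs, ?_⟩
      rintro rfl
      exact hL.1 hb
    obtain ⟨y, hy, _, ⟨θ, rfl⟩, hyθ⟩ := Submodule.mem_sup.mp h
    rw [← Set.insert_sdiff_self_of_mem has, Ideal.span_insert, Submodule.sup_smul,
      Submodule.ideal_span_singleton_smul] at hy
    obtain ⟨_, ⟨η, -, rfl⟩, y', hy', rfl⟩ := Submodule.mem_sup.mp hy
    have hmul : a • (Z - koszul d η) ∈ Ideal.span (s \ {a}) • (⊤ : Submodule R Λ) := by
      have h1 := congrArg (koszul d) hyθ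
      rw [koszul_ι_mul, hw a has, map_add, map_add, koszul_koszul, add_zero] at h1
      have h2 : a • (Z - koszul d η) =
          koszul d y' + ExteriorAlgebra.ι R (w a) * koszul d Z := by
        have h3 : koszul d ((DistribSMul.toLinearMap R Λ a) η) = a • koszul d η := map_smul _ _ _
        rw [h3] at h1
        rw [smul_sub, sub_eq_iff_eq_add, ← sub_eq_iff_eq_add'.mpr h1.symm]
        abel
      rw [h2]
      exact Submodule.add_mem _ (Submodule.smul_top_le_comap_smul_top _ (koszul d) hy')
        (mul_mem_ideal_smul_top _ _ hZ)
    have hI : Z - koszul d η ∈ Ideal.span s • (⊤ : Submodule R Λ) := by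
      have b := (Pi.basisFun R (Fin n)).ExteriorAlgebra
      rw [mem_ideal_smul_top_iff b] at hmul ⊢
      intro i
      refine hsyz a has _ ?_
      rw [mul_comm]
      simpa using hmul i
    exact Submodule.mem_sup.mpr ⟨_, hI, _, ⟨η, rfl⟩, sub_add_cancel _ _⟩

theorem card_le_of_syzygy [IsDomain R] {d : Module.Dual R (Fin n → R)} {m : Ideal R}
    (hm : m ≠ ⊤) (hd : ∀ v, d v ∈ m) (s : Finset R)
    (hs : ∀ a ∈ s, ∃ v, d v = a)
    (hsyz : ∀ a ∈ s, ∀ p, p * a ∈ Ideal.span ((s : Set R) \ {a}) → p ∈ Ideal.span (s : Set R)) :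
    s.card ≤ n := by
  have hs' : ∀ a, ∃ v, a ∈ s → d v = a := fun a => by
    by_cases ha : a ∈ s
    · obtain ⟨v, hv⟩ := hs a ha
      exact ⟨v, fun _ => hv⟩
    · exact ⟨0, fun h => absurd h ha⟩
  choose w hw using hs'
  by_contra! hcard
  have hne := prod_notMem_ideal_smul_top_sup_range hm hd (s := (s : Set R))
    (fun a ha => hw a ha ▸ hd (w a)) (fun a ha => hw a ha) hsyz s.toList s.nodup_toList
    (fun a ha => Finset.mem_toList.mp ha)
  have := Module.Free.of_basis (Pi.basisFun R (Fin n)).ExteriorAlgebra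
  have h0 : ExteriorAlgebra.ιMulti R s.toList.length (fun i => w (s.toList.get i)) = 0 := by
    refine AlternatingMap.map_linearDependent _ _ fun hli => ?_
    have := hli.fintype_card_le_finrank
    simp at this
    lia
  rw [ExteriorAlgebra.ιMulti_apply] at h0
  apply hne
  convert Submodule.zero_mem _
  rw [← h0]
  congr 1
  exact List.ext_get (by simp) fun i _ _ => by simp

end Koszul

/-! ### Generators of the invariant ring of a reflection group -/

section Generators

variable {k : Type*} [Field k] {n : ℕ} {G : Subgroup (GL (Fin n) k)}

theorem exists_sum_mul_X_eq {p : MvPolynomial (Fin n) k} (hp : constantCoeff p = 0) :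
    ∃ v : Fin n → MvPolynomial (Fin n) k, ∑ i, v i * X i = p := by
  rw [← Ideal.mem_span_range_iff_exists_fun, ← Set.image_univ, mem_ideal_span_X_image]
  intro m hm
  by_contra! h
  have hm0 : m = 0 := Finsupp.ext fun i => h i trivial
  rw [hm0, mem_support_iff] at hm
  exact hm hp

theorem hilbertIdeal_eq_span_homogeneous :
    hilbertIdeal G = Ideal.span {p | p ∈ invariants G ∧ ∃ d, 0 < d ∧ p.IsHomogeneous d} := by
  refine le_antisymm (Ideal.span_le.mpr fun p hp => ?_) (Ideal.span_mono fun p hp => ⟨hp.1, ?_⟩)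
  · rw [SetLike.mem_coe, ← sum_homogeneousComponent p]
    refine Ideal.sum_mem _ fun d _ => ?_
    rcases Nat.eq_zero_or_pos d with rfl | hd
    · rw [homogeneousComponent_zero, show coeff 0 p = 0 from hp.2, C_0]
      exact Ideal.zero_mem _
    · exact Ideal.subset_span ⟨homogeneousComponent_mem_invariants hp.1 d, d, hd,
        homogeneousComponent_isHomogeneous d p⟩
  · obtain ⟨-, d, hd, h⟩ := hp
    by_contra hne
    exact hd.ne (by simpa using h hne)

theorem exists_finset_span_eq_hilbertIdeal [Finite G] (hG : (Nat.card G : k) ≠ 0)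
    {T : Set (GL (Fin n) k)} (hT : ∀ g ∈ T, HasFixedHyperplane g)
    (hGT : Subgroup.closure T = G) :
    ∃ s : Finset (MvPolynomial (Fin n) k),
      (∀ p ∈ s, p ∈ invariants G ∧ ∃ d, 0 < d ∧ p.IsHomogeneous d) ∧
      Ideal.span (s : Set (MvPolynomial (Fin n) k)) = hilbertIdeal G ∧ s.card ≤ n := by
  classical
  set P : Set (Finset (MvPolynomial (Fin n) k)) := {s |
    (∀ p ∈ s, p ∈ invariants G ∧ ∃ d, 0 < d ∧ p.IsHomogeneous d) ∧
      Ideal.span (s : Set (MvPolynomial (Fin n) k)) = hilbertIdeal G} with hP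
  have hne : P.Nonempty := by
    obtain ⟨s, hs, h⟩ := (Submodule.fg_span_iff_fg_span_finset_subset
      (R := MvPolynomial (Fin n) k) _).mp (IsNoetherian.noetherian
        (Ideal.span {p | p ∈ invariants G ∧ ∃ d, 0 < d ∧ p.IsHomogeneous d}))
    exact ⟨s, hs, by rw [hilbertIdeal_eq_span_homogeneous]; exact h.symm⟩
  obtain ⟨s, ⟨hs, hspan⟩, hmin⟩ := WellFounded.has_min (wellFounded_lt) P hne
  refine ⟨s, hs, hspan, ?_⟩
  have hirr : ∀ a ∈ s, a ∉ Ideal.span ((s : Set (MvPolynomial (Fin n) k)) \ {a}) := by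
    intro a ha hmem
    refine hmin (s.erase a) ⟨fun p hp => hs p (Finset.mem_of_mem_erase hp), ?_⟩
      (Finset.erase_ssubset ha)
    rw [← hspan, Finset.coe_erase]
    conv_rhs => rw [← Set.insert_sdiff_self_of_mem (Finset.mem_coe.mpr ha), Ideal.span_insert]
    exact (sup_eq_right.mpr ((Ideal.span_singleton_le_iff_mem _).mpr hmem)).symm
  have hcc : ∀ a ∈ s, constantCoeff a = 0 := fun a ha =>
    constantCoeff_of_mem_hilbertIdeal (hspan ▸ Ideal.subset_span ha)
  refine card_le_of_syzygy (d := Fintype.linearCombination _ X)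
    (m := RingHom.ker (constantCoeff : MvPolynomial (Fin n) k →+* k))
    (RingHom.ker_ne_top _) (fun v => ?_) s (fun a ha => ?_) fun a ha p hp => ?_
  · simp [RingHom.mem_ker, Fintype.linearCombination_apply]
  · obtain ⟨v, hv⟩ := exists_sum_mul_X_eq (hcc a ha)
    exact ⟨v, by simpa [Fintype.linearCombination_apply] using hv⟩
  · obtain ⟨hinv, d, -, hd⟩ := hs a ha
    rw [hspan]
    exact mem_hilbertIdeal_of_mul_mem_span hG hT hGT (fun b hb => (hs b hb.1).1)
      (fun b hb => (hs b hb.1).2.imp fun _ h => h.2) hinv hd (hirr a ha) hp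

theorem adjoin_eq_invariants [Finite G] (hG : (Nat.card G : k) ≠ 0)
    {s : Finset (MvPolynomial (Fin n) k)}
    (hs : ∀ p ∈ s, p ∈ invariants G ∧ ∃ d, 0 < d ∧ p.IsHomogeneous d)
    (hspan : Ideal.span (s : Set (MvPolynomial (Fin n) k)) = hilbertIdeal G) :
    Algebra.adjoin k (s : Set (MvPolynomial (Fin n) k)) = invariants G := by
  refine le_antisymm (Algebra.adjoin_le fun p hp => (hs p hp).1) fun p hp => ?_
  suffices key : ∀ e, ∀ q ∈ invariants G, q.IsHomogeneous e →
      q ∈ Algebra.adjoin k (s : Set (MvPolynomial (Fin n) k)) by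
    rw [← sum_homogeneousComponent p]
    exact Subalgebra.sum_mem _ fun e _ => key e _ (homogeneousComponent_mem_invariants hp e)
      (homogeneousComponent_isHomogeneous e p)
  intro e
  induction e using Nat.strong_induction_on with
  | _ e ih =>
  intro q hq hqe
  rcases Nat.eq_zero_or_pos e with rfl | he
  · rw [totalDegree_eq_zero_iff_eq_C.mp (Nat.le_zero.mp hqe.totalDegree_le)]
    exact Subalgebra.algebraMap_mem _ _
  · have hqI : q ∈ Ideal.span (s : Set (MvPolynomial (Fin n) k)) := by
      rw [hspan, hilbertIdeal_eq_span_homogeneous]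
      exact Ideal.subset_span ⟨hq, e, he, hqe⟩
    obtain ⟨c, hc⟩ := Submodule.mem_span_finset'.mp hqI
    have h1 : q = ∑ a : s, reynolds G (c a) * a := by
      rw [← reynolds_eq_self hG hq, ← hc, reynolds_sum]
      exact Finset.sum_congr rfl fun a _ => reynolds_mul _ (hs a a.2).1
    have h2 : homogeneousComponent e q = q := by
      rw [homogeneousComponent_of_mem hqe, if_pos rfl]
    rw [← h2, h1, map_sum]
    refine Subalgebra.sum_mem _ fun a _ => ?_
    obtain ⟨-, d, hd, had⟩ := hs a a.2
    rw [homogeneousComponent_mul_of_isHomogeneous had]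
    split_ifs with hde
    · exact Subalgebra.mul_mem _ (ih (e - d) (by lia) _
        (homogeneousComponent_mem_invariants (reynolds_mem _) _)
        (homogeneousComponent_isHomogeneous _ _)) (Algebra.subset_adjoin a.2)
    · exact Subalgebra.zero_mem _

theorem isIntegral_invariants [Finite G] :
    Algebra.IsIntegral (invariants G) (MvPolynomial (Fin n) k) :=
  have : Algebra.IsInvariant (invariants G) (MvPolynomial (Fin n) k) G :=
    ⟨fun p hp => ⟨⟨p, fun g hg => hp ⟨g, hg⟩⟩, rfl⟩⟩
  Algebra.IsInvariant.isIntegral _ _ G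

/-- The invariant ring of a finite reflection group in the nonmodular case is generated by `n`
algebraically independent invariants without constant term. -/
theorem exists_algebraicIndependent_generators [Finite G] (hG : (Nat.card G : k) ≠ 0)
    {T : Set (GL (Fin n) k)} (hT : ∀ g ∈ T, HasFixedHyperplane g)
    (hGT : Subgroup.closure T = G) :
    ∃ f : Fin n → MvPolynomial (Fin n) k, (∀ i, constantCoeff (f i) = 0) ∧
      AlgebraicIndependent k f ∧ Algebra.adjoin k (Set.range f) = invariants G := by
  obtain ⟨s, hs, hspan, hcard⟩ := exists_finset_span_eq_hilbertIdeal hG hT hGT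
  have hadj := adjoin_eq_invariants hG hs hspan
  have hrange : Set.range ((↑) : s → MvPolynomial (Fin n) k) = s := by simp
  have halg : Algebra.IsAlgebraic
      (Algebra.adjoin k (Set.range ((↑) : s → MvPolynomial (Fin n) k)))
      (MvPolynomial (Fin n) k) := by
    rw [hrange, hadj]
    have := isIntegral_invariants (G := G)
    infer_instance
  have htr : Algebra.trdeg k (MvPolynomial (Fin n) k) = n := by
    simp [MvPolynomial.trdeg_of_isDomain]
  have hn : n = s.card := by
    refine le_antisymm ?_ hcard
    have := Algebra.IsAlgebraic.trdeg_le_cardinalMk k (Set.range ((↑) : s → MvPolynomial (Fin n) k))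
    rw [htr, hrange] at this
    simpa using this
  have hbasis : IsTranscendenceBasis k ((↑) : s → MvPolynomial (Fin n) k) := by
    refine Algebra.IsAlgebraic.isTranscendenceBasis_of_le_trdeg_of_finite k _ ?_
    rw [htr]
    simp [hn]
  let e : Fin n ≃ s := (finCongr hn).trans s.equivFin.symm
  refine ⟨fun i => e i, fun i => ?_, hbasis.1.comp e e.injective, ?_⟩
  · exact constantCoeff_of_mem_hilbertIdeal (hspan ▸ Ideal.subset_span (e i).2)
  · rw [← hadj, ← hrange]
    congr 1
    exact e.surjective.range_comp _

end Generators

/-! ### Orbit polynomials -/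

section OrbitPolynomial

variable {Γ A T B ι : Type*} [Group Γ] [CommRing A] [MulSemiringAction Γ A]

theorem out_smul_eq {N : Subgroup Γ} {a : A} (ha : ∀ h ∈ N, h • a = a) (g : Γ) :
    (g : Γ ⧸ N).out • a = g • a := by
  have h : g⁻¹ * (g : Γ ⧸ N).out ∈ N := QuotientGroup.eq.mp (QuotientGroup.out_eq' _).symm
  conv_rhs => rw [← ha _ h, smul_smul, mul_inv_cancel_left]

variable [CommRing T] [CommRing B] [Fintype ι]

/-- Let `T` be a ring between `A` and its subring of `Γ`-invariants, consisting of `N`-invariants,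
and let `α : T → B` and `β : A → B` agree on `Γ`-invariants. Then `α` annihilates the polynomial
whose roots are the images under `β` of the conjugates of a linear combination of elements
of `T`. -/
theorem prod_sum_sub_eq_zero (N : Subgroup Γ) [Fintype (Γ ⧸ N)] {j : T →+* A}
    (hj : Function.Injective j) (hN : ∀ h ∈ N, ∀ t, h • j t = j t) (α : T →+* B) (β : A →+* B)
    (hαβ : ∀ a : A, (∀ g : Γ, g • a = a) → ∃ t, j t = a ∧ α t = β a) (τ : ι → T) (z : ι → B) :
    ∏ c : Γ ⧸ N, ∑ i, z i * (α (τ i) - β (c.out • j (τ i))) = 0 := by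
  set F : MvPolynomial (Option ι) A := ∏ c : Γ ⧸ N,
    (X none - ∑ i, X (some i) * C (c.out • j (τ i))) with hF
  have hFinv : ∀ g : Γ, map (MulSemiringAction.toRingHom Γ A g) F = F := by
    intro g
    rw [hF, map_prod]
    refine Fintype.prod_equiv (MulAction.toPerm g) _ _ fun c => ?_
    simp only [map_sub, map_sum, _root_.map_mul, map_X, map_C, MulSemiringAction.toRingHom_apply]
    refine congrArg (X none - ·) (Finset.sum_congr rfl fun i _ => ?_)
    rw [smul_smul, ← out_smul_eq (fun h hh => hN h hh (τ i)) (g * c.out)]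
    congr 4
    rw [MulAction.toPerm_apply]
    conv_rhs => rw [← QuotientGroup.out_eq' c]
    rfl
  have hcoeff : ∀ m, ∃ t, j t = coeff m F ∧ α t = β (coeff m F) := fun m =>
    hαβ _ fun g => by
      conv_rhs => rw [← hFinv g]
      rw [coeff_map, MulSemiringAction.toRingHom_apply]
  choose t ht htα using hcoeff
  let w : Option ι → MvPolynomial ι T := fun o => o.elim (∑ i, X i * C (τ i)) X
  have hP : ∑ m ∈ F.support, C (t m) * ∏ o ∈ m.support, w o ^ m o = 0 := by
    apply map_injective j hj
    have h1 : eval₂ C (fun o => map j (w o)) F = 0 := by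
      rw [hF, ← coe_eval₂Hom, map_prod]
      refine Finset.prod_eq_zero (Finset.mem_univ ((1 : Γ) : Γ ⧸ N)) ?_
      simp only [map_sub, map_sum, _root_.map_mul, coe_eval₂Hom, eval₂_X, eval₂_C, w,
        Option.elim_none, Option.elim_some, map_X, map_C]
      rw [sub_eq_zero]
      refine Finset.sum_congr rfl fun i _ => ?_
      rw [out_smul_eq (fun h hh => hN h hh (τ i)), one_smul]
    rw [map_zero, ← h1, eval₂_eq, map_sum]
    refine Finset.sum_congr rfl fun m _ => ?_
    simp only [_root_.map_mul, map_prod, map_pow, map_C, ht]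
  have h2 := congrArg (eval₂Hom α z) hP
  have h3 : ∀ o, eval₂Hom α z (w o) = o.elim (∑ i, z i * α (τ i)) z := by
    rintro (_ | i) <;> simp [w]
  rw [map_zero, map_sum] at h2
  simp only [_root_.map_mul, map_prod, map_pow, h3, eval₂Hom_C, htα] at h2
  rw [← eval₂_eq, hF, ← coe_eval₂Hom, map_prod] at h2
  rw [← h2]
  refine Finset.prod_congr rfl fun c _ => ?_
  simp [mul_sub, Finset.sum_sub_distrib]

theorem eq_zero_of_sum_X_mul_C_eq_zero {κ : Type*} [CommRing κ] {a : ι → κ}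
    (h : ∑ i, (X i : MvPolynomial ι κ) * C (a i) = 0) (i : ι) : a i = 0 := by
  classical
  simpa [Pi.single_apply] using congrArg (eval (Pi.single i 1)) h

end OrbitPolynomial

/-! ### Inertia and derivations on the invariants of a subgroup -/

section Inertia

variable {k κ : Type*} [Field k] [CommRing κ] [IsDomain κ] {n : ℕ}
  {G H : Subgroup (GL (Fin n) k)} {φ : MvPolynomial (Fin n) k →+* κ}

theorem invariants_anti (hHG : H ≤ G) : invariants G ≤ invariants H :=
  fun _ hp h hh => hp h (hHG hh)

/-- If `H` contains the inertia subgroup of `G` at the prime `ker φ`, then the elements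
of `G \ H` are separated modulo `ker φ` from the identity by `H`-invariants. -/
theorem exists_invariant_map_smul_ne [Finite H] (hHG : H ≤ G)
    (hin : ∀ g ∈ G, (∀ p : MvPolynomial (Fin n) k, φ (g • p) = φ p) → g ∈ H)
    {σ : GL (Fin n) k} (hσ : σ ∈ G) (hσH : σ ∉ H) :
    ∃ t ∈ invariants H, φ (σ • t) ≠ φ t := by
  by_contra! hcon
  cases nonempty_fintype (H ⧸ (⊥ : Subgroup H))
  let φσ : MvPolynomial (Fin n) k →+* κ := φ.comp (MulSemiringAction.toRingHom _ _ σ)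
  have hprod := prod_sum_sub_eq_zero (Γ := H) ⊥ (j := RingHom.id (MvPolynomial (Fin n) k))
    Function.injective_id (by simp) ((C : κ →+* MvPolynomial (Fin n) κ).comp φσ)
    ((C : κ →+* MvPolynomial (Fin n) κ).comp φ)
    (fun a ha => ⟨a, rfl, congrArg C (hcon a fun h hh => ha ⟨h, hh⟩)⟩) X X
  obtain ⟨c, -, hc⟩ := Finset.prod_eq_zero_iff.mp hprod
  simp only [RingHom.comp_apply, RingHom.id_apply, ← C_sub] at hc
  obtain ⟨h, hh⟩ : ∃ h : H, h = c.out := ⟨_, rfl⟩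
  rw [← hh] at hc
  have hX : ∀ i, φ (σ • (X i : MvPolynomial (Fin n) k)) = φ ((h : GL (Fin n) k) • X i) :=
    fun i => sub_eq_zero.mp (eq_zero_of_sum_X_mul_C_eq_zero hc i)
  have hext : φσ = φ.comp (MulSemiringAction.toRingHom _ _ (h : GL (Fin n) k)) := by
    refine MvPolynomial.ringHom_ext (fun c => ?_) hX
    simp only [φσ, RingHom.comp_apply, MulSemiringAction.toRingHom_apply, gl_smul_C]
  have hmem : σ * (h : GL (Fin n) k)⁻¹ ∈ H := by
    refine hin _ (mul_mem hσ (inv_mem (hHG h.2))) fun p => ?_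
    have := RingHom.congr_fun hext ((h : GL (Fin n) k)⁻¹ • p)
    simpa [φσ, mul_smul] using this
  exact hσH (by simpa using mul_mem hmem h.2)

/-- The ring homomorphism to dual numbers attached to a derivation. -/
def toDualNumber {T κ : Type*} [CommRing T] [CommRing κ] (φ : T →+* κ) (δ : T →+ κ)
    (hδ : ∀ a b, δ (a * b) = φ a * δ b + φ b * δ a) (hδ1 : δ 1 = 0) : T →+* DualNumber κ where
  toFun t := TrivSqZeroExt.inl (φ t) + TrivSqZeroExt.inr (δ t)
  map_one' := by simp [hδ1]
  map_zero' := by simp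
  map_add' a b := by ext <;> simp
  map_mul' a b := by
    ext
    · simp
    · simp [hδ, mul_comm (φ b)]

theorem fst_toDualNumber {T κ : Type*} [CommRing T] [CommRing κ] {φ : T →+* κ} {δ : T →+ κ}
    (hδ : ∀ a b, δ (a * b) = φ a * δ b + φ b * δ a) (hδ1 : δ 1 = 0) (t : T) :
    (toDualNumber φ δ hδ hδ1 t).fst = φ t := by
  simp [toDualNumber]

theorem snd_toDualNumber {T κ : Type*} [CommRing T] [CommRing κ] {φ : T →+* κ} {δ : T →+ κ}
    (hδ : ∀ a b, δ (a * b) = φ a * δ b + φ b * δ a) (hδ1 : δ 1 = 0) (t : T) :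
    (toDualNumber φ δ hδ hδ1 t).snd = δ t := by
  simp [toDualNumber]

theorem snd_eq_zero_of_prod_eq_zero {K ι : Type*} [CommRing K] [IsDomain K] [Fintype ι]
    {u : ι → DualNumber K} (hu : ∏ c, u c = 0) (c₀ : ι) (h₀ : (u c₀).fst = 0)
    (hne : ∀ c, c ≠ c₀ → (u c).fst ≠ 0) : (u c₀).snd = 0 := by
  classical
  rw [← Finset.prod_erase_mul _ _ (Finset.mem_univ c₀)] at hu
  have hQ : (∏ c ∈ Finset.univ.erase c₀, u c).fst ≠ 0 := by
    change TrivSqZeroExt.fstHom K K K _ ≠ 0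
    rw [map_prod, Finset.prod_ne_zero_iff]
    exact fun c hc => hne c (Finset.ne_of_mem_erase hc)
  have h := congrArg TrivSqZeroExt.snd hu
  rw [TrivSqZeroExt.snd_mul, h₀, MulOpposite.op_zero, zero_smul, add_zero, smul_eq_mul,
    TrivSqZeroExt.snd_zero] at h
  exact (mul_eq_zero.mp h).resolve_left hQ

/-- A derivation from `H`-invariants into a domain which vanishes on `G`-invariants is zero,
provided `H` contains the inertia subgroup of `G` at the prime `ker φ`. -/
theorem derivation_eq_zero [Finite G] (hHG : H ≤ G)
    (hin : ∀ g ∈ G, (∀ p : MvPolynomial (Fin n) k, φ (g • p) = φ p) → g ∈ H)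
    {δ : invariants H →+ κ} (hδ : ∀ a b, δ (a * b) = φ a * δ b + φ b * δ a)
    (hδG : ∀ t : invariants H, (t : MvPolynomial (Fin n) k) ∈ invariants G → δ t = 0)
    (t : invariants H) : δ t = 0 := by
  classical
  have hfin : Finite H := Finite.of_injective _ (Subgroup.inclusion_injective hHG)
  let N := H.subgroupOf G
  cases nonempty_fintype (G ⧸ N)
  have hsep : ∀ c : G ⧸ N, ∃ s : invariants H, c ≠ ((1 : G) : G ⧸ N) →
      φ ((c.out : GL (Fin n) k) • (s : MvPolynomial (Fin n) k)) ≠ φ s := by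
    intro c
    by_cases hc : c = ((1 : G) : G ⧸ N)
    · exact ⟨0, fun h => absurd hc h⟩
    · obtain ⟨s, hs, hne⟩ := exists_invariant_map_smul_ne hHG hin c.out.2 fun hmem => hc <| by
        rw [← QuotientGroup.out_eq' c, eq_comm]
        exact QuotientGroup.eq.mpr (by simpa [N, Subgroup.mem_subgroupOf] using hmem)
      exact ⟨⟨s, hs⟩, fun _ => hne⟩
  choose s hs using hsep
  let ι := Option (G ⧸ N)
  let τ : ι → invariants H := fun o => o.elim t s
  let CC : κ →+* MvPolynomial ι κ := C
  let δ' : invariants H →+ MvPolynomial ι κ := CC.toAddMonoidHom.comp δ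
  let j : invariants H →+* MvPolynomial (Fin n) k := (invariants H).val.toRingHom
  have hδ' : ∀ a b, δ' (a * b) =
      (CC.comp (φ.comp j)) a * δ' b + (CC.comp (φ.comp j)) b * δ' a := fun a b => by
    change CC (δ (a * b)) = CC (φ a) * CC (δ b) + CC (φ b) * CC (δ a)
    rw [hδ, map_add, _root_.map_mul, _root_.map_mul]
  have hδ1 : δ' 1 = 0 := by
    change CC (δ 1) = 0
    rw [hδG 1 (one_mem (invariants G)), map_zero]
  have hprod := prod_sum_sub_eq_zero (Γ := G) N (j := j) Subtype.val_injective
    (fun h hh a => a.2 h hh) (toDualNumber _ δ' hδ' hδ1)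
    ((TrivSqZeroExt.inlHom (MvPolynomial ι κ) (MvPolynomial ι κ)).comp (CC.comp φ))
    (fun a ha => ⟨⟨a, fun h hh => ha ⟨h, hHG hh⟩⟩, rfl, by
      have h0 : δ ⟨a, fun h hh => ha ⟨h, hHG hh⟩⟩ = 0 := hδG _ fun g hg => ha ⟨g, hg⟩
      ext
      · simp [toDualNumber, j]
      · simp [toDualNumber, δ', h0]⟩)
    τ (fun i => TrivSqZeroExt.inl (X i))
  have hfst : ∀ (c : G ⧸ N), (∑ i, TrivSqZeroExt.inl (X i) *
      (toDualNumber _ δ' hδ' hδ1 (τ i) - ((TrivSqZeroExt.inlHom (MvPolynomial ι κ)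
        (MvPolynomial ι κ)).comp (CC.comp φ)) (c.out • j (τ i)))).fst = ∑ i, X i *
      C (φ (τ i) - φ ((c.out : GL (Fin n) k) • (τ i : MvPolynomial (Fin n) k))) := by
    intro c
    rw [TrivSqZeroExt.fst_sum]
    refine Finset.sum_congr rfl fun i _ => ?_
    rw [TrivSqZeroExt.fst_mul, TrivSqZeroExt.fst_sub, fst_toDualNumber, C_sub]
    rfl
  have hsnd : ∀ (c : G ⧸ N), (∑ i, TrivSqZeroExt.inl (X i) *
      (toDualNumber _ δ' hδ' hδ1 (τ i) - ((TrivSqZeroExt.inlHom (MvPolynomial ι κ)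
        (MvPolynomial ι κ)).comp (CC.comp φ)) (c.out • j (τ i)))).snd = ∑ i, X i * C (δ (τ i)) := by
    intro c
    rw [TrivSqZeroExt.snd_sum]
    refine Finset.sum_congr rfl fun i _ => ?_
    rw [TrivSqZeroExt.snd_mul, TrivSqZeroExt.snd_sub, snd_toDualNumber, TrivSqZeroExt.snd_inl,
      op_smul_eq_smul, smul_zero, add_zero]
    change X i * (C (δ (τ i)) - 0) = _
    rw [sub_zero]
  have key := snd_eq_zero_of_prod_eq_zero hprod ((1 : G) : G ⧸ N) ?_ fun c hc h0 => ?_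
  · rw [hsnd] at key
    exact eq_zero_of_sum_X_mul_C_eq_zero key none
  · rw [hfst]
    refine Finset.sum_eq_zero fun i _ => ?_
    have hout : ((1 : G) : G ⧸ N).out • (τ i : MvPolynomial (Fin n) k) =
        (τ i : MvPolynomial (Fin n) k) := by
      rw [out_smul_eq (N := N) (fun h hh => (τ i).2 h hh), one_smul]
    change X i * C (φ (τ i) - φ (((1 : G) : G ⧸ N).out • (τ i : MvPolynomial (Fin n) k))) = 0
    rw [hout, sub_self, C_0, mul_zero]
  · rw [hfst] at h0
    exact hs c hc (sub_eq_zero.mp (eq_zero_of_sum_X_mul_C_eq_zero h0 (some c))).symm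

end Inertia

theorem eq_one_of_gl_smul_eq {k : Type*} [Field k] {n : ℕ} {g : GL (Fin n) k}
    (hg : ∀ p : MvPolynomial (Fin n) k, g • p = p) : g = 1 := by
  have hM : (g : Matrix (Fin n) (Fin n) k) - 1 = 0 := Matrix.ext fun i j => by
    have h := gl_smul_X_sub_X g j
    rw [hg, sub_self] at h
    have hc := coeff_linForm (((g : Matrix (Fin n) (Fin n) k) - 1).col j) i
    rw [← h, coeff_zero] at hc
    exact hc.symm
  exact Units.ext (sub_eq_zero.mp hM)

/-! ### Subgroups generated by the pseudo-reflections of a group -/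

section Jacobian

variable {k : Type*} [Field k] {n : ℕ} {G H : Subgroup (GL (Fin n) k)}
  {f h : Fin n → MvPolynomial (Fin n) k}

/-- The Jacobian matrix of the polynomials `F i`, evaluated at the `h j`. -/
def jacobianAt (h F : Fin n → MvPolynomial (Fin n) k) :
    Matrix (Fin n) (Fin n) (MvPolynomial (Fin n) k) :=
  Matrix.of fun i j => aeval h (pderiv j (F i))

theorem map_det_jacobianAt_ne_zero {κ : Type*} [CommRing κ] [IsDomain κ]
    {φ : MvPolynomial (Fin n) k →+* κ} [Finite G] (hHG : H ≤ G)
    (hin : ∀ g ∈ G, (∀ p : MvPolynomial (Fin n) k, φ (g • p) = φ p) → g ∈ H)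
    (hh : AlgebraicIndependent k h) (hhH : Algebra.adjoin k (Set.range h) = invariants H)
    (hfG : invariants G ≤ Algebra.adjoin k (Set.range f))
    {F : Fin n → MvPolynomial (Fin n) k} (hF : ∀ i, aeval h (F i) = f i) :
    φ (jacobianAt h F).det ≠ 0 := by
  intro h0
  rw [RingHom.map_det] at h0
  obtain ⟨v, hv, hMv⟩ := Matrix.exists_mulVec_eq_zero_iff.mpr h0
  have hHh : ∀ t : invariants H, ∃ P, aeval h P = (t : MvPolynomial (Fin n) k) := fun t => by
    have ht := hhH.ge t.2
    rwa [Algebra.adjoin_range_eq_range_aeval] at ht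
  choose E hE using hHh
  have hinj : Function.Injective (aeval h : MvPolynomial (Fin n) k →ₐ[k] _) := hh
  have hEu : ∀ (P) (t : invariants H), aeval h P = (t : MvPolynomial (Fin n) k) → E t = P :=
    fun P t hP => hinj ((hE t).trans hP.symm)
  let D : MvPolynomial (Fin n) k → κ := fun P => ∑ j, φ (aeval h (pderiv j P)) * v j
  have hDadd : ∀ P Q, D (P + Q) = D P + D Q := fun P Q => by
    simp [D, add_mul, Finset.sum_add_distrib]
  have hDmul : ∀ P Q, D (P * Q) = φ (aeval h P) * D Q + φ (aeval h Q) * D P := fun P Q => by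
    simp only [D, Derivation.leibniz, map_add, smul_eq_mul, _root_.map_mul, add_mul,
      Finset.sum_add_distrib, Finset.mul_sum, mul_assoc]
  let δ : invariants H →+ κ := AddMonoidHom.mk' (fun t => D (E t)) fun a b => by
    rw [← hDadd]
    congr 1
    exact hEu _ _ (by rw [map_add, hE, hE]; rfl)
  have hδE : ∀ (P) (t : invariants H), aeval h P = (t : MvPolynomial (Fin n) k) → δ t = D P :=
    fun P t hP => congrArg D (hEu P t hP)
  have hDf : ∀ i, D (F i) = 0 := fun i => congrFun hMv i
  have hDG : ∀ r ∈ Algebra.adjoin k (Set.range f), ∃ P, aeval h P = r ∧ D P = 0 := by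
    intro r hr
    induction hr using Algebra.adjoin_induction with
    | mem x hx =>
      obtain ⟨i, rfl⟩ := hx
      exact ⟨F i, hF i, hDf i⟩
    | algebraMap c => exact ⟨C c, by simp, by simp [D]⟩
    | add x y _ _ hx hy =>
      obtain ⟨P, rfl, hP⟩ := hx
      obtain ⟨Q, rfl, hQ⟩ := hy
      exact ⟨P + Q, map_add _ _ _, by rw [hDadd, hP, hQ, add_zero]⟩
    | mul x y _ _ hx hy =>
      obtain ⟨P, rfl, hP⟩ := hx
      obtain ⟨Q, rfl, hQ⟩ := hy
      exact ⟨P * Q, _root_.map_mul _ _ _, by rw [hDmul, hP, hQ, mul_zero, mul_zero, add_zero]⟩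
  have hδ0 := derivation_eq_zero hHG hin (δ := δ)
    (fun a b => by
      rw [hδE (E a * E b) (a * b) (by rw [_root_.map_mul, hE, hE]; rfl), hDmul, hE, hE]
      rfl)
    (fun t ht => by
      obtain ⟨P, hP, hP0⟩ := hDG _ (hfG ht)
      rw [hδE P t hP, hP0])
  refine hv (funext fun j => ?_)
  have hj : h j ∈ invariants H := hhH ▸ Algebra.subset_adjoin ⟨j, rfl⟩
  have := hδ0 ⟨h j, hj⟩
  rw [hδE (X j) _ (aeval_X _ _)] at this
  simpa [D, pderiv_X, Pi.single_apply, apply_ite, ite_mul] using this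

theorem isUnit_det_jacobianAt [Finite G] (hHG : H ≤ G)
    (hrefl : ∀ g ∈ G, g ≠ 1 → HasFixedHyperplane g → g ∈ H)
    (hh : AlgebraicIndependent k h) (hhH : Algebra.adjoin k (Set.range h) = invariants H)
    (hfG : invariants G ≤ Algebra.adjoin k (Set.range f))
    {F : Fin n → MvPolynomial (Fin n) k} (hF : ∀ i, aeval h (F i) = f i) :
    IsUnit (jacobianAt h F).det := by
  by_contra hu
  have h0 : (jacobianAt h F).det ≠ 0 :=
    map_det_jacobianAt_ne_zero (φ := RingHom.id _) hHG
      (fun g _ hg => by rw [eq_one_of_gl_smul_eq hg]; exact one_mem H) hh hhH hfG hF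
  obtain ⟨q, hq, hdvd⟩ := WfDvdMonoid.exists_irreducible_factor hu h0
  have hprime : (Ideal.span {q}).IsPrime := (Ideal.span_singleton_prime hq.ne_zero).mpr hq.prime
  refine map_det_jacobianAt_ne_zero (φ := Ideal.Quotient.mk (Ideal.span {q})) hHG
    (fun g hg hgq => ?_) hh hhH hfG hF
    (Ideal.Quotient.eq_zero_iff_mem.mpr (Ideal.mem_span_singleton.mpr hdvd))
  by_cases hg1 : g = 1
  · exact hg1 ▸ one_mem H
  refine hrefl g hg hg1 (hasFixedHyperplane_of_dvd hg1 (q := q) (fun hd => ?_) fun p => ?_)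
  · have hC := totalDegree_eq_zero_iff_eq_C.mp hd
    refine hq.not_isUnit ?_
    rw [hC]
    refine IsUnit.map C (isUnit_iff_ne_zero.mpr fun hc => hq.ne_zero ?_)
    rw [hC, hc, C_0]
  · exact Ideal.mem_span_singleton.mp (Ideal.Quotient.eq.mp (hgq p))

end Jacobian

/-! ### Comparison of the invariants of a group and of its reflection subgroup -/

section Comparison

variable {k : Type*} [Field k] {n : ℕ} {G H : Subgroup (GL (Fin n) k)}
  {f h : Fin n → MvPolynomial (Fin n) k}

theorem constantCoeff_aeval_of_constantCoeff_eq_zero (h0 : ∀ j, constantCoeff (h j) = 0)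
    (P : MvPolynomial (Fin n) k) : constantCoeff (aeval h P) = constantCoeff P := by
  induction P using MvPolynomial.induction_on with
  | C c => simp
  | add P Q hP hQ => rw [map_add, map_add, map_add, hP, hQ]
  | mul_X P j _ => simp [h0]

/-- Up to products of two elements without constant term, a polynomial in the `h j` agrees
with its linear part. -/
theorem aeval_sub_linear_mem {W : Submodule k (MvPolynomial (Fin n) k)}
    (h0 : ∀ j, constantCoeff (h j) = 0)
    (hW : ∀ a ∈ Algebra.adjoin k (Set.range h), ∀ b ∈ Algebra.adjoin k (Set.range h),
      constantCoeff a = 0 → constantCoeff b = 0 → a * b ∈ W)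
    (P : MvPolynomial (Fin n) k) :
    aeval h P - C (constantCoeff P) - ∑ j, C (constantCoeff (pderiv j P)) * h j ∈ W := by
  induction P using MvPolynomial.induction_on with
  | C c => simp
  | add P Q hP hQ =>
    convert add_mem hP hQ using 1
    simp only [map_add, add_mul, Finset.sum_add_distrib]
    ring
  | mul_X P i _ =>
    have hP : aeval h P ∈ Algebra.adjoin k (Set.range h) := by
      rw [Algebra.adjoin_range_eq_range_aeval]
      exact ⟨P, rfl⟩
    have := hW (aeval h P - C (constantCoeff P)) (sub_mem hP (Subalgebra.algebraMap_mem _ _))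
      (h i) (Algebra.subset_adjoin ⟨i, rfl⟩)
      (by rw [map_sub, constantCoeff_aeval_of_constantCoeff_eq_zero h0, constantCoeff_C,
        sub_self]) (h0 i)
    convert this using 1
    simp [Derivation.leibniz, pderiv_X, Pi.single_apply, sub_mul, apply_ite constantCoeff,
      apply_ite C, ite_mul]

theorem homogeneousComponent_mul_mem {e : ℕ}
    (ih : ∀ d < e, ∀ t ∈ invariants H, homogeneousComponent d t ∈ invariants G)
    {a b : MvPolynomial (Fin n) k} (ha : a ∈ invariants H) (hb : b ∈ invariants H)
    (ha0 : constantCoeff a = 0) (hb0 : constantCoeff b = 0) :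
    homogeneousComponent e (a * b) ∈ invariants G := by
  conv =>
    enter [2]
    rw [← sum_homogeneousComponent b, Finset.mul_sum, map_sum]
  refine sum_mem fun d _ => ?_
  rw [homogeneousComponent_mul_of_isHomogeneous (homogeneousComponent_isHomogeneous d b)]
  split_ifs with hd
  · rcases Nat.eq_zero_or_pos d with rfl | hd0
    · simp [homogeneousComponent_zero, ← constantCoeff_eq, hb0]
    rcases hd.eq_or_lt with rfl | hlt
    · simp [homogeneousComponent_zero, ← constantCoeff_eq, ha0]
    · exact mul_mem (ih _ (by lia) a ha) (ih d hlt b hb)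
  · exact zero_mem _

theorem invariants_le_of_isUnit_det_jacobianAt (h0 : ∀ j, constantCoeff (h j) = 0)
    (hhH : Algebra.adjoin k (Set.range h) = invariants H)
    {F : Fin n → MvPolynomial (Fin n) k} (hF : ∀ i, aeval h (F i) ∈ invariants G)
    (hdet : IsUnit (jacobianAt h F).det) : invariants H ≤ invariants G := by
  set A : Matrix (Fin n) (Fin n) k := constantCoeff.mapMatrix (jacobianAt h F) with hA
  have hAdet : IsUnit A.det := by
    rw [hA, ← RingHom.map_det]
    exact hdet.map _
  have hAij : ∀ i j, constantCoeff (pderiv j (F i)) = A i j := fun i j =>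
    (constantCoeff_aeval_of_constantCoeff_eq_zero h0 _).symm
  have hcomp : ∀ e, ∀ t ∈ invariants H, homogeneousComponent e t ∈ invariants G := by
    intro e
    induction e using Nat.strong_induction_on with
    | _ e ih =>
    let W : Submodule k (MvPolynomial (Fin n) k) :=
      (Subalgebra.toSubmodule (invariants G)).comap (homogeneousComponent e)
    have hCW : ∀ c : k, C c ∈ W := fun c =>
      homogeneousComponent_mem_invariants (Subalgebra.algebraMap_mem (invariants G) c) e
    have hlin := aeval_sub_linear_mem (W := W) h0 fun a ha b hb =>
      homogeneousComponent_mul_mem ih (hhH.le ha) (hhH.le hb)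
    have hAh : ∀ i, ∑ j, C (A i j) * h j ∈ W := fun i => by
      have hFW : aeval h (F i) ∈ W := homogeneousComponent_mem_invariants (hF i) e
      have := sub_mem (sub_mem hFW (hCW (constantCoeff (F i)))) (hlin (F i))
      simpa only [sub_sub_cancel, hAij] using this
    have hhW : ∀ j, h j ∈ W := fun j => by
      have hsum : ∑ i, A⁻¹ j i • ∑ l, C (A i l) * h l ∈ W :=
        sum_mem fun i _ => W.smul_mem _ (hAh i)
      have hinv : ∑ i, A⁻¹ j i • ∑ l, C (A i l) * h l = h j := by
        simp only [← smul_eq_C_mul, Finset.smul_sum, smul_smul]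
        rw [Finset.sum_comm]
        simp only [← Finset.sum_smul, ← Matrix.mul_apply, Matrix.nonsing_inv_mul _ hAdet,
          Matrix.one_apply, ite_smul, one_smul, zero_smul, Finset.sum_ite_eq, Finset.mem_univ,
          if_true]
      rwa [hinv] at hsum
    intro t ht
    have ht' := hhH.ge ht
    rw [Algebra.adjoin_range_eq_range_aeval] at ht'
    obtain ⟨P, rfl⟩ := ht'
    have hsum : ∑ j, C (constantCoeff (pderiv j P)) * h j ∈ W := sum_mem fun j _ => by
      rw [← smul_eq_C_mul]
      exact W.smul_mem _ (hhW j)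
    have := add_mem (add_mem (hlin P) hsum) (hCW (constantCoeff P))
    rwa [sub_add_cancel, sub_add_cancel] at this
  intro t ht
  rw [← sum_homogeneousComponent t]
  exact sum_mem fun e _ => hcomp e t ht

/-- The pseudo-reflections contained in a group. -/
def reflections (G : Subgroup (GL (Fin n) k)) : Set (GL (Fin n) k) :=
  {g | g ∈ G ∧ g ≠ 1 ∧ HasFixedHyperplane g}

/-- If the invariants of `G` are generated by `n` elements, then `G` is generated by its
pseudo-reflections. -/
theorem closure_reflections_eq [Finite G] (hG : (Nat.card G : k) ≠ 0)
    (hf : Algebra.adjoin k (Set.range f) = invariants G) :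
    Subgroup.closure (reflections G) = G := by
  set H := Subgroup.closure (reflections G) with hHdef
  have hHG : H ≤ G := (Subgroup.closure_le G).mpr fun g hg => hg.1
  have : Finite H := Finite.of_injective _ (Subgroup.inclusion_injective hHG)
  have hH : (Nat.card H : k) ≠ 0 := fun h0 => hG <| by
    obtain ⟨m, hm⟩ := Subgroup.card_dvd_of_le hHG
    rw [hm, Nat.cast_mul, h0, zero_mul]
  obtain ⟨h, h0, hh, hhH⟩ :=
    exists_algebraicIndependent_generators hH (fun g hg => hg.2.2) hHdef.symm
  have hfG : ∀ i, f i ∈ invariants G := fun i => hf ▸ Algebra.subset_adjoin ⟨i, rfl⟩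
  have hF : ∀ i, ∃ P, aeval h P = f i := fun i => by
    have := hhH.ge (invariants_anti hHG (hfG i))
    rwa [Algebra.adjoin_range_eq_range_aeval] at this
  choose F hF using hF
  have hle : invariants H ≤ invariants G :=
    invariants_le_of_isUnit_det_jacobianAt h0 hhH (fun i => hF i ▸ hfG i) <|
      isUnit_det_jacobianAt hHG (fun g hg hg1 hgf => Subgroup.subset_closure ⟨hg, hg1, hgf⟩)
        hh hhH hf.ge hF
  refine le_antisymm hHG fun σ hσ => ?_
  by_contra hσH
  obtain ⟨t, ht, hne⟩ := exists_invariant_map_smul_ne (φ := RingHom.id (MvPolynomial (Fin n) k))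
    hHG (fun g _ hg => by rw [eq_one_of_gl_smul_eq hg]; exact one_mem H) hσ hσH
  exact hne (hle ht σ hσ)

/-- The invariants for an action by linear substitutions. -/
theorem invariantSubalgebra_eq_invariants
    (ψ : ↥G →* (MvPolynomial (Fin n) k ≃ₐ[k] MvPolynomial (Fin n) k))
    (hψ : ∀ (g : ↥G) (j : Fin n),
      ψ g (X j) =
        ∑ i, C (((g : GL (Fin n) k) : Matrix (Fin n) (Fin n) k) i j) * X i) :
    invariantSubalgebra ψ = invariants G := by
  have key : ∀ (g : G) p, ψ g p = (g : GL (Fin n) k) • p := fun g p => by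
    have : (ψ g : MvPolynomial (Fin n) k →ₐ[k] MvPolynomial (Fin n) k) =
        linSubst ((g : GL (Fin n) k) : Matrix (Fin n) (Fin n) k) :=
      MvPolynomial.algHom_ext fun j => (hψ g j).trans (linSubst_X _ j).symm
    exact DFunLike.congr_fun this p
  ext p
  exact ⟨fun hp g hg => (key ⟨g, hg⟩ p).symm.trans (hp ⟨g, hg⟩),
    fun hp g => (key g p).trans (hp g g.2)⟩

theorem exists_generators_of_algEquiv {A : Subalgebra k (MvPolynomial (Fin n) k)}
    (e : A ≃ₐ[k] MvPolynomial (Fin n) k) :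
    ∃ f : Fin n → MvPolynomial (Fin n) k, Algebra.adjoin k (Set.range f) = A := by
  refine ⟨fun i => e.symm (X i), ?_⟩
  have : (fun i => (e.symm (X i) : MvPolynomial (Fin n) k)) =
      (A.val.comp (e.symm : MvPolynomial (Fin n) k →ₐ[k] A)) ∘ X := rfl
  rw [this, Set.range_comp, ← AlgHom.map_adjoin, adjoin_range_X, Algebra.map_top]
  refine le_antisymm ?_ fun a ha => ⟨e ⟨a, ha⟩, by simp⟩
  rintro _ ⟨P, rfl⟩
  exact (e.symm P).2

end Comparison

end PolynomialInvariants

end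

/-- **The Chevalley–Shephard–Todd theorem.**
Let `k` be a field and `V = k^n` a finite-dimensional `k`-vector space, and let `G` be a finite
subgroup of `GL(V) = GL_n(k)` whose order is invertible in `k` (i.e. `char k` does not divide
`|G|`).  `G` acts by `k`-algebra automorphisms on the algebra of polynomial functions on `V`
(the symmetric algebra `S(V*)`, here the polynomial ring `k[x_1, …, x_n]`) by linear
substitutions `g • x_j = ∑ i, g i j • x_i`, encoded by the homomorphism `ψ`.  Then the
invariant ring `S(V*)^G` is isomorphic as a `k`-algebra to a polynomial ring in `dim V = n`
variables if and only if `G` is generated by pseudo-reflections, i.e. by elements `g ≠ 1` whose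
fixed subspace `ker (g - 1)` has codimension `1` in `V`. -/
theorem chevalley_shephard_todd
    (k : Type*) [Field k] (n : ℕ)
    (G : Subgroup (GL (Fin n) k)) [Finite G]
    (hord : (Nat.card G : k) ≠ 0)
    (ψ : ↥G →* (MvPolynomial (Fin n) k ≃ₐ[k] MvPolynomial (Fin n) k))
    (hψ : ∀ (g : ↥G) (j : Fin n),
      ψ g (X j) =
        ∑ i, C (((g : GL (Fin n) k) : Matrix (Fin n) (Fin n) k) i j) * X i) :
    Nonempty (↥(invariantSubalgebra ψ) ≃ₐ[k] MvPolynomial (Fin n) k) ↔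
      Subgroup.closure
        {g : GL (Fin n) k | g ∈ G ∧ g ≠ 1 ∧
          Module.finrank k
            ↥(LinearMap.ker (Matrix.mulVecLin ((g : Matrix (Fin n) (Fin n) k) - 1))) + 1 = n}
        = G := by
  have hψG := PolynomialInvariants.invariantSubalgebra_eq_invariants ψ hψ
  refine ⟨fun ⟨e⟩ => ?_, fun hcl => ?_⟩
  · obtain ⟨f, hf⟩ := PolynomialInvariants.exists_generators_of_algEquiv e
    exact PolynomialInvariants.closure_reflections_eq hord (hf.trans hψG)
  · obtain ⟨f, -, hf, hfG⟩ :=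
      PolynomialInvariants.exists_algebraicIndependent_generators hord (fun g hg => hg.2.2) hcl
    exact ⟨(Subalgebra.equivOfEq _ _ (hψG.trans hfG.symm)).trans hf.aevalEquiv.symm⟩
end
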